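/- arXiv:1510.00588 — 4 statements merged into one kernel-verified Lean document; each statement's English description precedes it below -/
import Mathlib

section
/- Let P be an r-differential poset and n ≥ 0. Then the matrix [DU_n] + x·I_{p_n} has Smith normal form over ℤ[x] if and only if the operator DU_n : ℤP_n → ℤP_n has rational canonical form over ℤ. -/
open Polynomial

/-- A rectangular matrix over a commutative ring has Smith normal form: there are
invertible matrices `P`, `Q` such that `P * A * Q` is diagonal with diagonal entries
forming a divisibility chain. -/
def Matrix.HasSNF {R : Type*} [CommRing R] {m n : ℕ} (A : Matrix (Fin m) (Fin n) R) : Prop :=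
  ∃ (P : Matrix (Fin m) (Fin m) R) (Q : Matrix (Fin n) (Fin n) R),
    IsUnit P ∧ IsUnit Q ∧
    (∀ (i : Fin m) (j : Fin n), (i : ℕ) ≠ (j : ℕ) → (P * A * Q) i j = 0) ∧
    (∀ (i : ℕ) (h₁ : i + 1 < m) (h₂ : i + 1 < n),
      (P * A * Q) ⟨i, Nat.lt_of_succ_lt h₁⟩ ⟨i, Nat.lt_of_succ_lt h₂⟩ ∣
        (P * A * Q) ⟨i + 1, h₁⟩ ⟨i + 1, h₂⟩)

/-- SNF for matrices with arbitrary finite index types. -/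
def Matrix.HasSNF' {ι κ R : Type*} [Fintype ι] [Fintype κ] [CommRing R]
    (A : Matrix ι κ R) : Prop :=
  ∃ (eι : ι ≃ Fin (Fintype.card ι)) (eκ : κ ≃ Fin (Fintype.card κ)),
    Matrix.HasSNF (Matrix.reindex eι eκ A)
/-- An endomorphism `φ` of a `ℤ`-module `M` (equivalently, the `ℤ[x]`-module `(M, φ)` where
`x` acts as `φ`) has rational canonical form over `ℤ`: `M` is an internal direct sum of
cyclic `ℤ[x]`-submodules whose annihilators are generated by monic non-constant polynomials
`a_1 ∣ a_2 ∣ ... ∣ a_k`. -/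
def Module.End.HasRCF {M : Type*} [AddCommGroup M] [Module ℤ M] (φ : Module.End ℤ M) : Prop :=
  ∃ (k : ℕ) (V : Fin k → Submodule ℤ[X] (Module.AEval' φ)) (a : Fin k → ℤ[X]),
    (∀ i, (a i).Monic) ∧ (∀ i, 0 < (a i).natDegree) ∧
    (∀ i j : Fin k, i ≤ j → a i ∣ a j) ∧
    (∀ i, ∃ v : Module.AEval' φ, V i = Submodule.span ℤ[X] {v}) ∧
    (∀ i, (V i).annihilator = Ideal.span {a i}) ∧
    DirectSum.IsInternal V
/-- An `r`-differential poset. -/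
structure DiffPoset (r : ℕ) where
  P : Type
  [po : PartialOrder P]
  locallyFinite : ∀ x y : P, (Set.Icc x y).Finite
  rk : P → ℕ
  fiberFinite : ∀ n : ℕ, {x : P | rk x = n}.Finite
  bot : P
  bot_le : ∀ x : P, bot ≤ x
  rk_bot : rk bot = 0
  rk_covBy : ∀ {x y : P}, x ⋖ y → rk y = rk x + 1
  d2 : ∀ {x y : P}, x ≠ y →
      {z : P | z ⋖ x ∧ z ⋖ y}.ncard = {z : P | x ⋖ z ∧ y ⋖ z}.ncard
  d3 : ∀ x : P, {z : P | x ⋖ z}.ncard = {z : P | z ⋖ x}.ncard + r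

attribute [instance] DiffPoset.po

namespace DiffPoset

variable {r : ℕ} (D : DiffPoset r)

/-- The `n`-th rank `P_n` of the poset. -/
abbrev level (n : ℕ) : Type := {x : D.P // D.rk x = n}

noncomputable instance (n : ℕ) : Fintype (D.level n) := (D.fiberFinite n).fintype

noncomputable instance (n : ℕ) : DecidableEq (D.level n) := Classical.decEq _

noncomputable instance (x y : D.P) : Decidable (x ⋖ y) := Classical.dec _

/-- The rank size `p_n`. -/
noncomputable def p (n : ℕ) : ℕ := Fintype.card (D.level n)

/-- The matrix of the up map `U_n` in the standard basis. -/
noncomputable def upMatrix (R : Type*) [CommRing R] (n : ℕ) :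
    Matrix (D.level (n + 1)) (D.level n) R :=
  fun y x => if (x : D.P) ⋖ (y : D.P) then 1 else 0

/-- The matrix of the down map `D_{n+1}` in the standard basis. -/
noncomputable def downMatrix (R : Type*) [CommRing R] (n : ℕ) :
    Matrix (D.level n) (D.level (n + 1)) R :=
  fun y x => if (y : D.P) ⋖ (x : D.P) then 1 else 0

/-- The up map `U_n : RP_n → RP_{n+1}`. -/
noncomputable def up (R : Type*) [CommRing R] (n : ℕ) :
    (D.level n → R) →ₗ[R] (D.level (n + 1) → R) :=
  (D.upMatrix R n).mulVecLin

/-- The down map `D_{n+1} : RP_{n+1} → RP_n`. -/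
noncomputable def down (R : Type*) [CommRing R] (n : ℕ) :
    (D.level (n + 1) → R) →ₗ[R] (D.level n → R) :=
  (D.downMatrix R n).mulVecLin

/-- The operator `DU_n = D_{n+1} ∘ U_n`. -/
noncomputable def du (R : Type*) [CommRing R] (n : ℕ) :
    Module.End R (D.level n → R) :=
  (D.down R n) ∘ₗ (D.up R n)

/-- The matrix `[DU_n]` in the standard basis. -/
noncomputable def duMatrix (R : Type*) [CommRing R] (n : ℕ) :
    Matrix (D.level n) (D.level n) R :=
  D.downMatrix R n * D.upMatrix R n

/-- The operator `UD_n = U_{n-1} ∘ D_n` (zero for `n = 0`). -/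
noncomputable def ud (R : Type*) [CommRing R] : (n : ℕ) → Module.End R (D.level n → R)
  | 0 => 0
  | (n + 1) => (D.up R n) ∘ₗ (D.down R n)

/-- The matrix `[UD_n]` in the standard basis (zero for `n = 0`). -/
noncomputable def udMatrix (R : Type*) [CommRing R] :
    (n : ℕ) → Matrix (D.level n) (D.level n) R
  | 0 => 0
  | (n + 1) => D.upMatrix R n * D.downMatrix R n

/-- The rank size difference `Δp_n = p_n - p_{n-1}` (with `p_{-1} = 0`), as an integer. -/
noncomputable def dp : ℕ → ℤ
  | 0 => (D.p 0 : ℤ)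
  | (n + 1) => (D.p (n + 1) : ℤ) - (D.p n : ℤ)

/-- The rank size difference `Δp_n = p_n - p_{n-1}` (with `p_{-1} = 0`), as a natural number. -/
noncomputable def dpN : ℕ → ℕ
  | 0 => D.p 0
  | (n + 1) => D.p (n + 1) - D.p n

end DiffPoset

/-- A module over `ℤ[X]` presented by a diagonal matrix with divisibility chain `s` has a
rational canonical form, as soon as all leading coefficients of `s` are units. -/
theorem Module.End.hasRCF_of_diagonal_presentation {M : Type*} [AddCommGroup M] [Module ℤ M]
    (φ : Module.End ℤ M) {N : ℕ} (s : Fin N → ℤ[X])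
    (ψ : (Fin N → ℤ[X]) →ₗ[ℤ[X]] Module.AEval' φ) (hψ : Function.Surjective ψ)
    (hker : ∀ q, ψ q = 0 ↔ ∀ i, s i ∣ q i) (hs : ∀ i j, i ≤ j → s i ∣ s j)
    (hlead : ∀ i, IsUnit (s i).leadingCoeff) : φ.HasRCF := by
  classical
  have hmonic : ∀ i, ∃ a : ℤ[X], a.Monic ∧ Associated a (s i) := fun i =>
    ⟨(hlead i).unit⁻¹ • s i, monic_of_isUnit_leadingCoeff_inv_smul _, by
      refine associated_of_dvd_dvd ⟨C ((hlead i).unit : ℤ), ?_⟩ ⟨C ((hlead i).unit⁻¹ : ℤˣ).val, ?_⟩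
      · rw [Units.smul_def, smul_eq_C_mul, mul_right_comm, ← C_mul]
        simp only [Units.inv_mul, C_1, one_mul]
      · rw [Units.smul_def, smul_eq_C_mul, mul_comm]⟩
  choose a ha hassoc using hmonic
  have hsingle : ∀ (i : Fin N) (q : ℤ[X]), ψ (Pi.single i q) = q • ψ (Pi.single i 1) := by
    intro i q
    rw [← map_smul, ← Pi.single_smul, smul_eq_mul, mul_one]
  have hsmul : ∀ (i : Fin N) (q : ℤ[X]), q • ψ (Pi.single i 1) = 0 ↔ s i ∣ q := by
    intro i q
    rw [← hsingle, hker]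
    refine ⟨fun h => by simpa using h i, fun h j => ?_⟩
    rcases eq_or_ne j i with rfl | hj
    · simpa using h
    · simp [hj]
  let T : Finset (Fin N) := Finset.univ.filter fun i => ¬ IsUnit (s i)
  let o : Fin T.card ≃o T := T.orderIsoOfFin rfl
  have hT : ∀ i, i ∉ T → ψ (Pi.single i 1) = 0 := by
    intro i hi
    have hu : IsUnit (s i) := by simpa [T] using hi
    rw [← one_smul ℤ[X] (ψ _), hsmul]
    exact hu.dvd
  refine ⟨T.card, fun i => Submodule.span ℤ[X] {ψ (Pi.single (o i : Fin N) 1)}, fun i => a (o i),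
    fun i => ha _, fun i => ?_, fun i j hij => ?_, fun i => ⟨_, rfl⟩, fun i => ?_, ?_⟩
  · refine (ha _).natDegree_pos_of_not_isUnit fun h => ?_
    exact (Finset.mem_filter.1 (o i).2).2 ((hassoc _).isUnit h)
  · exact ((hassoc _).dvd_iff_dvd_left.2 ((hassoc _).dvd_iff_dvd_right.2 (hs _ _ (o.monotone hij))))
  · ext q
    rw [Submodule.mem_annihilator_span_singleton, hsmul, Ideal.mem_span_singleton]
    exact (hassoc _).symm.dvd_iff_dvd_left
  · apply DirectSum.isInternal_submodule_of_iSupIndep_of_iSup_eq_top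
    · rw [iSupIndep_iff_finsetSum_eq_zero_imp_eq_zero]
      intro S v hv hsum i hi
      have hv' : ∀ i, ∃ q : ℤ[X], i ∈ S → q • ψ (Pi.single (o i : Fin N) 1) = v i := by
        intro i
        by_cases h : i ∈ S
        · obtain ⟨q, hq⟩ := Submodule.mem_span_singleton.1 (hv i h)
          exact ⟨q, fun _ => hq⟩
        · exact ⟨0, fun h' => (h h').elim⟩
      choose q hq using hv'
      rw [← hq i hi, hsmul]
      have h0 : ψ (∑ i ∈ S, Pi.single (o i : Fin N) (q i)) = 0 := by
        rw [map_sum, ← hsum]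
        exact Finset.sum_congr rfl fun j hj => by rw [hsingle, hq j hj]
      have h1 := (hker _).1 h0 (o i)
      rw [Finset.sum_apply, Finset.sum_eq_single_of_mem i hi] at h1
      · simpa using h1
      · intro j _ hj
        refine Pi.single_eq_of_ne (fun h => hj ?_) _
        exact (o.injective (Subtype.ext h)).symm
    · rw [eq_top_iff]
      rintro m -
      obtain ⟨q, rfl⟩ := hψ m
      rw [← Finset.univ_sum_single q, map_sum]
      refine Submodule.sum_mem _ fun i _ => ?_
      rw [hsingle]
      refine Submodule.smul_mem _ _ ?_
      by_cases hi : i ∈ T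
      · refine Submodule.mem_iSup_of_mem (o.symm ⟨i, hi⟩) ?_
        simp [Submodule.mem_span_singleton_self]
      · rw [hT i hi]
        exact Submodule.zero_mem _

section Presentation

variable {R M : Type*} [CommRing R] [AddCommGroup M] [Module R M] {ι : Type*} [Fintype ι]
  [DecidableEq ι]

/-- The canonical presentation `R[X]^ι → (M, φ)` attached to a basis of `M`. -/
noncomputable def Module.AEval'.presentation (b : Module.Basis ι R M) (φ : Module.End R M) :
    (ι → R[X]) →ₗ[R[X]] Module.AEval' φ :=
  Fintype.linearCombination R[X] fun i => Module.AEval'.of φ (b i)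

/-- The constant polynomial vector attached to the coordinates of an element of `M`. -/
noncomputable def Module.Basis.constVec (b : Module.Basis ι R M) : M →ₗ[R] (ι → R[X]) :=
  LinearMap.pi fun i => (Algebra.linearMap R R[X]) ∘ₗ b.coord i

omit [Fintype ι] [DecidableEq ι] in
theorem Module.Basis.constVec_apply (b : Module.Basis ι R M) (m : M) (i : ι) :
    b.constVec m i = C (b.repr m i) := rfl

omit [Fintype ι] in
theorem Module.Basis.constVec_self (b : Module.Basis ι R M) (i : ι) :
    b.constVec (b i) = Pi.single i 1 := by
  ext1 j
  rw [constVec_apply, b.repr_self, Finsupp.single_apply, Pi.single_apply]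
  simp only [eq_comm (a := j)]
  split_ifs <;> simp

omit [DecidableEq ι] in
theorem Module.AEval'.presentation_constVec (b : Module.Basis ι R M) (φ : Module.End R M) (m : M) :
    presentation b φ (b.constVec m) = Module.AEval'.of φ m := by
  rw [presentation, Fintype.linearCombination_apply]
  conv_rhs => rw [← b.sum_repr m, map_sum]
  refine Finset.sum_congr rfl fun i _ => ?_
  rw [b.constVec_apply, map_smul]
  exact Module.AEval.C_smul _ _ _

theorem Module.Basis.charmatrix_mulVec_constVec (b : Module.Basis ι R M) (φ : Module.End R M)
    (m : M) : (LinearMap.toMatrix b b φ).charmatrix.mulVec (b.constVec m) =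
      (X : R[X]) • b.constVec m - b.constVec (φ m) := by
  ext1 i
  rw [Matrix.charmatrix, Matrix.sub_mulVec, Pi.sub_apply, Pi.sub_apply, Pi.smul_apply]
  congr 1
  · simp [Matrix.mulVec_diagonal]
  · rw [b.constVec_apply, ← LinearMap.toMatrix_mulVec_repr b b φ m]
    simp [Matrix.mulVec, dotProduct, b.constVec_apply]

omit [DecidableEq ι] in
theorem Module.AEval'.presentation_surjective (b : Module.Basis ι R M) (φ : Module.End R M) :
    Function.Surjective (presentation b φ) := fun m =>
  ⟨b.constVec ((Module.AEval'.of φ).symm m), by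
    rw [presentation_constVec, LinearEquiv.apply_symm_apply]⟩

theorem Module.AEval'.presentation_charmatrix_mulVec (b : Module.Basis ι R M)
    (φ : Module.End R M) (q : ι → R[X]) :
    presentation b φ ((LinearMap.toMatrix b b φ).charmatrix.mulVec q) = 0 := by
  suffices h : presentation b φ ∘ₗ (LinearMap.toMatrix b b φ).charmatrix.mulVecLin = 0 from
    LinearMap.congr_fun h q
  refine (Pi.basisFun R[X] ι).ext fun i => ?_
  rw [Pi.basisFun_apply, ← b.constVec_self, LinearMap.comp_apply, Matrix.mulVecLin_apply,
    b.charmatrix_mulVec_constVec, map_sub, map_smul, presentation_constVec, presentation_constVec,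
    X_smul_of, sub_self, LinearMap.zero_apply]

/-- The kernel of the presentation of `(M, φ)` is the image of the characteristic matrix. -/
theorem Module.AEval'.presentation_eq_zero_iff (b : Module.Basis ι R M) (φ : Module.End R M)
    (q : ι → R[X]) :
    presentation b φ q = 0 ↔ ∃ w, (LinearMap.toMatrix b b φ).charmatrix.mulVec w = q := by
  set A := (LinearMap.toMatrix b b φ).charmatrix with hA
  refine ⟨fun hq => ?_, fun ⟨w, hw⟩ => hw ▸ presentation_charmatrix_mulVec b φ w⟩
  have hpow : ∀ (n : ℕ) (m : M), ∃ w, (X ^ n : R[X]) • b.constVec m =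
      b.constVec ((φ ^ n) m) + A.mulVec w := by
    intro n m
    induction n with
    | zero => exact ⟨0, by simp⟩
    | succ n ih =>
      obtain ⟨w, hw⟩ := ih
      refine ⟨(X : R[X]) • w + b.constVec ((φ ^ n) m), ?_⟩
      rw [pow_succ', mul_smul, hw, smul_add, Matrix.mulVec_add, Matrix.mulVec_smul,
        hA, b.charmatrix_mulVec_constVec, pow_succ', Module.End.mul_apply]
      abel
  have hconst : ∀ q : ι → R[X], ∃ m w, q = b.constVec m + A.mulVec w := by
    have hadd : ∀ q q' : ι → R[X], (∃ m w, q = b.constVec m + A.mulVec w) →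
        (∃ m w, q' = b.constVec m + A.mulVec w) →
        ∃ m w, q + q' = b.constVec m + A.mulVec w := by
      rintro _ _ ⟨m, w, rfl⟩ ⟨m', w', rfl⟩
      refine ⟨m + m', w + w', ?_⟩
      rw [map_add, Matrix.mulVec_add]
      abel
    intro q
    induction q using Pi.single_induction with
    | zero => exact ⟨0, 0, by simp⟩
    | add q q' hq hq' => exact hadd q q' hq hq'
    | single i p =>
      induction p using Polynomial.induction_on' with
      | add p p' hp hp' => rw [Pi.single_add]; exact hadd _ _ hp hp'
      | monomial n c =>
        obtain ⟨w, hw⟩ := hpow n (c • b i)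
        refine ⟨(φ ^ n) (c • b i), w, ?_⟩
        rw [← hw, map_smul, b.constVec_self, ← C_mul_X_pow_eq_monomial]
        ext1 j
        rcases eq_or_ne j i with rfl | hj
        · rw [Pi.single_eq_same, Pi.smul_apply, Pi.smul_apply, Pi.single_eq_same, smul_eq_mul,
            smul_eq_C_mul, mul_one, mul_comm]
        · simp [hj]
  obtain ⟨m, w, rfl⟩ := hconst q
  rw [map_add, presentation_charmatrix_mulVec, add_zero, presentation_constVec,
    LinearEquiv.map_eq_zero_iff] at hq
  exact ⟨w, by rw [hq, map_zero, zero_add]⟩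

omit [Fintype ι] [DecidableEq ι] in
theorem Module.AEval'.constVec_symm_smul (b : Module.Basis ι R M) (φ : Module.End R M)
    (v : Module.AEval' φ) {q : R[X]} {d : ℕ} (hq : q.natDegree < d) :
    b.constVec ((Module.AEval'.of φ).symm (q • v)) = ∑ j ∈ Finset.range d,
      (C (q.coeff j) : R[X]) • b.constVec ((φ ^ j) ((Module.AEval'.of φ).symm v)) := by
  have hsymm : (Module.AEval'.of φ).symm (q • v) =
      aeval φ q ((Module.AEval'.of φ).symm v) := Module.AEval.of_symm_smul φ q v
  rw [hsymm, aeval_eq_sum_range' hq, LinearMap.sum_apply, map_sum]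
  refine Finset.sum_congr rfl fun j _ => ?_
  rw [LinearMap.smul_apply, map_smul]
  exact (algebraMap_smul R[X] (q.coeff j) _).symm

end Presentation

theorem Module.End.hasRCF_of_hasSNF {M : Type*} [AddCommGroup M] [Module ℤ M] {N : ℕ}
    (b : Module.Basis (Fin N) ℤ M) (φ : Module.End ℤ M)
    (h : (LinearMap.toMatrix b b φ).charmatrix.HasSNF) : φ.HasRCF := by
  obtain ⟨P, Q, hP, hQ, hdiag, hchain⟩ := h
  set A := (LinearMap.toMatrix b b φ).charmatrix with hA
  let s : Fin N → ℤ[X] := fun i => (P * A * Q) i i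
  have hS : P * A * Q = Matrix.diagonal s := by
    ext1 i j
    rcases eq_or_ne i j with rfl | hij
    · simp [s]
    · rw [Matrix.diagonal_apply_ne _ hij, hdiag i j fun h => hij (Fin.ext h)]
  have hPd : IsUnit P.det := (Matrix.isUnit_iff_isUnit_det P).1 hP
  have hQd : IsUnit Q.det := (Matrix.isUnit_iff_isUnit_det Q).1 hQ
  refine hasRCF_of_diagonal_presentation φ s
    (Module.AEval'.presentation b φ ∘ₗ P⁻¹.mulVecLin) ?_ ?_ ?_ ?_
  · refine (Module.AEval'.presentation_surjective b φ).comp fun q => ⟨P.mulVec q, ?_⟩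
    rw [Matrix.mulVecLin_apply, Matrix.mulVec_mulVec, Matrix.nonsing_inv_mul _ hPd,
      Matrix.one_mulVec]
  · intro q
    rw [LinearMap.comp_apply, Matrix.mulVecLin_apply, Module.AEval'.presentation_eq_zero_iff,
      ← hA]
    constructor
    · rintro ⟨w, hw⟩ i
      refine ⟨(Q⁻¹.mulVec w) i, ?_⟩
      rw [← Matrix.mulVec_diagonal, ← hS, Matrix.mulVec_mulVec, Matrix.mul_assoc,
        Matrix.mul_nonsing_inv _ hQd, Matrix.mul_one, ← Matrix.mulVec_mulVec, hw,
        Matrix.mulVec_mulVec, Matrix.mul_nonsing_inv _ hPd, Matrix.one_mulVec]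
    · intro hq
      choose w hw using hq
      refine ⟨Q.mulVec w, ?_⟩
      have hq' : q = (P * A * Q).mulVec w := by
        rw [hS]
        ext1 i
        rw [Matrix.mulVec_diagonal, hw]
      rw [hq', Matrix.mulVec_mulVec, Matrix.mulVec_mulVec, Matrix.mul_assoc P,
        Matrix.nonsing_inv_mul_cancel_left _ _ hPd]
  · intro i j hij
    have hstep : ∀ (n : ℕ) (hn : n < N), (i : ℕ) ≤ n → s i ∣ s ⟨n, hn⟩ := by
      intro n hn hin
      induction n, hin using Nat.le_induction with
      | base => exact dvd_rfl
      | succ n _ ih => exact (ih (Nat.lt_of_succ_lt hn)).trans (hchain n hn hn)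
    exact hstep j j.2 hij
  · intro i
    refine (Matrix.charpoly_monic (LinearMap.toMatrix b b φ)).isUnit_leadingCoeff_of_dvd ?_
    have h1 : s i ∣ P.det * A.det * Q.det := by
      rw [← Matrix.det_mul, ← Matrix.det_mul, hS, Matrix.det_diagonal]
      exact Finset.dvd_prod_of_mem s (Finset.mem_univ i)
    rwa [hQd.dvd_mul_right, hPd.dvd_mul_left] at h1

theorem Module.Basis.sum_natDegree_eq_card_of_isInternal {M : Type*} [AddCommGroup M]
    [Module ℤ M] {ι : Type*} [Fintype ι] (b : Module.Basis ι ℤ M) (φ : Module.End ℤ M) {k : ℕ}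
    (v : Fin k → Module.AEval' φ) (a : Fin k → ℤ[X]) (ha : ∀ i, (a i).Monic)
    (hann : ∀ i, (Submodule.span ℤ[X] {v i}).annihilator = Ideal.span {a i})
    (hV : DirectSum.IsInternal fun i => Submodule.span ℤ[X] {v i}) :
    ∑ i, (a i).natDegree = Fintype.card ι := by
  classical
  have hquot : ∀ i, Ideal.torsionOf ℤ[X] _ (v i) = Ideal.span {a i} := by
    intro i
    ext q
    rw [← hann, Submodule.mem_annihilator_span_singleton, Ideal.mem_torsionOf_iff]
  let e₁ : (i : Fin k) → AdjoinRoot (a i) ≃+ Submodule.span ℤ[X] {v i} := fun i =>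
    ((Submodule.quotEquivOfEq _ _ (hquot i).symm).trans
      (Ideal.quotTorsionOfEquivSpanSingleton ℤ[X] _ (v i))).toAddEquiv
  let e₂ : (Π i, AdjoinRoot (a i)) ≃+ M :=
    (AddEquiv.piCongrRight e₁).trans
      (((DirectSum.linearEquivFunOnFintype ℤ[X] (Fin k) _).symm.trans
        (LinearEquiv.ofBijective (DirectSum.coeLinearMap _) hV)).toAddEquiv)
  have hfree : ∀ i, Module.Free ℤ (AdjoinRoot (a i)) := fun i =>
    .of_basis (AdjoinRoot.powerBasis' (ha i)).basis
  have hfin : ∀ i, Module.Finite ℤ (AdjoinRoot (a i)) := fun i =>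
    .of_basis (AdjoinRoot.powerBasis' (ha i)).basis
  rw [← Module.finrank_eq_card_basis b, ← e₂.toIntLinearEquiv.finrank_eq,
    Module.finrank_pi_fintype]
  exact Finset.sum_congr rfl fun i _ => by
    rw [(AdjoinRoot.powerBasis' (ha i)).finrank, AdjoinRoot.powerBasis'_dim]

theorem Module.End.hasSNF_of_hasRCF {M : Type*} [AddCommGroup M] [Module ℤ M] {N : ℕ}
    (b : Module.Basis (Fin N) ℤ M) (φ : Module.End ℤ M) (h : φ.HasRCF) :
    (LinearMap.toMatrix b b φ).charmatrix.HasSNF := by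
  classical
  obtain ⟨k, V, a, ha, -, hdvd, hcyc, hann, hV⟩ := h
  choose v hv using hcyc
  obtain rfl : V = fun i => Submodule.span ℤ[X] {v i} := funext hv
  set A := (LinearMap.toMatrix b b φ).charmatrix with hA
  let K := Σ i : Fin k, Fin (a i).natDegree
  have hsum : ∑ i, (a i).natDegree = N := by
    simpa using b.sum_natDegree_eq_card_of_isInternal φ v a ha hann hV
  have hcard : Fintype.card K = N := by simp [K, hsum]
  let e₀ : Fin N ≃ K := (Fintype.equivFinOfCardEq hcard).symm
  let g : K → ℕ := fun x => if (x.2 : ℕ) = 0 then x.1 + 1 else 0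
  let τ : Fin N ≃ K := (Tuple.sort (g ∘ e₀)).trans e₀
  have hτ : Monotone (g ∘ τ) := Tuple.monotone_sort (g ∘ e₀)
  let s : K → ℤ[X] := fun x => if (x.2 : ℕ) = 0 then a x.1 else 1
  have hs : ∀ x y, g x ≤ g y → s x ∣ s y := by
    intro x y hxy
    by_cases hx : (x.2 : ℕ) = 0
    · by_cases hy : (y.2 : ℕ) = 0
      · simp only [g, s, if_pos hx, if_pos hy] at hxy ⊢
        exact hdvd _ _ (Fin.le_def.2 (by omega))
      · simp only [g, if_pos hx, if_neg hy] at hxy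
        omega
    · simp only [s, if_neg hx]
      exact one_dvd _
  let u : Fin k → ℕ → Fin N → ℤ[X] := fun i j =>
    b.constVec ((φ ^ j) ((Module.AEval'.of φ).symm (v i)))
  have hAu : ∀ i j, A.mulVec (u i j) = (X : ℤ[X]) • u i j - u i (j + 1) := by
    intro i j
    simp only [u, hA]
    rw [b.charmatrix_mulVec_constVec, pow_succ' φ, Module.End.mul_apply]
  let c : K → Fin N → ℤ[X] := fun x =>
    if (x.2 : ℕ) = 0 then u x.1 0 else A.mulVec (u x.1 (x.2 - 1))
  let T := Submodule.span ℤ[X] (Set.range c)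
  have hu : ∀ i j, j < (a i).natDegree → u i j ∈ T := by
    intro i j hj
    induction j with
    | zero =>
      refine Submodule.subset_span ⟨⟨i, ⟨0, hj⟩⟩, ?_⟩
      simp [c]
    | succ j ih =>
      have h1 : A.mulVec (u i j) ∈ T := by
        refine Submodule.subset_span ⟨⟨i, ⟨j + 1, hj⟩⟩, ?_⟩
        simp [c]
      rw [← sub_sub_self ((X : ℤ[X]) • u i j) (u i (j + 1)), ← hAu]
      exact T.sub_mem (T.smul_mem _ (ih (Nat.lt_of_succ_lt hj))) h1
  have hT' : ∀ x : Module.AEval' φ, b.constVec ((Module.AEval'.of φ).symm x) ∈ T := by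
    intro x
    have hx : x ∈ ⨆ i, Submodule.span ℤ[X] {v i} := hV.submodule_iSup_eq_top ▸ Submodule.mem_top
    induction hx using Submodule.iSup_induction' with
    | zero => rw [map_zero, map_zero]; exact T.zero_mem
    | add x y _ _ hx hy => rw [map_add, map_add]; exact T.add_mem hx hy
    | mem i x hx =>
      obtain ⟨q, rfl⟩ := Submodule.mem_span_singleton.1 hx
      rcases Nat.eq_zero_or_pos (a i).natDegree with h0 | hpos
      · have h1 : (1 : ℤ[X]) ∈ (Submodule.span ℤ[X] {v i}).annihilator := by
          rw [hann, (ha i).natDegree_eq_zero.1 h0]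
          exact Ideal.mem_span_singleton_self 1
        rw [Submodule.mem_annihilator_span_singleton, one_smul] at h1
        rw [h1, smul_zero, map_zero, map_zero]
        exact T.zero_mem
      have hmod : q • v i = (q %ₘ a i) • v i := by
        have h1 : a i * (q /ₘ a i) ∈ (Submodule.span ℤ[X] {v i}).annihilator := by
          rw [hann]
          exact Ideal.mem_span_singleton.2 (dvd_mul_right _ _)
        rw [Submodule.mem_annihilator_span_singleton] at h1
        conv_lhs => rw [← modByMonic_add_div q (a i), add_smul, h1, add_zero]
      have hdeg : (q %ₘ a i).natDegree < (a i).natDegree :=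
        natDegree_modByMonic_lt q (ha i) fun h => by simp [h] at hpos
      rw [hmod, Module.AEval'.constVec_symm_smul b φ (v i) hdeg]
      exact T.sum_mem fun j hj => T.smul_mem _ (hu i j (Finset.mem_range.1 hj))
  have hT : T = ⊤ := by
    rw [eq_top_iff]
    rintro q -
    rw [← Finset.univ_sum_single q]
    refine T.sum_mem fun i _ => ?_
    have h1 := T.smul_mem (q i) (hT' (Module.AEval'.of φ (b i)))
    rwa [LinearEquiv.symm_apply_apply, b.constVec_self, ← Pi.single_smul, smul_eq_mul,
      mul_one] at h1
  have hw : ∀ x, ∃ w, A.mulVec w = s x • c x := by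
    intro x
    by_cases hx : (x.2 : ℕ) = 0
    · rw [hA, ← Module.AEval'.presentation_eq_zero_iff]
      simp only [s, c, u, if_pos hx]
      rw [map_smul, Module.AEval'.presentation_constVec, pow_zero, Module.End.one_apply,
        LinearEquiv.apply_symm_apply, ← Submodule.mem_annihilator_span_singleton, hann]
      exact Ideal.mem_span_singleton_self _
    · exact ⟨u x.1 (x.2 - 1), by simp only [s, c, if_neg hx, one_smul]⟩
  choose w hw using hw
  let P : Matrix (Fin N) (Fin N) ℤ[X] := Matrix.of fun i j => c (τ j) i
  let Q : Matrix (Fin N) (Fin N) ℤ[X] := Matrix.of fun i j => w (τ j) i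
  have hP : IsUnit P := by
    rw [← Matrix.mulVec_surjective_iff_isUnit]
    have h1 : P.mulVecLin.range = ⊤ := by
      rw [Matrix.range_mulVecLin, ← hT]
      change Submodule.span ℤ[X] (Set.range (c ∘ τ)) = _
      rw [τ.surjective.range_comp]
    exact LinearMap.range_eq_top.1 h1
  have hPd : IsUnit P.det := (Matrix.isUnit_iff_isUnit_det P).1 hP
  have hAQ : A * Q = P * Matrix.diagonal (s ∘ τ) := by
    ext1 i j
    rw [Matrix.mul_diagonal]
    have h1 := congrFun (hw (τ j)) i
    rw [Pi.smul_apply, smul_eq_mul, mul_comm] at h1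
    exact h1
  have hprod : ∏ x, s x = ∏ i, a i := by
    rw [Fintype.prod_sigma]
    refine Finset.prod_congr rfl fun i _ => ?_
    rcases Nat.eq_zero_or_pos (a i).natDegree with h0 | hpos
    · have : IsEmpty (Fin (a i).natDegree) := by rw [h0]; infer_instance
      rw [Fintype.prod_empty, (ha i).natDegree_eq_zero.1 h0]
    · rw [Fintype.prod_eq_single ⟨0, hpos⟩]
      · simp [s]
      · intro j hj
        exact if_neg fun h => hj (Fin.ext h)
  have hdet : A.det * Q.det = P.det * ∏ i, a i := by
    rw [← Matrix.det_mul, hAQ, Matrix.det_mul, Matrix.det_diagonal, ← hprod]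
    exact congrArg _ (τ.prod_comp s)
  have hAm : A.det.Monic := Matrix.charpoly_monic _
  have hAdeg : A.det.natDegree = N := by
    exact (Matrix.charpoly_natDegree_eq_dim (LinearMap.toMatrix b b φ)).trans (Fintype.card_fin N)
  have heq : ∏ i, a i = A.det := by
    refine eq_of_monic_of_dvd_of_natDegree_le hAm (monic_prod_of_monic _ _ fun i _ => ha i) ?_ ?_
    · rw [← hPd.dvd_mul_left, ← hdet]
      exact dvd_mul_right _ _
    · rw [natDegree_prod_of_monic _ _ fun i _ => ha i, hsum, hAdeg]
  have hQ : IsUnit Q := by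
    rw [Matrix.isUnit_iff_isUnit_det]
    rw [heq, mul_comm] at hdet
    rwa [mul_right_cancel₀ hAm.ne_zero hdet]
  have hdiag : P⁻¹ * A * Q = Matrix.diagonal (s ∘ τ) := by
    rw [Matrix.mul_assoc, hAQ, Matrix.nonsing_inv_mul_cancel_left _ _ hPd]
  refine ⟨P⁻¹, Q, Matrix.isUnit_nonsing_inv_iff.2 hP, hQ, fun i j hij => ?_, fun i h₁ h₂ => ?_⟩
  · rw [hdiag, Matrix.diagonal_apply_ne _ fun h => hij (congrArg _ h)]
  · rw [hdiag, Matrix.diagonal_apply_eq, Matrix.diagonal_apply_eq]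
    exact hs _ _ (hτ (Fin.le_def.2 (Nat.le_succ i)))

namespace Matrix

variable {R ι : Type*} [CommRing R] [Fintype ι]

/-- For a square matrix, the two reindexings in `HasSNF'` may be replaced by any single one. -/
theorem HasSNF'.hasSNF_reindex {A : Matrix ι ι R} (h : A.HasSNF') :
    ∃ e : ι ≃ Fin (Fintype.card ι), (reindex e e A).HasSNF := by
  obtain ⟨e, e', P, Q, hP, hQ, hdiag, hchain⟩ := h
  let Q' := Q.submatrix (e.symm.trans e') (Equiv.refl _)
  have hQ' : reindex e e A * Q' = reindex e e' A * Q := by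
    rw [reindex_apply, reindex_apply, show A.submatrix e.symm e.symm =
      (A.submatrix e.symm e'.symm).submatrix (Equiv.refl _) (e.symm.trans e') from ?_]
    · rw [submatrix_mul_equiv]
      simp
    · ext i j
      simp
  refine ⟨e, P, Q', hP, (isUnit_submatrix_equiv _ _).2 hQ, ?_, ?_⟩
  · rwa [Matrix.mul_assoc, hQ', ← Matrix.mul_assoc]
  · rwa [Matrix.mul_assoc, hQ', ← Matrix.mul_assoc]

theorem HasSNF.neg {m n : ℕ} {A : Matrix (Fin m) (Fin n) R} (h : A.HasSNF) : (-A).HasSNF := by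
  obtain ⟨P, Q, hP, hQ, hdiag, hchain⟩ := h
  refine ⟨-P, Q, hP.neg, hQ, ?_, ?_⟩
  · rwa [Matrix.neg_mul, Matrix.mul_neg, neg_neg]
  · rwa [Matrix.neg_mul, Matrix.mul_neg, neg_neg]

theorem HasSNF.map {S : Type*} [CommRing S] {m n : ℕ} {A : Matrix (Fin m) (Fin n) R}
    (h : A.HasSNF) (f : R →+* S) : (A.map f).HasSNF := by
  obtain ⟨P, Q, hP, hQ, hdiag, hchain⟩ := h
  have hmap : P.map f * A.map f * Q.map f = (P * A * Q).map f := by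
    rw [Matrix.map_mul, Matrix.map_mul]
  refine ⟨P.map f, Q.map f, hP.map f.mapMatrix, hQ.map f.mapMatrix, ?_, ?_⟩
  · intro i j hij
    rw [hmap, map_apply, hdiag i j hij, map_zero]
  · intro i h₁ h₂
    rw [hmap, map_apply, map_apply]
    exact map_dvd f (hchain i h₁ h₂)

/-- The matrices `A + xI` and `xI - A` have Smith normal form simultaneously. -/
theorem hasSNF_map_C_add_X_iff {N : ℕ} (A : Matrix (Fin N) (Fin N) R) :
    (A.map C + (X : R[X]) • (1 : Matrix (Fin N) (Fin N) R[X])).HasSNF ↔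
      A.charmatrix.HasSNF := by
  let σ : R[X] →+* R[X] := (algEquivAevalNegX (R := R) : R[X] →+* R[X])
  have hC : ∀ c, σ (C c) = C c := fun c => by simp [σ]
  have hX : σ X = -X := by simp [σ]
  have h₁ : -(A.map C + (X : R[X]) • (1 : Matrix (Fin N) (Fin N) R[X])).map σ = A.charmatrix := by
    ext1 i j
    rcases eq_or_ne i j with rfl | hij
    · simp [hC, hX, sub_eq_add_neg]
    · simp [hC, hij]
  have h₂ : -A.charmatrix.map σ = A.map C + (X : R[X]) • (1 : Matrix (Fin N) (Fin N) R[X]) := by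
    ext1 i j
    rcases eq_or_ne i j with rfl | hij
    · simp [hC, hX, add_comm]
    · simp [hC, hij]
  exact ⟨fun h => h₁ ▸ (h.map σ).neg, fun h => h₂ ▸ (h.map σ).neg⟩

end Matrix

/-- For an `r`-differential poset `P` and `n ≥ 0`, the matrix
`[DU_n] + x·I_{p_n}` has Smith normal form over `ℤ[x]` if and only if the operator
`DU_n : ℤP_n → ℤP_n` has rational canonical form over `ℤ`. -/
theorem snf_iff_rcf_of_du {r : ℕ} (hr : 0 < r) (D : DiffPoset r) (n : ℕ) :
    Matrix.HasSNF' ((D.duMatrix ℤ n).map (C : ℤ → ℤ[X]) +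
        (X : ℤ[X]) • (1 : Matrix (D.level n) (D.level n) ℤ[X])) ↔
      (D.du ℤ n).HasRCF := by
  have hdu : D.du ℤ n = (D.duMatrix ℤ n).mulVecLin := (Matrix.mulVecLin_mul _ _).symm
  have key : ∀ e : D.level n ≃ Fin (Fintype.card (D.level n)),
      (Matrix.reindex e e ((D.duMatrix ℤ n).map (C : ℤ → ℤ[X]) +
        (X : ℤ[X]) • (1 : Matrix (D.level n) (D.level n) ℤ[X]))).HasSNF ↔
      (LinearMap.toMatrix ((Pi.basisFun ℤ _).reindex e) ((Pi.basisFun ℤ _).reindex e)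
        (D.du ℤ n)).charmatrix.HasSNF := by
    intro e
    rw [← Matrix.hasSNF_map_C_add_X_iff]
    refine iff_of_eq (congrArg _ ?_)
    ext1 i j
    simp [LinearMap.toMatrix_apply, hdu, Matrix.one_apply]
  constructor
  · intro h
    obtain ⟨e, he⟩ := h.hasSNF_reindex
    exact Module.End.hasRCF_of_hasSNF _ _ ((key e).1 he)
  · intro h
    let e := Fintype.equivFin (D.level n)
    exact ⟨e, e, (key e).2 (Module.End.hasSNF_of_hasRCF _ _ h)⟩
end

section
/- Let P be an r-differential poset and n ≥ 0. The down map D_{n+1} : ℤP_{n+1} → ℤP_n is surjective if and only if the up map U_n : ℤP_n → ℤP_{n+1} has free cokernel, i.e., ℤP_{n+1}/im(U_n) is a free ℤ-module. -/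
open Polynomial

theorem Finset.sum_sq_sum_ite_eq {α β : Type*} [Fintype β] (T : Finset α)
    (c : α → β → Prop) [∀ z x, Decidable (c z x)] (v : β → ℤ) :
    ∑ z ∈ T, (∑ x, if c z x then v x else 0) ^ 2 =
      ∑ x, ∑ y, v x * v y * ((T.filter fun z => c z x ∧ c z y).card : ℤ) := by
  simp_rw [sq, Finset.sum_mul_sum, Finset.card_filter, Nat.cast_sum, Finset.mul_sum]
  rw [Finset.sum_comm]
  refine Finset.sum_congr rfl fun x _ => ?_
  rw [Finset.sum_comm]
  refine Finset.sum_congr rfl fun y _ => Finset.sum_congr rfl fun z _ => ?_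
  by_cases hx : c z x <;> by_cases hy : c z y <;> simp [hx, hy]

/-- A matrix over a principal ideal domain has a left inverse if and only if it is injective with
free cokernel. -/
theorem Matrix.exists_left_inverse_iff_free_quotient {R ι κ : Type*} [CommRing R] [IsDomain R]
    [IsPrincipalIdealRing R] [Fintype ι] [Fintype κ] [DecidableEq κ]
    {A : Matrix ι κ R} (hA : Function.Injective A.mulVecLin) :
    (∃ B : Matrix κ ι R, B * A = 1) ↔ Module.Free R ((ι → R) ⧸ LinearMap.range A.mulVecLin) := by
  classical
  have hexact : Function.Exact A.mulVecLin (LinearMap.range A.mulVecLin).mkQ :=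
    LinearMap.exact_map_mkQ_range _
  have hsplit := (hexact.split_tfae hA (Submodule.mkQ_surjective _)).out 0 1
  have hleft : (∃ B : Matrix κ ι R, B * A = 1) ↔ ∃ l, l ∘ₗ A.mulVecLin = LinearMap.id := by
    constructor
    · rintro ⟨B, hB⟩
      exact ⟨B.mulVecLin, by rw [← Matrix.mulVecLin_mul, hB, Matrix.mulVecLin_one]⟩
    · rintro ⟨l, hl⟩
      refine ⟨LinearMap.toMatrix' l, ?_⟩
      have := congrArg LinearMap.toMatrix' hl
      rwa [LinearMap.toMatrix'_comp, ← Matrix.toLin'_apply', LinearMap.toMatrix'_toLin', LinearMap.toMatrix'_id] at this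
  rw [hleft, ← hsplit]
  constructor
  · rintro ⟨l, hl⟩
    have := Module.Projective.of_split _ _ hl
    infer_instance
  · intro _
    exact Module.projective_lifting_property _ _ (Submodule.mkQ_surjective _)

namespace DiffPoset

variable {r : ℕ} (D : DiffPoset r)

theorem downMatrix_eq_transpose_upMatrix (R : Type*) [CommRing R] (n : ℕ) :
    D.downMatrix R n = (D.upMatrix R n).transpose := rfl

theorem up_apply (R : Type*) [CommRing R] (n : ℕ) (v : D.level n → R) (y : D.level (n + 1)) :
    D.up R n v y = ∑ x : D.level n, if (x : D.P) ⋖ (y : D.P) then v x else 0 := by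
  simp [up, upMatrix, Matrix.mulVec, dotProduct]

theorem card_common_upper_covers (n : ℕ) (x y : D.level n) :
    (Finset.univ.filter fun z : D.level (n + 1) =>
      (x : D.P) ⋖ (z : D.P) ∧ (y : D.P) ⋖ (z : D.P)).card =
      {z : D.P | (x : D.P) ⋖ z ∧ (y : D.P) ⋖ z}.ncard := by
  rw [← Finset.card_map (Function.Embedding.subtype _), ← Set.ncard_coe_finset]
  congr 1
  ext z
  simp only [Finset.coe_map, Finset.coe_filter, Finset.mem_univ, true_and, Set.mem_image,
    Set.mem_ofPred_eq, Function.Embedding.subtype_apply, Subtype.exists]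
  constructor
  · rintro ⟨a, ha, h, rfl⟩
    exact h
  · intro h
    exact ⟨z, by rw [D.rk_covBy h.1, x.2], h, rfl⟩

theorem finite_setOf_rk_lt (n : ℕ) : {z : D.P | D.rk z < n}.Finite := by
  have h := (Set.finite_Iio n).biUnion fun i _ => D.fiberFinite i
  exact h.subset fun z hz => Set.mem_biUnion (Set.mem_Iio.mpr hz) rfl

theorem card_common_lower_covers (n : ℕ) (x y : D.level n) :
    ((D.finite_setOf_rk_lt n).toFinset.filter fun z => z ⋖ (x : D.P) ∧ z ⋖ (y : D.P)).card =
      {z : D.P | z ⋖ (x : D.P) ∧ z ⋖ (y : D.P)}.ncard := by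
  rw [← Set.ncard_coe_finset]
  congr 1
  ext z
  simp only [Finset.coe_filter, Set.Finite.mem_toFinset, Set.mem_ofPred_eq, and_iff_right_iff_imp]
  intro h
  have := D.rk_covBy h.1
  have := x.2
  omega

theorem ncard_common_upper_covers (n : ℕ) (x y : D.level n) :
    {z : D.P | (x : D.P) ⋖ z ∧ (y : D.P) ⋖ z}.ncard =
      {z : D.P | z ⋖ (x : D.P) ∧ z ⋖ (y : D.P)}.ncard + if x = y then r else 0 := by
  by_cases h : x = y
  · subst h
    simpa using D.d3 x
  · simpa [h] using (D.d2 fun h' => h (Subtype.ext h')).symm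

/-- The quadratic form of the identity `DU - UD = r`. -/
theorem sum_sq_up (n : ℕ) (v : D.level n → ℤ) :
    ∑ y, D.up ℤ n v y ^ 2 =
      ∑ z ∈ (D.finite_setOf_rk_lt n).toFinset,
        (∑ x : D.level n, if z ⋖ (x : D.P) then v x else 0) ^ 2 + r * ∑ x, v x ^ 2 := by
  simp_rw [up_apply]
  rw [Finset.sum_sq_sum_ite_eq _ fun (y : D.level (n + 1)) (x : D.level n) => (x : D.P) ⋖ (y : D.P),
    Finset.sum_sq_sum_ite_eq _ fun (z : D.P) (x : D.level n) => z ⋖ (x : D.P)]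
  simp_rw [card_common_upper_covers, card_common_lower_covers, ncard_common_upper_covers]
  simp only [Nat.cast_add, Nat.cast_ite, Nat.cast_zero, mul_add, Finset.sum_add_distrib,
    mul_ite, mul_zero, Finset.sum_ite_eq, Finset.mem_univ, if_true, Finset.mul_sum]
  congr 1
  exact Finset.sum_congr rfl fun x _ => by ring

theorem up_injective (hr : 0 < r) (n : ℕ) : Function.Injective (D.up ℤ n) := by
  rw [← LinearMap.ker_eq_bot, LinearMap.ker_eq_bot']
  intro v hv
  have h := D.sum_sq_up n v
  simp only [hv, Pi.zero_apply, ne_eq, OfNat.ofNat_ne_zero, not_false_eq_true, zero_pow,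
    Finset.sum_const_zero] at h
  have h₁ : 0 ≤ ∑ z ∈ (D.finite_setOf_rk_lt n).toFinset,
      (∑ x : D.level n, if z ⋖ (x : D.P) then v x else 0) ^ 2 :=
    Finset.sum_nonneg fun _ _ => sq_nonneg _
  have h₂ : 0 ≤ ∑ x, v x ^ 2 := Finset.sum_nonneg fun _ _ => sq_nonneg _
  have hr' : (0 : ℤ) < r := by exact_mod_cast hr
  have h₃ : ∑ x, v x ^ 2 = 0 := by nlinarith
  rw [Finset.sum_eq_zero_iff_of_nonneg fun _ _ => sq_nonneg _] at h₃
  funext x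
  exact pow_eq_zero_iff two_ne_zero |>.mp (h₃ x (Finset.mem_univ x))

theorem down_surjective_iff_exists_left_inverse (R : Type*) [CommRing R] (n : ℕ) :
    Function.Surjective (D.down R n) ↔ ∃ B : Matrix (D.level n) (D.level (n + 1)) R, B * D.upMatrix R n = 1 := by
  change Function.Surjective (D.downMatrix R n).mulVec ↔ _
  rw [Matrix.mulVec_surjective_iff_exists_right_inverse, downMatrix_eq_transpose_upMatrix]
  constructor
  · rintro ⟨B, hB⟩
    exact ⟨B.transpose, by simpa using congrArg Matrix.transpose hB⟩
  · rintro ⟨B, hB⟩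
    exact ⟨B.transpose, by rw [← Matrix.transpose_mul, hB, Matrix.transpose_one]⟩

end DiffPoset

/-- For an `r`-differential poset `P` and `n ≥ 0`, the down map
`D_{n+1} : ℤP_{n+1} → ℤP_n` is surjective if and only if the up map `U_n` has free cokernel. -/
theorem down_surjective_iff_up_free_cokernel {r : ℕ} (hr : 0 < r) (D : DiffPoset r) (n : ℕ) :
    Function.Surjective (D.down ℤ n) ↔
      Module.Free ℤ ((D.level (n + 1) → ℤ) ⧸ LinearMap.range (D.up ℤ n)) := by
  rw [D.down_surjective_iff_exists_left_inverse]
  exact Matrix.exists_left_inverse_iff_free_quotient (D.up_injective hr n)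
end

section
/- Let P be an r-differential poset such that: (i) the down maps D_{n+1} : ℤP_{n+1} → ℤP_n are surjective for all n ≥ 0; (ii) there exists l ≥ 0 such that Δp_n ≥ Δp_{n−1−δ_{r,1}} + 1 for every n ≥ l + 1 (where Δp_n := p_n − p_{n−1} and δ_{r,1} is 1 if r = 1 and 0 otherwise); (iii) the operators DU_n have rational canonical form over ℤ for all n ∈ {0, 1, ..., l}. Then the operators DU_n have rational canonical form over ℤ for all n ≥ 0. -/
open Polynomial

/-- Modulo a submodule `K`, an element can be moved away from `pQ` for finitely many primes `p` at
once, provided that this is possible for each of them separately. -/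
theorem exists_add_forall_prime_not_smul {Q : Type*} [AddCommGroup Q]
    (K : Submodule ℤ Q) (q : Q) (S : Finset ℕ) (hS : ∀ p ∈ S, p.Prime)
    (h : ∀ p ∈ S, (∃ z ∈ K, ∀ y, z ≠ (p : ℤ) • y) ∨ ∀ y, q ≠ (p : ℤ) • y) :
    ∃ κ ∈ K, ∀ p ∈ S, ∀ y, q + κ ≠ (p : ℤ) • y := by
  induction S using Finset.induction_on with
  | empty => exact ⟨0, K.zero_mem, by simp⟩
  | insert p S hp ih =>
    obtain ⟨κ, hκ, hκS⟩ := ih (fun p' hp' => hS p' (Finset.mem_insert_of_mem hp'))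
      (fun p' hp' => h p' (Finset.mem_insert_of_mem hp'))
    have hpp : p.Prime := hS p (Finset.mem_insert_self _ _)
    by_cases hq : ∀ y, q + κ ≠ (p : ℤ) • y
    · refine ⟨κ, hκ, fun p' hp' => ?_⟩
      rcases Finset.mem_insert.1 hp' with rfl | hp'
      · exact hq
      · exact hκS p' hp'
    push Not at hq
    obtain ⟨y₀, hy₀⟩ := hq
    obtain ⟨z, hz, hzp⟩ : ∃ z ∈ K, ∀ y, z ≠ (p : ℤ) • y := by
      rcases h p (Finset.mem_insert_self _ _) with hK | hq'
      · exact hK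
      · refine ⟨κ, hκ, fun y hy => hq' (y₀ - y) ?_⟩
        rw [smul_sub, ← hy₀, ← hy]; abel
    refine ⟨κ + ((∏ i ∈ S, i : ℕ) : ℤ) • z, K.add_mem hκ (K.smul_mem _ hz), fun p' hp' y hy => ?_⟩
    rcases Finset.mem_insert.1 hp' with rfl | hp'
    · have hcop : IsCoprime ((∏ i ∈ S, i : ℕ) : ℤ) (p' : ℤ) := by
        rw [Nat.isCoprime_iff_coprime]
        refine Nat.Coprime.prod_left fun i hi => ?_
        refine (Nat.coprime_primes (hS i (Finset.mem_insert_of_mem hi)) hpp).2 ?_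
        rintro rfl
        exact hp hi
      obtain ⟨u, v, huv⟩ := hcop
      apply hzp (u • (y - y₀) + v • z)
      have h1 : ((∏ i ∈ S, i : ℕ) : ℤ) • z = (p' : ℤ) • (y - y₀) := by
        rw [smul_sub, ← hy, ← hy₀]; abel
      calc z = (u * ((∏ i ∈ S, i : ℕ) : ℤ) + v * (p' : ℤ)) • z := by rw [huv, one_smul]
        _ = u • (((∏ i ∈ S, i : ℕ) : ℤ) • z) + (v * (p' : ℤ)) • z := by
            rw [add_smul, mul_smul u]
        _ = _ := by rw [h1]; module
    · obtain ⟨m, hm⟩ := Finset.dvd_prod_of_mem (fun i : ℕ => i) hp'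
      apply hκS p' hp' (y - (m : ℤ) • z)
      rw [smul_sub, ← hy, hm]
      push_cast
      module

/-- In rank at least two, a coset of a finite-index sublattice contains a primitive vector as soon
as there is no obstruction at any single prime. -/
theorem exists_add_primitive {Q : Type*} [AddCommGroup Q] {d : ℕ}
    (b : Module.Basis (Fin (d + 2)) ℤ Q) (K : Submodule ℤ Q) (t : ℤ) (ht : t ≠ 0)
    (htK : ∀ z : Q, t • z ∈ K) (q : Q)
    (h : ∀ p : ℕ, p.Prime → (∃ z ∈ K, ∀ y, z ≠ (p : ℤ) • y) ∨ ∀ y, q ≠ (p : ℤ) • y) :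
    ∃ κ ∈ K, ∀ p : ℕ, p.Prime → ∀ y, q + κ ≠ (p : ℤ) • y := by
  obtain ⟨κ₁, hκ₁, h₁⟩ := exists_add_forall_prime_not_smul K q t.natAbs.primeFactors
    (fun p hp => Nat.prime_of_mem_primeFactors hp)
    (fun p hp => h p (Nat.prime_of_mem_primeFactors hp))
  obtain ⟨κ₂, hκ₂, h₂, hne⟩ : ∃ κ₂ ∈ K, (∀ p ∈ t.natAbs.primeFactors, ∀ y,
      q + κ₂ ≠ (p : ℤ) • y) ∧ b.repr (q + κ₂) 1 ≠ 0 := by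
    by_cases h0 : b.repr (q + κ₁) 1 = 0
    · refine ⟨κ₁ + t • b 1, K.add_mem hκ₁ (htK _), fun p hp y hy => ?_, ?_⟩
      · obtain ⟨m, hm⟩ := Int.natCast_dvd.2 (Nat.dvd_of_mem_primeFactors hp)
        apply h₁ p hp (y - m • b 1)
        rw [smul_sub, ← hy, hm]
        module
      · rw [← add_assoc, map_add, Finsupp.add_apply, h0]
        simpa using ht
    · exact ⟨κ₁, hκ₁, h₁, h0⟩
  obtain ⟨κ₃, hκ₃, h₃⟩ := exists_add_forall_prime_not_smul (Submodule.span ℤ {t • b 0}) (q + κ₂)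
    (b.repr (q + κ₂) 1).natAbs.primeFactors (fun p hp => Nat.prime_of_mem_primeFactors hp) (by
      intro p hp
      by_cases hpt : (p : ℤ) ∣ t
      · right
        refine h₂ p (Nat.mem_primeFactors.2 ⟨Nat.prime_of_mem_primeFactors hp, ?_, ?_⟩)
        · exact Int.natCast_dvd.1 hpt
        · simpa using ht
      · left
        refine ⟨_, Submodule.mem_span_singleton_self _, fun y hy => hpt ⟨b.repr y 0, ?_⟩⟩
        have := congrArg (fun z => b.repr z 0) hy
        simpa using this)
  obtain ⟨c, rfl⟩ := Submodule.mem_span_singleton.1 hκ₃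
  refine ⟨κ₂ + c • t • b 0, K.add_mem hκ₂ (K.smul_mem _ (htK _)), fun p hp y hy => ?_⟩
  rw [← add_assoc] at hy
  refine h₃ p (Nat.mem_primeFactors.2 ⟨hp, Int.natCast_dvd.1 ⟨b.repr y 1, ?_⟩, by simpa using hne⟩)
    y hy
  have := congrArg (fun z => b.repr z 1) hy
  simpa using this

/-- Vectors generating a lattice modulo a finite-index sublattice can be lifted to generators of
the lattice, if their number is the rank and `3` kills the last one modulo the sublattice. -/
theorem exists_lift_span_eq_top (d : ℕ) : ∀ {Q : Type*} [AddCommGroup Q]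
    [Module.Free ℤ Q] [Module.Finite ℤ Q] (_ : Module.finrank ℤ Q = d) (K : Submodule ℤ Q)
    (t : ℤ) (_ : t ≠ 0) (_ : ∀ z : Q, t • z ∈ K) (q : Fin d → Q)
    (_ : Submodule.span ℤ (Set.range q) ⊔ K = ⊤)
    (_ : ∀ i : Fin d, (i : ℕ) + 1 = d → (3 : ℤ) • q i ∈ K),
    ∃ q' : Fin d → Q, (∀ i, q' i - q i ∈ K) ∧ Submodule.span ℤ (Set.range q') = ⊤ := by
  induction d with
  | zero =>
    intro Q _ _ _ hd K t ht htK q hq h3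
    refine ⟨q, fun i => i.elim0, ?_⟩
    have := Module.finrank_zero_iff.1 hd
    exact Subsingleton.elim _ _
  | succ d ih =>
    intro Q _ _ _ hd K t ht htK q hq h3
    have b : Module.Basis (Fin (d + 1)) ℤ Q := Module.finBasisOfFinrankEq ℤ Q hd
    have hfree : Module.IsTorsionFree ℤ Q := inferInstance
    rcases d with _ | d
    · have hb : ∀ z, z = b.repr z 0 • b 0 := fun z => by
        conv_lhs => rw [← b.sum_repr z]
        simp
      have hspan : Submodule.span ℤ {b 0} = ⊤ :=
        eq_top_iff.2 fun z _ => Submodule.mem_span_singleton.2 ⟨_, (hb z).symm⟩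
      obtain ⟨a, κ, hκ, hab⟩ : ∃ (a : ℤ) (κ : Q), κ ∈ K ∧ a • q 0 + κ = b 0 := by
        have : b 0 ∈ Submodule.span ℤ (Set.range q) ⊔ K := hq ▸ Submodule.mem_top
        obtain ⟨y, hy, κ, hκ, h⟩ := Submodule.mem_sup.1 this
        have hr : Set.range q = {q 0} := Set.range_unique (ι := Fin 1)
        rw [hr, Submodule.mem_span_singleton] at hy
        obtain ⟨a, rfl⟩ := hy
        exact ⟨a, κ, hκ, h⟩
      have h3b : (3 : ℤ) • b 0 ∈ K := by
        rw [← hab, smul_add, smul_comm]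
        exact K.add_mem (K.smul_mem _ (h3 0 rfl)) (K.smul_mem _ hκ)
      have key : ∃ e : Q, e - q 0 ∈ K ∧ Submodule.span ℤ {e} = ⊤ := by
        set x := b.repr (q 0) 0 with hx
        have hq0 : q 0 = x • b 0 := hb _
        have hdiv : x % 3 = 0 ∨ x % 3 = 1 ∨ x % 3 = 2 := by omega
        rcases hdiv with hm | hm | hm
        · obtain ⟨y, hy⟩ : (3 : ℤ) ∣ x := Int.dvd_of_emod_eq_zero hm
          have hbK : b 0 ∈ K := by
            rw [← hab]
            refine K.add_mem (K.smul_mem _ ?_) hκ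
            rw [hq0, hy, mul_comm, mul_smul]
            exact K.smul_mem _ h3b
          refine ⟨b 0, ?_, hspan⟩
          rw [hq0]
          exact K.sub_mem hbK (K.smul_mem _ hbK)
        · refine ⟨b 0, ?_, hspan⟩
          have : b 0 - q 0 = (-(x / 3)) • (3 : ℤ) • b 0 := by
            rw [hq0, smul_smul, show b 0 - x • b 0 = (1 - x) • b 0 by module]
            congr 1; omega
          rw [this]
          exact K.smul_mem _ h3b
        · refine ⟨-b 0, ?_, ?_⟩
          · have : -b 0 - q 0 = (-(x / 3) - 1) • (3 : ℤ) • b 0 := by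
              rw [hq0, smul_smul, show -b 0 - x • b 0 = (-1 - x) • b 0 by module]
              congr 1; omega
            rw [this]
            exact K.smul_mem _ h3b
          · rw [← Set.neg_singleton, Submodule.span_neg, hspan]
      obtain ⟨e, heK, he⟩ := key
      refine ⟨fun _ => e, fun i => ?_, ?_⟩
      · obtain rfl : i = 0 := by omega
        exact heK
      · rw [Set.range_const, he]
    · obtain ⟨κ, hκ, hprim⟩ := exists_add_primitive b K t ht htK (q 0) (by
        intro p hp
        by_contra! hcon
        obtain ⟨hK, y₀, hy₀⟩ := hcon
        have : Fact p.Prime := ⟨hp⟩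
        let f : Q →ₗ[ℤ] (Fin (d + 2) → ZMod p) :=
          { toFun := fun z i => ((b.repr z i : ℤ) : ZMod p)
            map_add' := fun z w => by ext i; simp
            map_smul' := fun c z => by ext i; simp }
        have hfp : ∀ y, f ((p : ℤ) • y) = 0 := fun y => by
          ext i; simp [f]
        have hfsurj : ∀ w, ∃ z, f z = w := fun w => by
          choose c hc using fun i => ZMod.intCast_surjective (w i)
          refine ⟨b.equivFun.symm c, ?_⟩
          ext i
          simp only [f, LinearMap.coe_mk, AddHom.coe_mk]
          rw [← Module.Basis.equivFun_apply, LinearEquiv.apply_symm_apply, hc]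
        have hli : LinearIndependent (ZMod p) (fun i => f (q i)) := by
          apply linearIndependent_of_top_le_span_of_card_eq_finrank
          · intro w hw
            obtain ⟨z, rfl⟩ := hfsurj w
            have hz : z ∈ Submodule.span ℤ (Set.range q) ⊔ K := hq ▸ Submodule.mem_top
            obtain ⟨y, hy, κ, hκ, rfl⟩ := Submodule.mem_sup.1 hz
            obtain ⟨κ', rfl⟩ := hK κ hκ
            rw [map_add, hfp, add_zero]
            clear hz hw
            induction hy using Submodule.span_induction with
            | mem x hx =>
              obtain ⟨i, rfl⟩ := hx
              exact Submodule.subset_span ⟨i, rfl⟩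
            | zero => rw [map_zero]; exact Submodule.zero_mem _
            | add x y _ _ hx hy =>
              rw [map_add]
              exact Submodule.add_mem _ hx hy
            | smul c x _ hx =>
              rw [map_smul, ← Int.cast_smul_eq_zsmul (ZMod p)]
              exact Submodule.smul_mem _ _ hx
          · simp
        refine hli.ne_zero 0 ?_
        rw [hy₀, hfp])
      set e := q 0 + κ with he
      set E := Submodule.span ℤ {e} with hE
      have hprimE : ∀ p : ℕ, p.Prime → ∀ z : Q, (p : ℤ) • z ∈ E → z ∈ E := by
        intro p hp z hz
        obtain ⟨c, hc⟩ := Submodule.mem_span_singleton.1 hz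
        have hp0 : (p : ℤ) ≠ 0 := by exact_mod_cast hp.ne_zero
        by_cases hpc : (p : ℤ) ∣ c
        · obtain ⟨m, rfl⟩ := hpc
          refine Submodule.mem_span_singleton.2 ⟨m, ?_⟩
          rw [mul_smul] at hc
          exact smul_right_injective Q hp0 hc
        · exfalso
          obtain ⟨u, v, huv⟩ := ((Nat.prime_iff_prime_int.1 hp).coprime_iff_not_dvd).2 hpc
          apply hprim p hp (u • e + v • z)
          calc e = (u * p + v * c) • e := by rw [huv, one_smul]
            _ = (u * (p : ℤ)) • e + v • c • e := by rw [add_smul, mul_smul v]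
            _ = _ := by rw [hc]; module
      have hsat : ∀ (n : ℕ) (z : Q), n ≠ 0 → (n : ℤ) • z ∈ E → z ∈ E := by
        intro n
        induction n using Nat.recOnMul with
        | zero => intro z h; exact absurd rfl h
        | one => intro z _ h; simpa using h
        | prime p hp => intro z _ h; exact hprimE p hp z h
        | mul m n hm hn =>
          intro z h0 h
          rw [Nat.cast_mul, mul_smul] at h
          exact hn z (right_ne_zero_of_mul h0) (hm _ (left_ne_zero_of_mul h0) h)
      have : Module.IsTorsionFree ℤ (Q ⧸ E) := by
        refine Module.IsTorsionFree.mk fun c hc => ?_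
        have hc0 : c ≠ 0 := hc.ne_zero
        refine (injective_iff_map_eq_zero (DistribSMul.toAddMonoidHom (Q ⧸ E) c)).2 fun z hz => ?_
        obtain ⟨z, rfl⟩ := E.mkQ_surjective z
        have hz' : c • z ∈ E := by
          rw [← Submodule.Quotient.mk_eq_zero]
          simpa using hz
        rw [Submodule.mkQ_apply, Submodule.Quotient.mk_eq_zero]
        refine hsat c.natAbs z (by simpa using hc0) ?_
        rcases Int.natAbs_eq c with h | h
        · rwa [← h]
        · rw [h, neg_smul] at hz'
          exact (Submodule.neg_mem_iff _).1 hz'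
      have he0 : e ≠ 0 := fun h => hprim 2 Nat.prime_two 0 (by rw [h, smul_zero])
      have hfin : Module.finrank ℤ (Q ⧸ E) = d + 1 := by
        have h1 := Submodule.finrank_quotient_add_finrank E
        have h2 : Module.finrank ℤ E = 1 := by
          have := (LinearEquiv.toSpanNonzeroSingleton ℤ Q e he0).finrank_eq
          rw [Module.finrank_self] at this
          exact this.symm
        omega
      have : Module.Free ℤ (Q ⧸ E) := inferInstance
      obtain ⟨w, hw, hwspan⟩ := ih hfin (K.map E.mkQ) t ht
        (fun z => by
          obtain ⟨z, rfl⟩ := E.mkQ_surjective z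
          exact ⟨t • z, htK z, by simp⟩)
        (fun i => E.mkQ (q i.succ))
        (by
          rw [eq_top_iff]
          intro z _
          obtain ⟨z, rfl⟩ := E.mkQ_surjective z
          have hz : z ∈ Submodule.span ℤ (Set.range q) ⊔ K := hq ▸ Submodule.mem_top
          obtain ⟨y, hy, k, hk, rfl⟩ := Submodule.mem_sup.1 hz
          rw [map_add]
          refine Submodule.add_mem _ ?_ (Submodule.mem_sup_right ⟨k, hk, rfl⟩)
          rw [← Submodule.mem_comap]
          clear hz
          revert y
          suffices h : Submodule.span ℤ (Set.range q) ≤ Submodule.comap E.mkQ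
              (Submodule.span ℤ (Set.range fun i : Fin (d + 1) => E.mkQ (q i.succ)) ⊔
                K.map E.mkQ) from fun y hy _ => h hy
          rw [Submodule.span_le]
          rintro _ ⟨i, rfl⟩
          refine Fin.cases ?_ (fun i => ?_) i
          · refine Submodule.mem_sup_right ⟨-κ, K.neg_mem hκ, ?_⟩
            refine (Submodule.Quotient.eq E).2 ?_
            rw [show -κ - q 0 = -e by rw [he]; abel]
            exact E.neg_mem (Submodule.mem_span_singleton_self e)
          · exact Submodule.mem_sup_left (Submodule.subset_span ⟨i, rfl⟩))
        (fun i hi => ⟨(3 : ℤ) • q i.succ, h3 i.succ (by simpa using hi), by simp⟩)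
      choose k hk hkw using hw
      refine ⟨Fin.cons e fun i => q i.succ + k i, fun i => ?_, ?_⟩
      · refine Fin.cases ?_ (fun i => ?_) i
        · simpa [he] using hκ
        · simpa using hk i
      · have hEle : E ≤ Submodule.span ℤ
            (Set.range (Fin.cons e fun i => q i.succ + k i : Fin (d + 2) → Q)) := by
          rw [hE, Submodule.span_singleton_le_iff_mem]
          exact Submodule.subset_span ⟨0, rfl⟩
        have hmap : Submodule.map E.mkQ (Submodule.span ℤ
            (Set.range (Fin.cons e fun i => q i.succ + k i : Fin (d + 2) → Q))) = ⊤ := by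
          rw [eq_top_iff, ← hwspan, Submodule.span_le]
          rintro _ ⟨i, rfl⟩
          refine ⟨q i.succ + k i, Submodule.subset_span ⟨i.succ, rfl⟩, ?_⟩
          rw [map_add, hkw]
          abel
        rw [eq_top_iff]
        intro z _
        obtain ⟨y, hy, hyz⟩ : E.mkQ z ∈ Submodule.map E.mkQ (Submodule.span ℤ
            (Set.range (Fin.cons e fun i => q i.succ + k i : Fin (d + 2) → Q))) :=
          hmap ▸ Submodule.mem_top
        have : z - y ∈ E := (Submodule.Quotient.eq E).1 hyz.symm
        rw [← sub_add_cancel z y]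
        exact Submodule.add_mem _ (hEle this) hy

/-- A finite cyclic decomposition of the `ℤ[X]`-module defined by `φ`, with invariants `a j` listed
in descending order of divisibility and continued by `1`. -/
structure CyclicDecomp {M : Type*} [AddCommGroup M] (φ : Module.End ℤ M) (k : ℕ) (a : ℕ → ℤ[X])
    (v : ℕ → M) : Prop where
  monic : ∀ j, (a j).Monic
  succ_dvd : ∀ j, a (j + 1) ∣ a j
  eq_one : ∀ j, k ≤ j → a j = 1
  kill : ∀ j, aeval φ (a j) (v j) = 0
  span : ∀ m, ∃ f : ℕ → ℤ[X], ∑ j ∈ Finset.range k, aeval φ (f j) (v j) = m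
  indep : ∀ f : ℕ → ℤ[X], ∑ j ∈ Finset.range k, aeval φ (f j) (v j) = 0 → ∀ j, a j ∣ f j

namespace CyclicDecomp

variable {M : Type*} [AddCommGroup M] {φ : Module.End ℤ M} {k : ℕ} {a : ℕ → ℤ[X]} {v : ℕ → M}

theorem dvd_of_le (h : CyclicDecomp φ k a v) {i j : ℕ} (hij : i ≤ j) : a j ∣ a i := by
  induction j, hij using Nat.le_induction with
  | base => exact dvd_rfl
  | succ j _ ih => exact (h.succ_dvd j).trans ih

theorem of_eq_one (h : CyclicDecomp φ k a v) {k' : ℕ} (hk' : ∀ j, k' ≤ j → a j = 1) :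
    CyclicDecomp φ k' a v := by
  have hv : ∀ j, a j = 1 → v j = 0 := fun j hj => by simpa [hj] using h.kill j
  have hsum : ∀ f : ℕ → ℤ[X], ∑ j ∈ Finset.range k', aeval φ (f j) (v j) =
      ∑ j ∈ Finset.range k, aeval φ (f j) (v j) := fun f => by
    rw [Finset.sum_subset (Finset.range_mono (le_max_left k' k)),
      Finset.sum_subset (Finset.range_mono (le_max_right k' k))]
    · intro j _ hj
      rw [hv j (h.eq_one j (by simpa using hj)), map_zero]
    · intro j _ hj
      rw [hv j (hk' j (by simpa using hj)), map_zero]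
  exact ⟨h.monic, h.succ_dvd, hk', h.kill,
    fun m => (h.span m).imp fun f hf => (hsum f).trans hf,
    fun f hf => h.indep f ((hsum f).symm.trans hf)⟩

theorem dvd_of_aeval_eq_zero (h : CyclicDecomp φ k a v) {j : ℕ} {f : ℤ[X]}
    (hf : aeval φ f (v j) = 0) : a j ∣ f := by
  have := h.indep (Pi.single j f) (Finset.sum_eq_zero fun i _ => by
    by_cases hij : i = j
    · subst hij; simpa using hf
    · simp [hij]) j
  simpa using this

theorem add_algebraMap (h : CyclicDecomp φ k a v) (c : ℤ) :
    CyclicDecomp (φ + algebraMap ℤ (Module.End ℤ M) c) k (fun j => (a j).comp (X - C c)) v := by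
  have h1 : ∀ p : ℤ[X], aeval (φ + algebraMap ℤ (Module.End ℤ M) c) (p.comp (X - C c)) =
      aeval φ p := fun p => by
    rw [aeval_comp]; congr 1; simp
  have h2 : ∀ p : ℤ[X], aeval φ (p.comp (X + C c)) =
      aeval (φ + algebraMap ℤ (Module.End ℤ M) c) p := fun p => by
    rw [aeval_comp]; congr 1; simp
  refine ⟨fun j => (h.monic j).comp_X_sub_C c, fun j => ?_, fun j hj => ?_, fun j => ?_,
    fun m => ?_, fun f hf j => ?_⟩
  · obtain ⟨q, hq⟩ := h.succ_dvd j
    exact ⟨q.comp (X - C c), by rw [hq, mul_comp]⟩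
  · simp [h.eq_one j hj]
  · rw [h1]; exact h.kill j
  · obtain ⟨f, hf⟩ := h.span m
    exact ⟨fun j => (f j).comp (X - C c), by simpa only [h1] using hf⟩
  · obtain ⟨q, hq⟩ := h.indep (fun j => (f j).comp (X + C c)) (by simpa only [h2] using hf) j
    refine ⟨q.comp (X - C c), ?_⟩
    rw [← mul_comp, ← hq, comp_assoc]
    simp

theorem hasRCF (h : CyclicDecomp φ k a v) : φ.HasRCF := by
  classical
  have hex : ∃ j, a j = 1 := ⟨k, h.eq_one k le_rfl⟩
  replace h : CyclicDecomp φ (Nat.find hex) a v := h.of_eq_one fun j hj =>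
    (h.monic j).isUnit_iff.1 (isUnit_of_dvd_one ((Nat.find_spec hex) ▸ h.dvd_of_le hj))
  have hne : ∀ j < Nat.find hex, a j ≠ 1 := fun j hj => Nat.find_min hex hj
  generalize Nat.find hex = n at h hne
  have hsmul : ∀ (f : ℤ[X]) (m : M), f • Module.AEval'.of φ m = Module.AEval'.of φ (aeval φ f m) :=
    fun f m => rfl
  have hann : ∀ (f : ℤ[X]) j, f • Module.AEval'.of φ (v j) = 0 ↔ a j ∣ f := fun f j => by
    rw [hsmul, LinearEquiv.map_eq_zero_iff]
    refine ⟨h.dvd_of_aeval_eq_zero, ?_⟩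
    rintro ⟨g, rfl⟩
    rw [mul_comm, map_mul, Module.End.mul_apply, h.kill, map_zero]
  refine ⟨n, fun i => Submodule.span ℤ[X] {Module.AEval'.of φ (v i.rev)}, fun i => a i.rev,
    fun i => h.monic _, fun i => (h.monic _).natDegree_pos.2 (hne _ i.rev.isLt),
    fun i j hij => h.dvd_of_le (Fin.rev_le_rev.2 hij), fun i => ⟨_, rfl⟩, fun i => ?_, ?_⟩
  · ext f
    rw [Submodule.mem_annihilator_span_singleton, Ideal.mem_span_singleton, hann]
  · refine DirectSum.isInternal_submodule_of_iSupIndep_of_iSup_eq_top ?_ ?_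
    · rw [iSupIndep_iff_finsetSum_eq_zero_imp_eq_zero]
      intro s w hw hsum i hi
      choose! f hf using fun i hi => Submodule.mem_span_singleton.1 (hw i hi)
      let g : ℕ → ℤ[X] := fun j =>
        if hj : j < n then if Fin.rev ⟨j, hj⟩ ∈ s then f (Fin.rev ⟨j, hj⟩) else 0 else 0
      have hg : ∀ i : Fin n, g i.rev = if i ∈ s then f i else 0 := fun i => by
        simp only [g]
        rw [dif_pos i.rev.isLt, Fin.eta, Fin.rev_rev]
      have key : ∑ j ∈ Finset.range n, aeval φ (g j) (v j) = 0 := by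
        rw [Finset.sum_range, ← Equiv.sum_comp Fin.revPerm]
        apply (Module.AEval'.of φ).injective
        rw [map_sum, map_zero, ← hsum, ← Finset.sum_subset (Finset.subset_univ s)]
        · refine Finset.sum_congr rfl fun i hi => ?_
          rw [Fin.revPerm_apply, hg, if_pos hi, ← hf i hi, hsmul]
        · intro i _ hi
          rw [Fin.revPerm_apply, hg, if_neg hi]
          simp
      rw [← hf i hi, hann]
      simpa only [hg, if_pos hi] using h.indep g key (i.rev : Fin n)
    · rw [eq_top_iff]
      intro m _
      obtain ⟨m, rfl⟩ := (Module.AEval'.of φ).surjective m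
      obtain ⟨f, rfl⟩ := h.span m
      rw [map_sum]
      refine Submodule.sum_mem _ fun j hj => ?_
      rw [← hsmul]
      refine Submodule.smul_mem _ _ (Submodule.mem_iSup_of_mem
        (Fin.rev ⟨j, Finset.mem_range.1 hj⟩) (Submodule.subset_span ?_))
      simp

end CyclicDecomp

theorem Module.End.HasRCF.exists_cyclicDecomp {M : Type*} [AddCommGroup M] {φ : Module.End ℤ M}
    (h : φ.HasRCF) : ∃ k a v, CyclicDecomp φ k a v := by
  obtain ⟨k, V, a, hmonic, -, hdvd, hcyc, hann, hinternal⟩ := h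
  choose w hw using hcyc
  have hsmul : ∀ (f : ℤ[X]) (m : M), f • Module.AEval'.of φ m = Module.AEval'.of φ (aeval φ f m) :=
    fun f m => rfl
  have hker : ∀ (f : ℤ[X]) i, f • w i = 0 ↔ a i ∣ f := fun f i => by
    rw [← Submodule.mem_annihilator_span_singleton, ← hw, hann, Ideal.mem_span_singleton]
  rw [DirectSum.isInternal_submodule_iff_iSupIndep_and_iSup_eq_top] at hinternal
  obtain ⟨hind, htop⟩ := hinternal
  let b : ℕ → ℤ[X] := fun j => if hj : j < k then a (Fin.rev ⟨j, hj⟩) else 1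
  let u : ℕ → M := fun j => if hj : j < k then (Module.AEval'.of φ).symm (w (Fin.rev ⟨j, hj⟩)) else 0
  have hu : ∀ i : Fin k, u i = (Module.AEval'.of φ).symm (w i.rev) := fun i => by simp [u]
  have hsum : ∀ f : ℕ → ℤ[X], Module.AEval'.of φ (∑ j ∈ Finset.range k, aeval φ (f j) (u j)) =
      ∑ i : Fin k, f i.rev • w i := fun f => by
    rw [Finset.sum_range, map_sum, ← Equiv.sum_comp Fin.revPerm]
    refine Finset.sum_congr rfl fun i _ => ?_
    rw [Fin.revPerm_apply, ← hsmul, hu, LinearEquiv.apply_symm_apply, Fin.rev_rev]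
  refine ⟨k, b, u, fun j => ?_, fun j => ?_, fun j hj => ?_, fun j => ?_, fun m => ?_,
    fun f hf j => ?_⟩
  · by_cases hj : j < k
    · simp only [b, dif_pos hj]; exact hmonic _
    · simp only [b, dif_neg hj]; exact monic_one
  · by_cases hj : j + 1 < k
    · simp only [b, dif_pos hj, dif_pos (Nat.lt_of_succ_lt hj)]
      exact hdvd _ _ (Fin.rev_le_rev.2 (by simp [Fin.le_def]))
    · simp only [b, dif_neg hj]; exact one_dvd _
  · simp only [b, dif_neg (not_lt.2 hj)]
  · by_cases hj : j < k
    · have := (hker (a (Fin.rev ⟨j, hj⟩)) (Fin.rev ⟨j, hj⟩)).2 dvd_rfl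
      apply (Module.AEval'.of φ).injective
      rw [← hsmul, map_zero]
      simpa only [b, u, dif_pos hj, LinearEquiv.apply_symm_apply] using this
    · simp only [u, dif_neg hj, map_zero]
  · have hm : Module.AEval'.of φ m ∈ Submodule.span ℤ[X] (Set.range w) := by
      have hle : ⨆ i, V i ≤ Submodule.span ℤ[X] (Set.range w) := iSup_le fun i => by
        rw [hw, Submodule.span_singleton_le_iff_mem]
        exact Submodule.subset_span ⟨i, rfl⟩
      exact hle (htop ▸ Submodule.mem_top)
    obtain ⟨c, hc⟩ := (Submodule.mem_span_range_iff_exists_fun _).1 hm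
    refine ⟨fun j => if hj : j < k then c (Fin.rev ⟨j, hj⟩) else 0, ?_⟩
    apply (Module.AEval'.of φ).injective
    rw [hsum, ← hc]
    refine Finset.sum_congr rfl fun i _ => ?_
    rw [dif_pos i.rev.isLt, Fin.eta, Fin.rev_rev]
  · by_cases hj : j < k
    · rw [iSupIndep_iff_finsetSum_eq_zero_imp_eq_zero] at hind
      have := hind Finset.univ (fun i => f i.rev • w i) (fun i _ => by
        rw [hw]
        exact Submodule.smul_mem _ _ (Submodule.mem_span_singleton_self _))
        (by rw [← hsum, hf, map_zero]) (Fin.rev ⟨j, hj⟩) (Finset.mem_univ _)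
      rw [hker] at this
      simpa only [b, dif_pos hj, Fin.rev_rev] using this
    · simp only [b, dif_neg hj]; exact one_dvd _

theorem map_aeval_apply {M N : Type*} [AddCommGroup M] [AddCommGroup N] {φ : Module.End ℤ M}
    {ψ : Module.End ℤ N} (g : M →ₗ[ℤ] N) (h : ∀ m, g (φ m) = ψ (g m)) (p : ℤ[X]) (m : M) :
    g (aeval φ p m) = aeval ψ p (g m) := by
  induction p using Polynomial.induction_on generalizing m with
  | C c => simp
  | add p q hp hq => simp [hp, hq]
  | monomial n c ih =>
    rw [pow_succ, ← mul_assoc, map_mul (aeval φ), map_mul (aeval ψ), Module.End.mul_apply,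
      Module.End.mul_apply, ih, aeval_X, aeval_X, h]

theorem aeval_apply_of_apply_eq_zero {M : Type*} [AddCommGroup M] {φ : Module.End ℤ M} {m : M}
    (h : φ m = 0) (p : ℤ[X]) : aeval φ p m = p.eval 0 • m := by
  conv_lhs => rw [← divX_mul_X_add p]
  simp [h, coeff_zero_eq_eval_zero]

namespace CyclicDecomp

variable {M N Q : Type*} [AddCommGroup M] [AddCommGroup N] [AddCommGroup Q]

/-- A cyclic decomposition of `B ∘ A` yields one of `A ∘ B`, with the `d` largest invariants
multiplied by `X`, where `d` is the rank of the cokernel of `A`. -/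
theorem comp_comm [Module.Free ℤ Q] [Module.Finite ℤ Q] {A : M →ₗ[ℤ] N} {B : N →ₗ[ℤ] M}
    (hB : Function.Surjective B) {π : N →ₗ[ℤ] Q} (hπ : Function.Surjective π)
    (hA : ∀ n, π n = 0 ↔ ∃ m, A m = n) {F : ℤ[X]} (hF : aeval (B ∘ₗ A : Module.End ℤ M) F = 0)
    (hF0 : F.eval 0 ≠ 0) {k : ℕ} {a : ℕ → ℤ[X]} {v : ℕ → M}
    (h : CyclicDecomp (B ∘ₗ A : Module.End ℤ M) k a v)
    (hunit : ∀ j, Module.finrank ℤ Q ≤ j → IsUnit ((a j).eval 0))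
    (hthree : ∀ j, j + 1 = Module.finrank ℤ Q → (a j).eval 0 ∣ 3) :
    ∃ k b w, CyclicDecomp (A ∘ₗ B : Module.End ℤ N) k b w := by
  classical
  have hmap_B : ∀ p n, B (aeval (A ∘ₗ B : Module.End ℤ N) p n) =
      aeval (B ∘ₗ A : Module.End ℤ M) p (B n) := map_aeval_apply B fun _ => rfl
  have hmap_A : ∀ p m, A (aeval (B ∘ₗ A : Module.End ℤ M) p m) =
      aeval (A ∘ₗ B : Module.End ℤ N) p (A m) := map_aeval_apply A fun _ => rfl
  have hπA : ∀ m, π (A m) = 0 := fun m => (hA _).2 ⟨m, rfl⟩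
  have hmap_π : ∀ (p : ℤ[X]) n, π (aeval (A ∘ₗ B : Module.End ℤ N) p n) = p.eval 0 • π n := fun p n => by
    rw [map_aeval_apply (ψ := 0) π (fun n => by simp [hπA]),
      aeval_apply_of_apply_eq_zero (by simp)]
  have hker : ∀ n, B n = 0 → ∀ p : ℤ[X], aeval (A ∘ₗ B : Module.End ℤ N) p n = p.eval 0 • n :=
    fun n hn p => aeval_apply_of_apply_eq_zero (by simp [hn]) p
  have ha0 : ∀ j, (a j).eval 0 ≠ 0 := fun j h0 => by
    obtain ⟨g, rfl⟩ : a j ∣ F := h.dvd_of_aeval_eq_zero (by rw [hF, LinearMap.zero_apply])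
    exact hF0 (by rw [eval_mul, h0, zero_mul])
  generalize hd : Module.finrank ℤ Q = d at hunit hthree
  replace h := h.of_eq_one (k' := max k d) fun j hj => h.eq_one j ((le_max_left _ _).trans hj)
  have hdk : d ≤ max k d := le_max_right _ _
  generalize max k d = K at h hdk
  choose n hn using fun j => hB (v j)
  let S : Submodule ℤ Q := (LinearMap.ker B).map π
  have hS : ∀ z, B z = 0 → π z ∈ S := fun z hz => ⟨z, hz, rfl⟩
  have hSt : ∀ z, F.eval 0 • z ∈ S := fun z => by
    obtain ⟨z, rfl⟩ := hπ z
    rw [← hmap_π]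
    exact hS _ (by rw [hmap_B, hF, LinearMap.zero_apply])
  have hSa : ∀ j, (a j).eval 0 • π (n j) ∈ S := fun j => by
    rw [← hmap_π]
    exact hS _ (by rw [hmap_B, hn, h.kill])
  have hSunit : ∀ j, d ≤ j → π (n j) ∈ S := fun j hj => by
    obtain ⟨u, hu⟩ := hunit j hj
    have := S.smul_mem (↑u⁻¹ : ℤ) (hSa j)
    rwa [← hu, smul_smul, Units.inv_mul, one_smul] at this
  have hspan : Submodule.span ℤ (Set.range fun i : Fin d => π (n i)) ⊔ S = ⊤ := by
    rw [eq_top_iff]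
    intro z _
    obtain ⟨z, rfl⟩ := hπ z
    obtain ⟨f, hf⟩ := h.span (B z)
    have hz : B (z - ∑ j ∈ Finset.range K, aeval (A ∘ₗ B : Module.End ℤ N) (f j) (n j)) = 0 := by
      simp only [map_sub, map_sum, hmap_B, hn, hf, sub_self]
    have := Submodule.add_mem _ (Submodule.mem_sup_right (hS _ hz))
      (Submodule.sum_mem (Submodule.span ℤ (Set.range fun i : Fin d => π (n i)) ⊔ S)
        (t := Finset.range K) (f := fun j => (f j).eval 0 • π (n j)) fun j _ => ?_)
    · simpa only [map_sub, map_sum, hmap_π, sub_add_cancel] using this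
    · refine Submodule.smul_mem _ _ ?_
      by_cases hj : j < d
      · exact Submodule.mem_sup_left (Submodule.subset_span ⟨⟨j, hj⟩, rfl⟩)
      · exact Submodule.mem_sup_right (hSunit j (not_lt.1 hj))
  obtain ⟨q, hq, hqspan⟩ := exists_lift_span_eq_top d hd S (F.eval 0) hF0 hSt
    (fun i : Fin d => π (n i)) hspan fun i hi => by
      obtain ⟨c, hc⟩ := hthree i hi
      rw [hc, mul_comm, mul_smul]
      exact S.smul_mem _ (hSa i)
  have hw : ∀ j, ∃ w, B w = v j ∧ (∀ hj : j < d, π w = q ⟨j, hj⟩) ∧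
      (d ≤ j → aeval (A ∘ₗ B : Module.End ℤ N) (a j) w = 0) := fun j => by
    by_cases hj : j < d
    · obtain ⟨z, hz, hzq⟩ := hq ⟨j, hj⟩
      refine ⟨n j + z, ?_, fun _ => ?_, fun hj' => absurd hj (not_lt.2 hj')⟩
      · rw [map_add, hn, LinearMap.mem_ker.1 hz, add_zero]
      · rw [map_add, hzq, add_sub_cancel]
    · obtain ⟨u, hu⟩ := hunit j (not_lt.1 hj)
      have hBz : B (aeval (A ∘ₗ B : Module.End ℤ N) (a j) (n j)) = 0 := by
        rw [hmap_B, hn, h.kill]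
      refine ⟨n j - (↑u⁻¹ : ℤ) • aeval (A ∘ₗ B : Module.End ℤ N) (a j) (n j), ?_,
        fun hj' => absurd hj' hj, fun _ => ?_⟩
      · rw [map_sub, map_smul, hBz, smul_zero, sub_zero, hn]
      · rw [map_sub, map_smul, hker _ hBz, ← hu, smul_smul, Units.inv_mul, one_smul, sub_self]
  choose w hwB hwq hwa using hw
  have hw0 : ∀ j, d ≤ j → π (w j) = 0 := fun j hj => by
    have := congrArg π (hwa j hj)
    rw [hmap_π, map_zero] at this
    exact (smul_eq_zero.1 this).resolve_left (ha0 j)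
  have hqind : LinearIndependent ℤ q :=
    linearIndependent_of_top_le_span_of_card_eq_finrank hqspan.ge (by simp [hd])
  have hsumπ : ∀ f : ℕ → ℤ, ∑ j ∈ Finset.range K, f j • π (w j) = ∑ i : Fin d, f i • q i :=
    fun f => by
      rw [← Finset.sum_subset (Finset.range_mono hdk), Finset.sum_range]
      · exact Finset.sum_congr rfl fun i _ => by rw [hwq i i.isLt]
      · intro j _ hj
        rw [hw0 j (by simpa using hj), smul_zero]
  refine ⟨K, fun j => if j < d then X * a j else a j, w, fun j => ?_, fun j => ?_, fun j hj => ?_,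
    fun j => ?_, fun z => ?_, fun f hf j => ?_⟩
  · split_ifs
    exacts [monic_X.mul (h.monic j), h.monic j]
  · split_ifs with h1 h2 h2
    · exact mul_dvd_mul_left _ (h.succ_dvd j)
    · omega
    · exact (h.succ_dvd j).mul_left _
    · exact h.succ_dvd j
  · rw [if_neg (by omega), h.eq_one j hj]
  · split_ifs with hj
    · rw [map_mul, Module.End.mul_apply, aeval_X, LinearMap.comp_apply, hmap_B, hwB, h.kill,
        map_zero]
    · exact hwa j (not_lt.1 hj)
  · obtain ⟨c, hc⟩ := (Submodule.mem_span_range_iff_exists_fun ℤ).1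
      (hqspan.ge (Submodule.mem_top (x := π z)))
    let c' : ℕ → ℤ := fun j => if hj : j < d then c ⟨j, hj⟩ else 0
    have hc' : ∑ j ∈ Finset.range K, c' j • π (w j) = π z := by
      rw [hsumπ, ← hc]
      exact Finset.sum_congr rfl fun i _ => by simp [c']
    obtain ⟨m, hm⟩ := (hA (z - ∑ j ∈ Finset.range K, c' j • w j)).1 (by
      rw [map_sub, map_sum, sub_eq_zero, ← hc']
      simp)
    obtain ⟨g, hg⟩ := h.span m
    refine ⟨fun j => C (c' j) + g j * X, ?_⟩
    rw [← add_sub_cancel (∑ j ∈ Finset.range K, c' j • w j) z, ← hm, ← hg, map_sum, ← Finset.sum_add_distrib]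
    refine Finset.sum_congr rfl fun j _ => ?_
    rw [hmap_A, ← hwB]
    simp
  · have hdvd := h.indep f (by
      rw [← map_zero B, ← hf, map_sum]
      exact Finset.sum_congr rfl fun j _ => by rw [hmap_B, hwB])
    split_ifs with hj
    · obtain ⟨g, hg⟩ := hdvd j
      have hπf := congrArg π hf
      simp only [map_sum, hmap_π, map_zero] at hπf
      rw [hsumπ fun j => (f j).eval 0] at hπf
      have h0 := Fintype.linearIndependent_iff.1 hqind _ hπf ⟨j, hj⟩
      dsimp only at h0
      rw [hg, eval_mul] at h0
      have hg0 := (mul_eq_zero.1 h0).resolve_left (ha0 j)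
      rw [hg, mul_comm (a j)]
      exact mul_dvd_mul_right (X_dvd_iff.2 (by rwa [coeff_zero_eq_eval_zero])) _
    · exact hdvd j

end CyclicDecomp

theorem CyclicDecomp.lt_finrank_ker {M : Type*} [AddCommGroup M] [Module.Free ℤ M]
    [Module.Finite ℤ M] {φ : Module.End ℤ M} {k : ℕ} {a : ℕ → ℤ[X]} {v : ℕ → M}
    (h : CyclicDecomp φ k a v) {j : ℕ} {e : ℤ} (hj : X - C e ∣ a j) :
    j < Module.finrank ℤ (LinearMap.ker (φ - algebraMap ℤ (Module.End ℤ M) e)) := by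
  have hjk : j < k := by
    by_contra! hk
    obtain ⟨g, hg⟩ := hj
    rw [h.eq_one j hk] at hg
    simpa using congrArg (eval e) hg
  have hdvd : ∀ i : Fin (j + 1), X - C e ∣ a i := fun i =>
    hj.trans (h.dvd_of_le (Nat.lt_succ_iff.1 i.isLt))
  choose g hg using hdvd
  have hu : ∀ i : Fin (j + 1), aeval φ (g i) (v i) ∈
      LinearMap.ker (φ - algebraMap ℤ (Module.End ℤ M) e) := fun i => by
    have := h.kill i
    rw [hg, map_mul, Module.End.mul_apply] at this
    simpa using this
  have hind : LinearIndependent ℤ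
      (fun i => (⟨_, hu i⟩ : LinearMap.ker (φ - algebraMap ℤ (Module.End ℤ M) e))) := by
    rw [← LinearMap.linearIndependent_iff (Submodule.subtype _) (Submodule.ker_subtype _),
      Fintype.linearIndependent_iff]
    intro c hc i
    have := h.indep (fun i => if hi : i < j + 1 then C (c ⟨i, hi⟩) * g ⟨i, hi⟩ else 0) (by
      rw [← Finset.sum_subset (Finset.range_mono (Nat.succ_le_of_lt hjk)), Finset.sum_range, ← hc]
      · refine Finset.sum_congr rfl fun i _ => ?_
        rw [dif_pos i.isLt, map_mul, Module.End.mul_apply]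
        simp
      · intro i _ hi
        rw [dif_neg (by simpa using hi)]
        simp) i
    rw [dif_pos i.isLt, hg] at this
    have hne : g i ≠ 0 := fun h0 => (h.monic i).ne_zero (by rw [hg, h0, mul_zero])
    obtain ⟨q, hq⟩ := (mul_dvd_mul_iff_right hne).1 this
    simpa using congrArg (eval e) hq
  simpa using hind.fintype_card_le_finrank

theorem Polynomial.eval_zero_dvd_of_dvd_prod_X_sub_C {ι : Type*} [DecidableEq ι] {b : ℤ[X]}
    {E : ι → ℤ} {s t : Finset ι} (hb : b ∣ ∏ c ∈ s, (X - C (E c))) (ht : t ⊆ s)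
    (h : ∀ c ∈ s, X - C (E c) ∣ b → c ∈ t) : b.eval 0 ∣ ∏ c ∈ t, -E c := by
  have key : ∀ (u : Finset ι) (G : ℤ[X]), (∀ c ∈ u, ¬ X - C (E c) ∣ b) →
      b ∣ G * ∏ c ∈ u, (X - C (E c)) → b ∣ G := fun u G => by
    induction u using Finset.induction_on with
    | empty => simp
    | insert c u hc ih =>
      intro hu hbu
      refine ih (fun c' hc' => hu c' (Finset.mem_insert_of_mem hc')) ?_
      rw [Finset.prod_insert hc, mul_left_comm] at hbu
      exact ((prime_X_sub_C (E c)).left_dvd_or_dvd_right_of_dvd_mul hbu).resolve_left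
        (hu c (Finset.mem_insert_self _ _))
  have hbt : b ∣ ∏ c ∈ t, (X - C (E c)) := by
    refine key (s \ t) _ (fun c hc hcb => ?_) (by rwa [mul_comm, Finset.prod_sdiff ht])
    exact (Finset.mem_sdiff.1 hc).2 (h c (Finset.mem_sdiff.1 hc).1 hcb)
  simpa [eval_prod] using eval_dvd (x := 0) hbt

theorem finrank_ker_comp_sub_algebraMap_le {M N : Type*} [AddCommGroup M] [AddCommGroup N]
    [Module.Free ℤ M] [Module.Free ℤ N] [Module.Finite ℤ N] (A : M →ₗ[ℤ] N) (B : N →ₗ[ℤ] M)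
    {e : ℤ} (he : e ≠ 0) :
    Module.finrank ℤ (LinearMap.ker (B ∘ₗ A - algebraMap ℤ (Module.End ℤ M) e)) ≤
      Module.finrank ℤ (LinearMap.ker (A ∘ₗ B - algebraMap ℤ (Module.End ℤ N) e)) := by
  have hmem : ∀ m, m ∈ LinearMap.ker (B ∘ₗ A - algebraMap ℤ (Module.End ℤ M) e) ↔
      B (A m) = e • m := fun m => by simp [sub_eq_zero]
  refine LinearMap.finrank_le_finrank_of_injective (f := A.restrict fun m hm => ?_) ?_
  · rw [hmem] at hm
    simp [hm]
  · rw [← LinearMap.ker_eq_bot, LinearMap.ker_eq_bot']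
    rintro ⟨m, hm⟩ h0
    rw [hmem] at hm
    have h0 : A m = 0 := congrArg Subtype.val h0
    rw [h0, map_zero, eq_comm, smul_eq_zero] at hm
    exact Subtype.ext (hm.resolve_left he)

theorem eq_zero_of_eq_smul_apply {ι : Type*} {T : Module.End ℤ (ι → ℤ)} {e : ℤ}
    (he : e.natAbs ≠ 1) {m : ι → ℤ} (h : m = e • T m) : m = 0 := by
  have hpow : ∀ k : ℕ, m = e ^ k • (T ^ k) m := fun k => by
    induction k with
    | zero => simp
    | succ k ih =>
      rw [pow_succ, pow_succ, mul_smul, Module.End.mul_apply, ← map_smul, ← h]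
      exact ih
  funext i
  by_contra hi
  obtain ⟨k, hk⟩ := Int.finiteMultiplicity_iff.2 ⟨he, hi⟩
  exact hk ⟨(T ^ (k + 1)) m i, congrFun (hpow (k + 1)) i⟩

theorem finrank_ker_comp_sub_algebraMap_le_finrank_ker {ι κ : Type*} [Finite ι] [Finite κ]
    {A S : (ι → ℤ) →ₗ[ℤ] (κ → ℤ)} {B L : (κ → ℤ) →ₗ[ℤ] (ι → ℤ)} (hS : ∀ m, B (S m) = m)
    (hL : ∀ m, L (A m) = m) {e : ℤ} (he : e.natAbs ≠ 1) :
    Module.finrank ℤ (LinearMap.ker (B ∘ₗ A - algebraMap ℤ (Module.End ℤ (ι → ℤ)) e)) ≤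
      Module.finrank ℤ (LinearMap.ker B) := by
  refine LinearMap.finrank_le_finrank_of_injective
    (f := (A - e • S).restrict fun m hm => ?_) ?_
  · rw [LinearMap.mem_ker, LinearMap.sub_apply, LinearMap.smul_apply, map_sub, map_smul, hS]
    exact hm
  · rw [← LinearMap.ker_eq_bot, LinearMap.ker_eq_bot']
    rintro ⟨m, hm⟩ h0
    have h0 : A m - e • S m = 0 := congrArg Subtype.val h0
    refine Subtype.ext (eq_zero_of_eq_smul_apply (T := L ∘ₗ S) he ?_)
    rw [LinearMap.comp_apply, ← map_smul, ← sub_eq_zero.1 h0, hL]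

theorem mulVecLin_scalar {ι : Type*} [Fintype ι] [DecidableEq ι] (c : ℤ) :
    (Matrix.scalar ι c).mulVecLin = algebraMap ℤ (Module.End ℤ (ι → ℤ)) c := by
  refine LinearMap.ext fun m => funext fun i => ?_
  rw [Matrix.mulVecLin_apply, Matrix.scalar_apply, Matrix.mulVec_diagonal]
  rfl

namespace DiffPoset

variable {r : ℕ} (D : DiffPoset r)

theorem sum_level_eq_ncard {m : ℕ} (s : Set D.P) [DecidablePred (· ∈ s)]
    (hs : ∀ z ∈ s, D.rk z = m) :
    ∑ z : D.level m, (if (z : D.P) ∈ s then 1 else 0 : ℤ) = s.ncard := by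
  have : s = Subtype.val '' {z : D.level m | (z : D.P) ∈ s} := by
    ext z
    simpa using hs z
  rw [Finset.sum_boole]
  conv_rhs => rw [this, Set.ncard_image_of_injective _ Subtype.val_injective,
    Set.ncard_eq_toFinset_card']
  simp

theorem duMatrix_apply (n : ℕ) (x y : D.level n) :
    D.duMatrix ℤ n x y = {z : D.P | (x : D.P) ⋖ z ∧ (y : D.P) ⋖ z}.ncard := by
  classical
  rw [← D.sum_level_eq_ncard (m := n + 1) _ fun z hz => by rw [D.rk_covBy hz.1, x.2], duMatrix,
    Matrix.mul_apply]
  refine Finset.sum_congr rfl fun z _ => ?_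
  simp only [downMatrix, upMatrix, Set.mem_ofPred_eq, ite_and]
  split_ifs <;> simp

theorem up_mul_downMatrix_apply (n : ℕ) (x y : D.level (n + 1)) :
    (D.upMatrix ℤ n * D.downMatrix ℤ n) x y =
      {z : D.P | z ⋖ (x : D.P) ∧ z ⋖ (y : D.P)}.ncard := by
  classical
  rw [← D.sum_level_eq_ncard (m := n) _ fun z hz => by
    have := D.rk_covBy hz.1; have := x.2; omega, Matrix.mul_apply]
  refine Finset.sum_congr rfl fun z _ => ?_
  simp only [downMatrix, upMatrix, Set.mem_ofPred_eq, ite_and]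
  split_ifs <;> simp

theorem duMatrix_succ (n : ℕ) :
    D.duMatrix ℤ (n + 1) = D.upMatrix ℤ n * D.downMatrix ℤ n + Matrix.scalar _ (r : ℤ) := by
  ext x y
  rw [Matrix.add_apply, duMatrix_apply, up_mul_downMatrix_apply, Matrix.scalar_apply]
  by_cases hxy : x = y
  · subst hxy
    simp only [and_self, D.d3, Matrix.diagonal_apply_eq]
    push_cast; rfl
  · rw [Matrix.diagonal_apply_ne _ hxy, add_zero, D.d2 fun h => hxy (Subtype.ext h)]

theorem eq_bot_of_rk_eq_zero {x : D.P} (hx : D.rk x = 0) : x = D.bot := by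
  by_contra hne
  have hlt : D.bot < x := lt_of_le_of_ne (D.bot_le x) (Ne.symm hne)
  obtain ⟨y, hy⟩ := ((D.locallyFinite D.bot x).subset Set.Ico_subset_Icc_self).exists_maximal
    ⟨D.bot, le_rfl, hlt⟩
  have hcov : y ⋖ x := ⟨hy.prop.2, fun z hyz hzx =>
    hyz.not_ge (hy.le_of_ge ⟨D.bot_le z, hzx⟩ hyz.le)⟩
  have := D.rk_covBy hcov
  omega

theorem duMatrix_zero : D.duMatrix ℤ 0 = Matrix.scalar _ (r : ℤ) := by
  ext x y
  obtain rfl : x = y :=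
    Subtype.ext ((D.eq_bot_of_rk_eq_zero x.2).trans (D.eq_bot_of_rk_eq_zero y.2).symm)
  have : {z : D.P | z ⋖ (x : D.P)} = ∅ := by
    ext z
    simp only [Set.mem_ofPred_eq, Set.mem_empty_iff_false, iff_false]
    intro hz
    have := D.rk_covBy hz
    have := x.2
    omega
  rw [duMatrix_apply, Matrix.scalar_apply]
  simp [D.d3, this]

theorem du_succ (n : ℕ) : D.du ℤ (n + 1) =
    (D.up ℤ n) ∘ₗ (D.down ℤ n) + algebraMap ℤ (Module.End ℤ (D.level (n + 1) → ℤ)) r := by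
  have h := congrArg Matrix.mulVecLin (D.duMatrix_succ n)
  rw [duMatrix, Matrix.mulVecLin_mul, Matrix.mulVecLin_add, Matrix.mulVecLin_mul] at h
  rw [du, down, up, h]
  rw [mulVecLin_scalar]
  rfl

theorem du_zero : D.du ℤ 0 = algebraMap ℤ (Module.End ℤ (D.level 0 → ℤ)) r := by
  have h := congrArg Matrix.mulVecLin D.duMatrix_zero
  rw [duMatrix, Matrix.mulVecLin_mul] at h
  rw [du, down, up, h, mulVecLin_scalar]

variable {D} in
theorem exists_section {n : ℕ} (h : Function.Surjective (D.down ℤ n)) :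
    ∃ S : (D.level n → ℤ) →ₗ[ℤ] (D.level (n + 1) → ℤ), ∀ m, D.down ℤ n (S m) = m := by
  obtain ⟨S, hS⟩ := Module.projective_lifting_property (D.down ℤ n) LinearMap.id h
  exact ⟨S, LinearMap.congr_fun hS⟩

variable {D} in
theorem exists_retraction {n : ℕ} (h : Function.Surjective (D.down ℤ n)) :
    ∃ L : (D.level (n + 1) → ℤ) →ₗ[ℤ] (D.level n → ℤ), ∀ m, L (D.up ℤ n m) = m := by
  obtain ⟨S, hS⟩ := exists_section h
  have h1 : D.downMatrix ℤ n * LinearMap.toMatrix' S = 1 := by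
    rw [← LinearMap.toMatrix'_toLin' (D.downMatrix ℤ n), ← LinearMap.toMatrix'_comp,
      ← LinearMap.toMatrix'_id]
    exact congrArg _ (LinearMap.ext hS)
  refine ⟨(LinearMap.toMatrix' S).transpose.mulVecLin, fun m => ?_⟩
  have h2 := congrArg Matrix.transpose h1
  rw [Matrix.transpose_mul, Matrix.transpose_one] at h2
  change (LinearMap.toMatrix' S).transpose.mulVec ((D.downMatrix ℤ n).transpose.mulVec m) = m
  rw [Matrix.mulVec_mulVec, h2, Matrix.one_mulVec]

theorem finrank_ker_of_surjective {n : ℕ} {B : (D.level (n + 1) → ℤ) →ₗ[ℤ] (D.level n → ℤ)}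
    (h : Function.Surjective B) :
    (Module.finrank ℤ (LinearMap.ker B) : ℤ) = D.dp (n + 1) := by
  have := (LinearMap.ker B).finrank_quotient_add_finrank
  rw [(B.quotKerEquivOfSurjective h).finrank_eq, Module.finrank_pi, Module.finrank_pi] at this
  rw [dp, p, p, ← this]
  push_cast
  ring

/-- The product of `X - r (c + 1)` over `c ≤ n`, which annihilates `DU_n`. -/
noncomputable def duPoly (_D : DiffPoset r) (n : ℕ) : ℤ[X] :=
  ∏ c ∈ Finset.range (n + 1), (X - C ((r : ℤ) * (c + 1)))

theorem aeval_du_duPoly (n : ℕ) : aeval (D.du ℤ n) (D.duPoly n) = 0 := by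
  induction n with
  | zero => simp [duPoly, du_zero]
  | succ n ih =>
    have h1 : D.duPoly (n + 1) = (X * D.duPoly n).comp (X - C (r : ℤ)) := by
      rw [duPoly, Finset.prod_range_succ', mul_comp, duPoly, prod_comp, mul_comm]
      congr 1
      · simp
      · refine Finset.prod_congr rfl fun c _ => ?_
        simp only [sub_comp, X_comp, C_comp, sub_sub, ← C_add]
        congr 2
        push_cast
        ring
    rw [h1, aeval_comp]
    have h2 : aeval (D.du ℤ (n + 1)) (X - C (r : ℤ)) = (D.up ℤ n) ∘ₗ (D.down ℤ n) := by
      rw [map_sub, aeval_X, aeval_C, du_succ, add_sub_cancel_right]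
    have h3 : ∀ m, D.down ℤ n (aeval ((D.up ℤ n) ∘ₗ (D.down ℤ n) : Module.End ℤ _)
        (D.duPoly n) m) = 0 := fun m => by
      rw [map_aeval_apply (ψ := D.du ℤ n) (D.down ℤ n) fun _ => rfl, ih, LinearMap.zero_apply]
    rw [h2, map_mul, aeval_X]
    exact LinearMap.ext fun m => (congrArg (D.up ℤ n) (h3 m)).trans (map_zero _)

theorem finrank_ker_du_sub (hr : 0 < r) (hdown : ∀ n, Function.Surjective (D.down ℤ n))
    (m c : ℕ) : (Module.finrank ℤ (LinearMap.ker (D.du ℤ (m + c) -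
      algebraMap ℤ (Module.End ℤ (D.level (m + c) → ℤ)) ((r : ℤ) * (c + 1)))) : ℤ) = D.dp m := by
  induction c with
  | zero =>
    cases m with
    | zero =>
      have : D.du ℤ 0 - algebraMap ℤ (Module.End ℤ (D.level 0 → ℤ))
          ((r : ℤ) * ((0 : ℕ) + 1)) = 0 := by
        rw [du_zero, Nat.cast_zero, zero_add, mul_one, sub_self]
      rw [add_zero, this, LinearMap.ker_zero, finrank_top, Module.finrank_pi, dp, p]
    | succ m =>
      obtain ⟨L, hL⟩ := exists_retraction (hdown m)
      rw [← D.finrank_ker_of_surjective (hdown m)]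
      have : D.du ℤ (m + 1) - algebraMap ℤ (Module.End ℤ (D.level (m + 1) → ℤ))
          ((r : ℤ) * ((0 : ℕ) + 1)) = (D.up ℤ m) ∘ₗ (D.down ℤ m) := by
        rw [du_succ, Nat.cast_zero, zero_add, mul_one, add_sub_cancel_right]
      rw [add_zero, this, LinearMap.ker_comp_of_ker_eq_bot _
        (LinearMap.ker_eq_bot_of_inverse (LinearMap.ext hL))]
  | succ c ih =>
    have he : (r : ℤ) * (c + 1) ≠ 0 := by positivity
    have : D.du ℤ (m + c + 1) - algebraMap ℤ (Module.End ℤ (D.level (m + c + 1) → ℤ))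
        ((r : ℤ) * ((c + 1 : ℕ) + 1)) = (D.up ℤ (m + c)) ∘ₗ (D.down ℤ (m + c)) -
          algebraMap ℤ (Module.End ℤ (D.level (m + c + 1) → ℤ)) ((r : ℤ) * (c + 1)) := by
      rw [du_succ, Nat.cast_succ, mul_add (r : ℤ) (_ + 1), mul_one, map_add]
      abel
    rw [← add_assoc, this, ← ih]
    congr 1
    exact le_antisymm (finrank_ker_comp_sub_algebraMap_le _ _ he)
      (finrank_ker_comp_sub_algebraMap_le _ _ he)

theorem dp_le_dp_succ (hr : 0 < r) (hdown : ∀ n, Function.Surjective (D.down ℤ n))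
    {m c : ℕ} (hc : r * (c + 1) ≠ 1) : D.dp m ≤ D.dp (m + c + 1) := by
  obtain ⟨L, hL⟩ := exists_retraction (hdown (m + c))
  obtain ⟨S, hS⟩ := exists_section (hdown (m + c))
  rw [← D.finrank_ker_of_surjective (hdown (m + c)), ← D.finrank_ker_du_sub hr hdown m c]
  exact_mod_cast finrank_ker_comp_sub_algebraMap_le_finrank_ker hS hL (by exact_mod_cast hc)

variable {D} in
theorem eval_zero_dvd_prod (hr : 0 < r) (hdown : ∀ n, Function.Surjective (D.down ℤ n))
    {n k : ℕ} {a : ℕ → ℤ[X]} {v : ℕ → D.level n → ℤ} (h : CyclicDecomp (D.du ℤ n) k a v) {j : ℕ}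
    {t : Finset ℕ} (ht : t ⊆ Finset.range (n + 1))
    (hj : ∀ c ∈ Finset.range (n + 1), c ∉ t → D.dp (n - c) ≤ j) :
    (a j).eval 0 ∣ ∏ c ∈ t, -((r : ℤ) * (c + 1)) := by
  refine eval_zero_dvd_of_dvd_prod_X_sub_C
    (h.dvd_of_aeval_eq_zero (f := D.duPoly n) (by rw [aeval_du_duPoly, LinearMap.zero_apply]))
    ht fun c hc hdvd => ?_
  by_contra hct
  have h1 := hj c hc hct
  obtain ⟨m, rfl⟩ : ∃ m, n = m + c :=
    ⟨n - c, (Nat.sub_add_cancel (Nat.lt_succ_iff.1 (Finset.mem_range.1 hc))).symm⟩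
  have h2 := h.lt_finrank_ker hdvd
  rw [Nat.add_sub_cancel, ← D.finrank_ker_du_sub hr hdown m c] at h1
  omega

theorem hasRCF_du_succ (hr : 0 < r) (hdown : ∀ n, Function.Surjective (D.down ℤ n)) {n : ℕ}
    (hgrow : D.dp (n - (if r = 1 then 1 else 0)) + 1 ≤ D.dp (n + 1))
    (hn : (D.du ℤ n).HasRCF) : (D.du ℤ (n + 1)).HasRCF := by
  obtain ⟨k, a, v, h⟩ := hn.exists_cyclicDecomp
  obtain ⟨L, hL⟩ := exists_retraction (hdown n)
  have hLsurj : Function.Surjective L := fun m => ⟨_, hL m⟩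
  have hd := D.finrank_ker_of_surjective hLsurj
  have hprojmem : ∀ m, (LinearMap.id - (D.up ℤ n) ∘ₗ L : Module.End ℤ _) m ∈ LinearMap.ker L :=
    fun m => by simp [hL]
  obtain ⟨k', b, w, h'⟩ := h.comp_comm (hdown n)
    (π := (LinearMap.id - (D.up ℤ n) ∘ₗ L : Module.End ℤ _).codRestrict (LinearMap.ker L) hprojmem)
    (fun m => ⟨m, Subtype.ext (by simp)⟩)
    (fun m => by
      rw [Subtype.ext_iff]
      simp only [LinearMap.codRestrict_apply, LinearMap.sub_apply, LinearMap.id_apply,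
        LinearMap.comp_apply, ZeroMemClass.coe_zero, sub_eq_zero]
      exact ⟨fun h => ⟨_, h.symm⟩, by rintro ⟨x, rfl⟩; rw [hL]⟩)
    (D.aeval_du_duPoly n)
    (by
      rw [duPoly, eval_prod, Finset.prod_ne_zero_iff]
      intro c _
      simp only [eval_sub, eval_X, eval_C, zero_sub, neg_ne_zero]
      positivity)
    (fun j hj => by
      refine isUnit_of_dvd_unit (eval_zero_dvd_prod hr hdown h
        (t := (Finset.range (n + 1)).filter fun c => r * (c + 1) = 1) (Finset.filter_subset _ _)
        fun c hc hct => ?_) ?_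
      · obtain ⟨m, rfl⟩ : ∃ m, n = m + c :=
          ⟨n - c, (Nat.sub_add_cancel (Nat.lt_succ_iff.1 (Finset.mem_range.1 hc))).symm⟩
        have := D.dp_le_dp_succ hr hdown (m := m) (c := c) fun hc1 =>
          hct (Finset.mem_filter.2 ⟨hc, hc1⟩)
        rw [Nat.add_sub_cancel]
        omega
      · refine IsUnit.prod_iff.2 fun c hc => ?_
        have : (r : ℤ) * (c + 1) = 1 := by exact_mod_cast (Finset.mem_filter.1 hc).2
        rw [this]
        exact isUnit_one.neg)
    (fun j hj => by
      by_cases hr1 : r = 1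
      · have hdpj : D.dp (n - 1) ≤ j := by rw [if_pos hr1] at hgrow; omega
        refine (eval_zero_dvd_prod hr hdown h
          (t := (Finset.range (n + 1)).filter (· ∈ ({0, 2} : Finset ℕ))) (Finset.filter_subset _ _)
          fun c hc hct => ?_).trans ((Finset.prod_dvd_prod_of_subset _ {0, 2} _ fun c hc =>
            (Finset.mem_filter.1 hc).2).trans ?_)
        · have hc02 : c ≠ 0 ∧ c ≠ 2 := by
            simpa [hc] using fun h => hct (Finset.mem_filter.2 ⟨hc, h⟩)
          rw [Finset.mem_range] at hc
          by_cases hc1 : c = 1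
          · rwa [hc1]
          · have := D.dp_le_dp_succ hr hdown (m := n - c) (c := c - 2) (by
              rw [hr1]; omega)
            rw [show n - c + (c - 2) + 1 = n - 1 by omega] at this
            exact this.trans hdpj
        · simp [hr1]
      · have hdpj : D.dp n ≤ j := by rw [if_neg hr1, Nat.sub_zero] at hgrow; omega
        refine (eval_zero_dvd_prod hr hdown h (t := ∅) (Finset.empty_subset _)
          fun c hc _ => ?_).trans (by simp)
        rw [Finset.mem_range] at hc
        rcases Nat.eq_zero_or_pos c with rfl | hc0
        · exact hdpj
        · have := D.dp_le_dp_succ hr hdown (m := n - c) (c := c - 1) (by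
            intro h1
            exact hr1 (Nat.eq_one_of_mul_eq_one_right h1))
          rw [show n - c + (c - 1) + 1 = n by omega] at this
          exact this.trans hdpj)
  have := (h'.add_algebraMap r).hasRCF
  rwa [← du_succ] at this

end DiffPoset

/-- **Main Theorem.** Let `P` be an `r`-differential poset such that (i) all
down maps over `ℤ` are surjective, (ii) for some `l ≥ 0` one has
`Δp_n ≥ Δp_{n-1-δ_{r,1}} + 1` for every `n ≥ l + 1`, and (iii) `DU_n` has rational canonical
form over `ℤ` for all `n ≤ l`. Then `DU_n` has rational canonical form over `ℤ` for all
`n ≥ 0`. -/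
theorem du_hasRCF_of_growth {r : ℕ} (hr : 0 < r) (D : DiffPoset r)
    (hdown : ∀ n : ℕ, Function.Surjective (D.down ℤ n))
    (l : ℕ)
    (hgrow : ∀ n : ℕ, l + 1 ≤ n →
      D.dp (n - 1 - (if r = 1 then 1 else 0)) + 1 ≤ D.dp n)
    (hbase : ∀ n : ℕ, n ≤ l → (D.du ℤ n).HasRCF) :
    ∀ n : ℕ, (D.du ℤ n).HasRCF := by
  intro n
  induction n with
  | zero => exact hbase 0 (Nat.zero_le l)
  | succ n ih =>
    rcases Nat.lt_or_ge l (n + 1) with hn | hn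
    · exact D.hasRCF_du_succ hr hdown (hgrow (n + 1) hn) ih
    · exact hbase (n + 1) hn
end

section
/- Let P and Q be differential posets (r-differential and s-differential respectively), with rank sizes p_n and q_n. Suppose that Δq_n ≥ Δq_{n−1} for all n ≥ 2 (where Δq_n := q_n − q_{n−1}), and that all the down maps over ℤ of at least one of the two posets are surjective. Then for every n ≥ 0, the matrix [DU_n] + x·I of the Cartesian product poset P × Q (with the componentwise order) has Smith normal form over ℤ[x]. -/
open Polynomial

namespace DiffPoset

variable {r s : ℕ} (D : DiffPoset r) (E : DiffPoset s)

lemma plevel_finite (n : ℕ) :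
    {x : D.P × E.P | D.rk x.1 + E.rk x.2 = n}.Finite := by
  have h1 : {a : D.P | D.rk a ≤ n}.Finite := by
    have : {a : D.P | D.rk a ≤ n} = ⋃ i ∈ Set.Iic n, {a : D.P | D.rk a = i} := by
      ext a
      simp [Set.mem_iUnion]
    rw [this]
    exact Set.Finite.biUnion (Set.finite_Iic n) fun i _ => D.fiberFinite i
  have h2 : {a : E.P | E.rk a ≤ n}.Finite := by
    have : {a : E.P | E.rk a ≤ n} = ⋃ i ∈ Set.Iic n, {a : E.P | E.rk a = i} := by
      ext a
      simp [Set.mem_iUnion]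
    rw [this]
    exact Set.Finite.biUnion (Set.finite_Iic n) fun i _ => E.fiberFinite i
  apply Set.Finite.subset (h1.prod h2)
  rintro ⟨a, b⟩ h
  simp only [Set.mem_setOf_eq] at h
  exact ⟨by simp; omega, by simp; omega⟩

/-- The `n`-th rank of the Cartesian product poset `P × Q`. -/
abbrev plevel (n : ℕ) : Type := {x : D.P × E.P // D.rk x.1 + E.rk x.2 = n}

noncomputable instance (n : ℕ) : Fintype (D.plevel E n) := (D.plevel_finite E n).fintype

noncomputable instance (n : ℕ) : DecidableEq (D.plevel E n) := Classical.decEq _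

noncomputable instance (x y : D.P × E.P) : Decidable (x ⋖ y) := Classical.dec _

/-- The matrix of the up map `U_n` of the product poset `P × Q` in the standard basis. -/
noncomputable def pupMatrix (R : Type*) [CommRing R] (n : ℕ) :
    Matrix (D.plevel E (n + 1)) (D.plevel E n) R :=
  fun y x => if x.1 ⋖ y.1 then 1 else 0

/-- The matrix of the down map `D_{n+1}` of the product poset `P × Q` in the standard basis. -/
noncomputable def pdownMatrix (R : Type*) [CommRing R] (n : ℕ) :
    Matrix (D.plevel E n) (D.plevel E (n + 1)) R :=
  fun y x => if y.1 ⋖ x.1 then 1 else 0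

/-- The matrix `[DU_n]` of the product poset `P × Q` in the standard basis. -/
noncomputable def pduMatrix (R : Type*) [CommRing R] (n : ℕ) :
    Matrix (D.plevel E n) (D.plevel E n) R :=
  D.pdownMatrix E R n * D.pupMatrix E R n

end DiffPoset

section

open Matrix

universe u

/-- A matrix over `ℤ` with a right inverse is, up to an invertible change of columns, `[1 0]`. -/
lemma Matrix.exists_kernel_complement {ι κ : Type*} [Fintype ι] [Fintype κ] [DecidableEq ι]
    [DecidableEq κ] (A : Matrix ι κ ℤ) (S : Matrix κ ι ℤ) (hS : A * S = 1) :
    ∃ (l : ℕ) (K : Matrix κ (Fin l) ℤ) (V : Matrix (Fin l) κ ℤ),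
      A * K = 0 ∧ V * S = 0 ∧ V * K = 1 ∧ S * A + K * V = 1 := by
  obtain ⟨l, ⟨b⟩⟩ := Submodule.nonempty_basis_of_pid (Pi.basisFun ℤ κ) (LinearMap.ker A.mulVecLin)
  have hAS : A.mulVecLin ∘ₗ S.mulVecLin = LinearMap.id := by
    rw [← Matrix.mulVecLin_mul, hS, Matrix.mulVecLin_one]
  have hASx : ∀ x, A.mulVecLin (S.mulVecLin x) = x := fun x => LinearMap.congr_fun hAS x
  let q : (κ → ℤ) →ₗ[ℤ] LinearMap.ker A.mulVecLin :=
    (LinearMap.id - S.mulVecLin ∘ₗ A.mulVecLin).codRestrict _ fun x => by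
      rw [LinearMap.mem_ker]
      simp only [LinearMap.sub_apply, LinearMap.id_apply, LinearMap.comp_apply, map_sub, hASx,
        sub_self]
  have hq : ∀ x, (q x : κ → ℤ) = x - S.mulVecLin (A.mulVecLin x) := fun x => rfl
  let k : (Fin l → ℤ) →ₗ[ℤ] (κ → ℤ) := (LinearMap.ker A.mulVecLin).subtype ∘ₗ b.equivFun.symm
  let v : (κ → ℤ) →ₗ[ℤ] (Fin l → ℤ) := b.equivFun ∘ₗ q
  have hAk : ∀ x, A.mulVecLin (k x) = 0 := fun x => (b.equivFun.symm x).2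
  have hA : A = LinearMap.toMatrix' A.mulVecLin := by
    rw [← Matrix.toLin'_apply', LinearMap.toMatrix'_toLin']
  have hS' : S = LinearMap.toMatrix' S.mulVecLin := by
    rw [← Matrix.toLin'_apply', LinearMap.toMatrix'_toLin']
  refine ⟨l, LinearMap.toMatrix' k, LinearMap.toMatrix' v, ?_, ?_, ?_, ?_⟩
  · conv_lhs => rw [hA]
    rw [← LinearMap.toMatrix'_comp, LinearEquiv.map_eq_zero_iff]
    exact LinearMap.ext hAk
  · conv_lhs => rw [hS']
    rw [← LinearMap.toMatrix'_comp, LinearEquiv.map_eq_zero_iff]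
    refine LinearMap.ext fun x => ?_
    have : q (S.mulVecLin x) = 0 := Subtype.ext (by rw [hq, hASx, sub_self]; rfl)
    simp only [v, LinearMap.comp_apply, this, map_zero, LinearMap.zero_apply]
  · rw [← LinearMap.toMatrix'_comp, ← LinearMap.toMatrix'_id]
    congr 1
    refine LinearMap.ext fun x => ?_
    have : q (k x) = b.equivFun.symm x :=
      Subtype.ext (by rw [hq, hAk, map_zero, sub_zero]; rfl)
    simp only [v, LinearMap.comp_apply, this, LinearEquiv.coe_coe, LinearEquiv.apply_symm_apply,
      LinearMap.id_apply]
  · conv_lhs => rw [hS', hA]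
    rw [← LinearMap.toMatrix'_comp, ← LinearMap.toMatrix'_comp, ← map_add,
      ← LinearMap.toMatrix'_id]
    congr 1
    refine LinearMap.ext fun x => ?_
    have : k (v x) = q x := by simp [k, v]
    simp only [LinearMap.add_apply, LinearMap.comp_apply, this, hq, LinearMap.id_apply]
    abel

section

variable {M K L : Type*} [AddCommGroup M] [AddCommGroup K] [AddCommGroup L]

lemma exists_functional_eq_one [Module.Free ℤ M] [Module.Finite ℤ M]
    (h : 0 < Module.finrank ℤ M) : ∃ (ψ : M →ₗ[ℤ] ℤ) (v : M), ψ v = 1 := by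
  let b := Module.finBasis ℤ M
  exact ⟨b.coord ⟨0, h⟩, b ⟨0, h⟩, by simp⟩

lemma finrank_ker_add_one [Module.Finite ℤ M] (φ : M →ₗ[ℤ] ℤ) (v : M) (h : φ v = 1) :
    Module.finrank ℤ (LinearMap.ker φ) + 1 = Module.finrank ℤ M := by
  have h1 := (LinearMap.ker φ).finrank_quotient_add_finrank
  have h2 := (φ.quotKerEquivOfSurjective fun z => ⟨z • v, by simp [h]⟩).finrank_eq
  rw [h2, Module.finrank_self] at h1
  omega

lemma exists_functional_eq_one_of_two_le_finrank [Module.Free ℤ M] [Module.Finite ℤ M]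
    (h : 2 ≤ Module.finrank ℤ M) (φ : M →ₗ[ℤ] ℤ) (a : M) :
    ∃ (ψ : M →ₗ[ℤ] ℤ) (a' : M), φ a' = φ a ∧ ψ a' = 1 := by
  by_cases hφ : φ = 0
  · obtain ⟨ψ, v, hv⟩ := exists_functional_eq_one (M := M) (by omega)
    exact ⟨ψ, v, by simp [hφ], hv⟩
  obtain ⟨γ, hγ⟩ := (IsPrincipalIdealRing.principal (LinearMap.range φ)).principal
  have hγ0 : γ ≠ 0 := by
    rintro rfl
    exact hφ (LinearMap.range_eq_bot.1 (by simpa using hγ))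
  have hdvd : ∀ x, γ ∣ φ x := fun x => by
    have : φ x ∈ Submodule.span ℤ {γ} := hγ ▸ LinearMap.mem_range_self φ x
    exact Ideal.mem_span_singleton.1 this
  obtain ⟨e, he⟩ : γ ∈ LinearMap.range φ := hγ ▸ Submodule.mem_span_singleton_self γ
  let φ' : M →ₗ[ℤ] ℤ :=
    { toFun := fun x => φ x / γ
      map_add' := fun x y => by rw [map_add, Int.add_ediv_of_dvd_left (hdvd x)]
      map_smul' := fun c x => by
        simp only [map_smul, smul_eq_mul, RingHom.id_apply, Int.mul_ediv_assoc c (hdvd x)] }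
  have hφ' : ∀ x, γ * φ' x = φ x := fun x => Int.mul_ediv_cancel' (hdvd x)
  have he' : φ' e = 1 := mul_left_cancel₀ hγ0 (by rw [hφ', he, mul_one])
  have hrk := finrank_ker_add_one φ' e he'
  obtain ⟨ψ, n, hn⟩ := exists_functional_eq_one (M := LinearMap.ker φ') (by omega)
  let ρ : M →ₗ[ℤ] LinearMap.ker φ' :=
    (LinearMap.id - φ'.smulRight e).codRestrict _ fun x => by
      rw [LinearMap.mem_ker]
      simp [he']
  have hρ : ρ (φ' a • e + n) = n := Subtype.ext <| by
    change φ' a • e + n - φ' (φ' a • e + n) • e = (n : M)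
    rw [map_add, map_smul, he', LinearMap.mem_ker.1 n.2]
    simp
  refine ⟨ψ ∘ₗ ρ, φ' a • e + n, ?_, by rw [LinearMap.comp_apply, hρ, hn]⟩
  rw [← hφ', ← hφ' a, map_add, map_smul, he', LinearMap.mem_ker.1 n.2]
  simp

/-- Given `f : M → K` and `g : L → K` jointly surjective with `rank K < rank M`, the map `f` can
be made surjective by adding a map that factors through `g`. -/
lemma exists_add_comp_surjective (k : ℕ) :
    ∀ {M K : Type u} [AddCommGroup M] [AddCommGroup K] [Module.Free ℤ M] [Module.Finite ℤ M]
      [Module.Free ℤ K] [Module.Finite ℤ K],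
      Module.finrank ℤ K = k → k < Module.finrank ℤ M → ∀ (f : M →ₗ[ℤ] K) (g : L →ₗ[ℤ] K),
      (∀ y, ∃ a b, f a + g b = y) → ∃ c : M →ₗ[ℤ] L, Function.Surjective (f + g ∘ₗ c) := by
  induction k with
  | zero =>
    intro M K _ _ _ _ _ _ hK hM f g hfg
    have := Module.finrank_zero_iff.1 hK
    exact ⟨0, fun y => ⟨0, Subsingleton.elim _ _⟩⟩
  | succ k ih =>
    intro M K _ _ _ _ _ _ hK hM f g hfg
    obtain ⟨π, v, hv⟩ := exists_functional_eq_one (M := K) (by omega)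
    obtain ⟨a₀, b₀, hab⟩ := hfg v
    obtain ⟨ψ, a', ha', hψ⟩ :=
      exists_functional_eq_one_of_two_le_finrank (M := M) (by omega) (π ∘ₗ f) a₀
    obtain ⟨f₁, hf₁⟩ : ∃ f₁ : M →ₗ[ℤ] K, f₁ = f + g ∘ₗ ψ.smulRight b₀ := ⟨_, rfl⟩
    have he : π (f₁ a') = 1 := by
      have : π (f a') = π (f a₀) := ha'
      rw [← hv, ← hab, hf₁]
      simp [hψ, this]
    have hfg₁ : ∀ y, ∃ a b, f₁ a + g b = y := fun y => by
      obtain ⟨a, b, h⟩ := hfg y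
      refine ⟨a, b - ψ a • b₀, ?_⟩
      rw [← h, hf₁]
      simp
    have hrM := finrank_ker_add_one (π ∘ₗ f₁) a' he
    have hrK := finrank_ker_add_one π v hv
    let q : K →ₗ[ℤ] LinearMap.ker π :=
      (LinearMap.id - π.smulRight (f₁ a')).codRestrict _ fun x => by
        rw [LinearMap.mem_ker]
        simp [he]
    let ρ : M →ₗ[ℤ] LinearMap.ker (π ∘ₗ f₁) :=
      (LinearMap.id - (π ∘ₗ f₁).smulRight a').codRestrict _ fun x => by
        rw [LinearMap.mem_ker]
        simp [he]
    have hq : ∀ x, (q x : K) = x - π x • f₁ a' := fun x => rfl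
    have hρ : ∀ x, (ρ x : M) = x - π (f₁ x) • a' := fun x => rfl
    have hq' : ∀ x : LinearMap.ker π, q x = x := fun x => Subtype.ext <| by
      rw [hq, LinearMap.mem_ker.1 x.2, zero_smul, sub_zero]
    have hρ' : ∀ x : LinearMap.ker (π ∘ₗ f₁), ρ x = x := fun x => Subtype.ext <| by
      rw [hρ, show π (f₁ x) = 0 from x.2, zero_smul, sub_zero]
    obtain ⟨c, hc⟩ := ih (by omega) (by omega)
      (q ∘ₗ f₁ ∘ₗ (LinearMap.ker (π ∘ₗ f₁)).subtype) (q ∘ₗ g) fun y => by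
        obtain ⟨a, b, h⟩ := hfg₁ y
        refine ⟨ρ a, b, ?_⟩
        have : q (f₁ (ρ a)) = q (f₁ a) := Subtype.ext <| by
          rw [hq, hq, hρ, map_sub, map_sub, map_smul, map_smul, he]
          simp
        simp only [LinearMap.comp_apply, Submodule.subtype_apply, this]
        rw [← map_add, h, hq']
    refine ⟨ψ.smulRight b₀ + c ∘ₗ ρ, fun y => ?_⟩
    obtain ⟨n, hn⟩ := hc (q y)
    have key : ∀ x, (f + g ∘ₗ (ψ.smulRight b₀ + c ∘ₗ ρ)) x = f₁ x + g (c (ρ x)) := fun x => by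
      have : f₁ x = f x + g (ψ x • b₀) := by rw [hf₁]; rfl
      rw [this]
      simp [add_assoc]
    have hρa : ρ a' = 0 := Subtype.ext <| by rw [hρ, he]; simp
    have hn' : q (f₁ n + g (c n)) = q y := by rw [← hn]; simp
    have hn'' := congrArg Subtype.val hn'
    rw [hq, hq] at hn''
    refine ⟨n + (π y - π (f₁ n + g (c n))) • a', ?_⟩
    rw [key, map_add ρ, map_smul ρ, hρa, hρ', smul_zero, add_zero, map_add f₁, map_smul f₁]
    linear_combination (norm := module) hn''

end

lemma Matrix.exists_add_mul_left_inverse {μ κ ν : Type} [Fintype μ] [Fintype κ] [Fintype ν]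
    [DecidableEq μ] [DecidableEq κ] [DecidableEq ν]
    (h : Fintype.card κ < Fintype.card μ) (A : Matrix ν κ ℤ) (B : Matrix μ κ ℤ)
    (L₁ : Matrix κ ν ℤ) (L₂ : Matrix κ μ ℤ) (hL : L₁ * A + L₂ * B = 1) :
    ∃ (Y : Matrix μ ν ℤ) (L : Matrix κ μ ℤ), L * (B + Y * A) = 1 := by
  obtain ⟨c, hc⟩ := exists_add_comp_surjective (L := ν → ℤ) (Fintype.card κ)
    (M := μ → ℤ) (K := κ → ℤ) (by simp) (by simpa using h) B.vecMulLinear A.vecMulLinear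
    fun y => ⟨y ᵥ* L₂, y ᵥ* L₁, by
      simp only [Matrix.vecMulLinear_apply, Matrix.vecMul_vecMul]
      rw [← Matrix.vecMul_add, add_comm, hL, Matrix.vecMul_one]⟩
  refine ⟨(LinearMap.toMatrix' c)ᵀ, ?_⟩
  rw [← Matrix.vecMul_surjective_iff_exists_left_inverse]
  convert hc using 1
  funext v
  simp [Matrix.vecMul_add, ← Matrix.vecMul_vecMul, Matrix.vecMul_transpose,
    LinearMap.toMatrix'_mulVec]

/-- Equivalence of matrices: `B = P * A * Q` with `P` and `Q` invertible. -/
def Matrix.IsEquivalent {R ι κ ι' κ' : Type*} [CommRing R] [Fintype ι] [Fintype κ] [Fintype ι']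
    [Fintype κ'] [DecidableEq ι] [DecidableEq κ] [DecidableEq ι'] [DecidableEq κ']
    (A : Matrix ι κ R) (B : Matrix ι' κ' R) : Prop :=
  ∃ (P : Matrix ι' ι R) (P' : Matrix ι ι' R) (Q : Matrix κ κ' R) (Q' : Matrix κ' κ R),
    P * P' = 1 ∧ P' * P = 1 ∧ Q * Q' = 1 ∧ Q' * Q = 1 ∧ P * A * Q = B

namespace Matrix.IsEquivalent

variable {R S : Type*} [CommRing R] [CommRing S] {α β γ δ ε ζ ι κ : Type*}
  [Fintype α] [Fintype β] [Fintype γ] [Fintype δ] [Fintype ε] [Fintype ζ] [Fintype ι] [Fintype κ]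
  [DecidableEq α] [DecidableEq β] [DecidableEq γ] [DecidableEq δ] [DecidableEq ε] [DecidableEq ζ]
  [DecidableEq ι] [DecidableEq κ]

lemma trans {A : Matrix α β R} {B : Matrix γ δ R} {C : Matrix ε ζ R} (h : A.IsEquivalent B)
    (h' : B.IsEquivalent C) : A.IsEquivalent C := by
  obtain ⟨P, P', Q, Q', h₁, h₂, h₃, h₄, rfl⟩ := h
  obtain ⟨S, S', T, T', k₁, k₂, k₃, k₄, rfl⟩ := h'
  refine ⟨S * P, P' * S', Q * T, T' * Q', ?_, ?_, ?_, ?_, by simp only [Matrix.mul_assoc]⟩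
  · rw [Matrix.mul_assoc, ← Matrix.mul_assoc P, h₁, Matrix.one_mul, k₁]
  · rw [Matrix.mul_assoc, ← Matrix.mul_assoc S', k₂, Matrix.one_mul, h₂]
  · rw [Matrix.mul_assoc, ← Matrix.mul_assoc T, k₃, Matrix.one_mul, h₃]
  · rw [Matrix.mul_assoc, ← Matrix.mul_assoc Q', h₄, Matrix.one_mul, k₄]

lemma map {A : Matrix α β R} {B : Matrix γ δ R} (h : A.IsEquivalent B) (f : R →+* S) :
    (A.map f).IsEquivalent (B.map f) := by
  obtain ⟨P, P', Q, Q', h₁, h₂, h₃, h₄, rfl⟩ := h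
  refine ⟨P.map f, P'.map f, Q.map f, Q'.map f, ?_, ?_, ?_, ?_, ?_⟩ <;>
    simp only [← Matrix.map_mul, h₁, h₂, h₃, h₄] <;> simp

lemma submatrix (A : Matrix α β R) (e : γ ≃ α) (f : δ ≃ β) :
    A.IsEquivalent (A.submatrix e f) := by
  refine ⟨(1 : Matrix α α R).submatrix e id, (1 : Matrix α α R).submatrix id e,
    (1 : Matrix β β R).submatrix id f, (1 : Matrix β β R).submatrix f id, ?_, ?_, ?_, ?_, ?_⟩
  · rw [← Matrix.submatrix_mul _ _ e id e Function.bijective_id, Matrix.one_mul,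
      Matrix.submatrix_one_equiv]
  · rw [Matrix.submatrix_mul_equiv, Matrix.one_mul, Matrix.submatrix_id_id]
  · rw [Matrix.submatrix_mul_equiv, Matrix.one_mul, Matrix.submatrix_id_id]
  · rw [← Matrix.submatrix_mul _ _ f id f Function.bijective_id, Matrix.one_mul,
      Matrix.submatrix_one_equiv]
  · ext i j
    simp [Matrix.mul_apply, Matrix.one_apply]

lemma fromBlocks_one {A : Matrix α β R} {B : Matrix γ δ R} (h : A.IsEquivalent B) :
    (fromBlocks (1 : Matrix ι ι R) 0 0 A).IsEquivalent (fromBlocks (1 : Matrix ι ι R) 0 0 B) := by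
  obtain ⟨P, P', Q, Q', h₁, h₂, h₃, h₄, rfl⟩ := h
  refine ⟨fromBlocks 1 0 0 P, fromBlocks 1 0 0 P', fromBlocks 1 0 0 Q, fromBlocks 1 0 0 Q',
    ?_, ?_, ?_, ?_, ?_⟩ <;> simp [fromBlocks_multiply, h₁, h₂, h₃, h₄, Matrix.fromBlocks_one]

/-- Row operations from a unit block and conjugation of the remaining scalar block. -/
lemma fromBlocks_scalar (b : α → R) (y : R) (H H' : Matrix β α R) (Y Z : Matrix β α R)
    (hH : H + Y * diagonal b = H' + y • Z) :
    (fromBlocks (diagonal b) 0 H (y • (1 : Matrix β β R))).IsEquivalent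
      (fromBlocks (diagonal b) 0 H' (y • (1 : Matrix β β R))) := by
  refine ⟨fromBlocks 1 0 Y 1, fromBlocks 1 0 (-Y) 1, fromBlocks 1 0 (-Z) 1, fromBlocks 1 0 Z 1,
    ?_, ?_, ?_, ?_, ?_⟩
  · simp [fromBlocks_multiply, Matrix.fromBlocks_one]
  · simp [fromBlocks_multiply, Matrix.fromBlocks_one]
  · simp [fromBlocks_multiply, Matrix.fromBlocks_one]
  · simp [fromBlocks_multiply, Matrix.fromBlocks_one]
  · simp only [fromBlocks_multiply, Matrix.one_mul, Matrix.mul_one, Matrix.zero_mul,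
      Matrix.mul_zero, add_zero, zero_add]
    congr 1
    rw [add_comm, add_comm (Y * _), hH]
    simp

lemma fromBlocks_conj (b : α → R) (y : R) (H : Matrix β α R) (G : Matrix γ β R)
    (G' : Matrix β γ R) (h : G * G' = 1) (h' : G' * G = 1) :
    (fromBlocks (diagonal b) 0 H (y • (1 : Matrix β β R))).IsEquivalent
      (fromBlocks (diagonal b) 0 (G * H) (y • (1 : Matrix γ γ R))) := by
  refine ⟨fromBlocks 1 0 0 G, fromBlocks 1 0 0 G', fromBlocks 1 0 0 G', fromBlocks 1 0 0 G,
    ?_, ?_, ?_, ?_, ?_⟩ <;> simp [fromBlocks_multiply, h, h', Matrix.fromBlocks_one]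

lemma fromBlocks_fromRows_one (b : α → R) (y : R) :
    (fromBlocks (diagonal b) 0 (fromRows (1 : Matrix α α R) (0 : Matrix β α R))
      (y • (1 : Matrix (α ⊕ β) (α ⊕ β) R))).IsEquivalent
      (diagonal (Sum.elim (fun _ : α => (1 : R)) (Sum.elim (fun i => y * b i) fun _ : β => y))) := by
  refine ⟨fromBlocks 0 (fromCols 1 0) (fromRows (-1) 0) (fromBlocks (diagonal b) 0 0 1),
    fromBlocks (diagonal b) (fromCols (-1) 0) (fromRows 1 0) (fromBlocks 0 0 0 1),
    fromBlocks 1 (fromCols (-y • 1) 0) 0 1, fromBlocks 1 (fromCols (y • 1) 0) 0 1,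
    ?_, ?_, ?_, ?_, ?_⟩
  all_goals
    simp only [fromBlocks_multiply, fromCols_mul_fromRows, fromCols_mul_fromBlocks,
      fromBlocks_mul_fromRows, fromRows_mul, mul_fromCols]
    ext (i | i | i) (j | j | j) <;> simp [Matrix.one_apply, diagonal_apply]
  all_goals split_ifs <;> simp [*]

lemma fromBlocks_fromBlocks_one (B : Matrix α β R) (H : Matrix γ (ι ⊕ β) R) (Y : Matrix γ δ R) :
    (fromBlocks (fromBlocks (1 : Matrix ι ι R) 0 0 B) 0 H Y).IsEquivalent
      (fromBlocks (1 : Matrix ι ι R) 0 0 (fromBlocks B 0 H.toCols₂ Y)) := by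
  refine trans (B := fromBlocks (fromBlocks (1 : Matrix ι ι R) 0 0 B) 0
    (fromCols 0 H.toCols₂) Y) ?_ ?_
  · refine ⟨fromBlocks 1 0 (-fromCols H.toCols₁ 0) 1, fromBlocks 1 0 (fromCols H.toCols₁ 0) 1,
      1, 1, ?_, ?_, by simp, by simp, ?_⟩
    · simp only [fromBlocks_multiply, Matrix.one_mul, Matrix.mul_one, Matrix.zero_mul,
        Matrix.mul_zero, add_zero, zero_add, neg_add_cancel, Matrix.fromBlocks_one]
    · simp only [fromBlocks_multiply, Matrix.one_mul, Matrix.mul_one, Matrix.zero_mul,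
        Matrix.mul_zero, add_zero, zero_add, add_neg_cancel, Matrix.fromBlocks_one]
    · simp only [fromBlocks_multiply, Matrix.one_mul, Matrix.mul_one, Matrix.zero_mul,
        Matrix.mul_zero, add_zero, zero_add, Matrix.neg_mul, fromCols_mul_fromBlocks]
      congr 1
      ext i (j | j) <;> simp [toCols₁, toCols₂]
  · have : fromBlocks (1 : Matrix ι ι R) 0 0 (fromBlocks B 0 H.toCols₂ Y) =
        (fromBlocks (fromBlocks (1 : Matrix ι ι R) 0 0 B) 0 (fromCols 0 H.toCols₂) Y).submatrix
          (Equiv.sumAssoc _ _ _).symm (Equiv.sumAssoc _ _ _).symm := by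
      ext (i | i | i) (j | j | j) <;> simp [toCols₂]
    rw [this]
    exact submatrix _ _ _

end Matrix.IsEquivalent

/-- `A` is equivalent to a diagonal matrix whose entries are some ones followed by a divisibility
chain of length `k`. -/
def Matrix.HasDivisibilityChain {R ι : Type*} [CommRing R] [Fintype ι] [DecidableEq ι]
    (A : Matrix ι ι R) (k : ℕ) : Prop :=
  ∃ (j : ℕ) (a : Fin k → R), (∀ i i', i ≤ i' → a i ∣ a i') ∧
    A.IsEquivalent (diagonal (Sum.elim (fun _ : Fin j => (1 : R)) a))

/-- The diagonal matrix with diagonal `d` can be used to complete any `m`-rowed integer matrix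
which is unimodular together with it. -/
def StablyCompletable {k : ℕ} (d : Fin k → ℤ) (m : ℕ) : Prop :=
  ∀ (H : Matrix (Fin m) (Fin k) ℤ) (L₁ : Matrix (Fin k) (Fin k) ℤ) (L₂ : Matrix (Fin k) (Fin m) ℤ),
    L₁ * diagonal d + L₂ * H = 1 →
    ∃ (Y : Matrix (Fin m) (Fin k) ℤ) (L : Matrix (Fin k) (Fin m) ℤ), L * (H + Y * diagonal d) = 1

lemma stablyCompletable_of_lt {k m : ℕ} (h : k < m) (d : Fin k → ℤ) : StablyCompletable d m :=
  fun H L₁ L₂ hL => Matrix.exists_add_mul_left_inverse (by simpa using h) _ H L₁ L₂ hL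

lemma stablyCompletable_two (d : Fin 1 → ℤ) (hd : d 0 = 2) : StablyCompletable d 1 := by
  intro H L₁ L₂ hL
  have h := congrFun (congrFun hL 0) 0
  simp only [Matrix.add_apply, Matrix.mul_apply, Finset.univ_unique, Finset.sum_singleton,
    Matrix.one_apply_eq, Fin.default_eq_zero, diagonal_apply_eq, hd] at h
  have hodd : H 0 0 % 2 = 1 := by
    rcases Int.emod_two_eq_zero_or_one (H 0 0) with h0 | h0
    · exfalso
      obtain ⟨c, hc⟩ := Int.dvd_of_emod_eq_zero h0
      rw [hc] at h
      have : 2 * (L₁ 0 0 + L₂ 0 0 * c) = 1 := by linarith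
      omega
    · exact h0
  refine ⟨Matrix.of fun _ _ => -(H 0 0 / 2), 1, ?_⟩
  ext i i'
  obtain rfl := Subsingleton.elim i 0
  obtain rfl := Subsingleton.elim i' 0
  simp only [Matrix.add_apply, Matrix.mul_apply, Finset.univ_unique,
    Finset.sum_singleton, Matrix.one_apply_eq, Fin.default_eq_zero, diagonal_apply_eq, hd,
    Matrix.of_apply]
  omega

lemma exists_eq_map_C_add_smul {α β : Type*} (t : ℤ) (F : Matrix α β ℤ[X]) :
    ∃ Z : Matrix α β ℤ[X], F = (F.map (evalRingHom (-t))).map C + (X + C t) • Z := by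
  have h : ∀ i j, ∃ z, F i j = C ((F i j).eval (-t)) + (X + C t) * z := fun i j => by
    obtain ⟨z, hz⟩ := X_sub_C_dvd_sub_C_eval (p := F i j) (a := -t)
    exact ⟨z, by rw [eq_add_of_sub_eq hz]; simp [add_comm]⟩
  choose Z hZ using h
  exact ⟨Matrix.of Z, by ext1 i j; simpa using hZ i j⟩

lemma hasDivisibilityChain_fromBlocks {ι : Type*} [Fintype ι] [DecidableEq ι] {t : ℤ}
    {j k m : ℕ} (N : Matrix ι ι ℤ) (Z : Matrix (Fin m) ι ℤ) (L₁ : Matrix ι ι ℤ)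
    (L₂ : Matrix ι (Fin m) ℤ) (hL : L₁ * N + L₂ * Z = 1) (b : Fin k → ℤ[X])
    (hb : ∀ i i', i ≤ i' → b i ∣ b i')
    (hN : (N.map C + (X + C t) • (1 : Matrix ι ι ℤ[X])).IsEquivalent
      (diagonal (Sum.elim (fun _ : Fin j => (1 : ℤ[X])) b)))
    (hsc : StablyCompletable (fun i => (b i).eval (-t)) m) :
    (fromBlocks (N.map C + (X + C t) • (1 : Matrix ι ι ℤ[X])) 0 (Z.map C)
      ((X + C t) • (1 : Matrix (Fin m) (Fin m) ℤ[X]))).HasDivisibilityChain m := by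
  obtain ⟨P, P', Q, Q', hP, hP', hQ, hQ', hE⟩ := hN
  set y : ℤ[X] := X + C t with hy
  set f : ℤ[X] →+* ℤ := evalRingHom (-t) with hf
  have hfy : f y = 0 := by simp [hf, hy]
  have hfC : ∀ {α β : Type _} (A : Matrix α β ℤ), (A.map C).map f = A := fun A => by
    ext i i'; simp [hf]
  have hE₀ : P.map f * N * Q.map f =
      diagonal (Sum.elim (fun _ : Fin j => (1 : ℤ)) fun i => (b i).eval (-t)) := by
    have := congrArg (fun A : Matrix _ _ ℤ[X] => A.map f) hE
    simp only [Matrix.map_mul] at this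
    convert this using 1
    · congr 2
      have hfy' : eval (-t) y = 0 := by simp [hy]
      ext i i'
      simp [hfy', hf]
    · rw [Matrix.diagonal_map (map_zero f)]
      congr 1
      funext i
      rcases i with i | i <;> simp [hf]
  obtain ⟨Y, L, hYL⟩ := hsc ((Z.map C * Q).map f).toCols₂
    ((Q'.map f * L₁ * P'.map f).toBlocks₂₂) (Q'.map f * L₂).toRows₂ (by
      have h₁ : (Q'.map f * L₁ * P'.map f) * (P.map f * N * Q.map f) + (Q'.map f * L₂) *
          ((Z.map C * Q).map f) = 1 := by
        have e₁ : P'.map f * P.map f = 1 := by rw [← Matrix.map_mul, hP']; simp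
        have e₂ : Q'.map f * Q.map f = 1 := by rw [← Matrix.map_mul, hQ']; simp
        calc _ = Q'.map f * (L₁ * ((P'.map f * P.map f) * N) + L₂ * Z) * Q.map f := by
              rw [Matrix.map_mul, hfC]
              simp only [Matrix.mul_assoc, Matrix.mul_add, Matrix.add_mul]
          _ = 1 := by rw [e₁, Matrix.one_mul, hL, Matrix.mul_one, e₂]
      rw [hE₀] at h₁
      ext i i'
      have h₂ := congrFun (congrFun h₁ (Sum.inr i)) (Sum.inr i')
      rw [Matrix.add_apply, Matrix.mul_diagonal, Matrix.mul_apply] at h₂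
      rw [Matrix.add_apply, Matrix.mul_diagonal, Matrix.mul_apply]
      refine Eq.trans (Eq.trans rfl h₂) ?_
      simp [Matrix.one_apply])
  set H := (Z.map C * Q).toCols₂ with hH
  set B := ((Z.map C * Q).map f).toCols₂ + Y * diagonal fun i => (b i).eval (-t) with hB
  obtain ⟨l, K, V, h₁, h₂, h₃, h₄⟩ := Matrix.exists_kernel_complement Bᵀ Lᵀ
    (by rw [← Matrix.transpose_mul, hYL, Matrix.transpose_one])
  have hGG' : fromRows L Kᵀ * fromCols B Vᵀ = 1 := by
    rw [fromRows_mul_fromCols, hYL, ← Matrix.transpose_mul, h₃,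
      ← Matrix.transpose_transpose (L * Vᵀ), ← Matrix.transpose_transpose (Kᵀ * B),
      Matrix.transpose_mul L, Matrix.transpose_mul Kᵀ, Matrix.transpose_transpose,
      Matrix.transpose_transpose, h₁, h₂]
    simp [Matrix.fromBlocks_one]
  have hG'G : fromCols B Vᵀ * fromRows L Kᵀ = 1 := by
    rw [fromCols_mul_fromRows, ← Matrix.transpose_transpose (B * L + _), Matrix.transpose_add,
      Matrix.transpose_mul, Matrix.transpose_mul, Matrix.transpose_transpose,
      Matrix.transpose_transpose, h₄, Matrix.transpose_one]
  have hGB : fromRows L Kᵀ * B = fromRows 1 0 := by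
    rw [fromRows_mul, hYL, ← Matrix.transpose_transpose (Kᵀ * B), Matrix.transpose_mul Kᵀ,
      Matrix.transpose_transpose, h₁, Matrix.transpose_zero]
  have hm : m = l + k := by
    have := Matrix.square_of_invertible _ _ hGG' hG'G
    simp only [Fintype.card_sum, Fintype.card_fin] at this
    omega
  have hdiag : ∀ {γ : Type} [Fintype γ] [DecidableEq γ] (c : γ → ℤ[X]),
      fromBlocks (1 : Matrix (Fin j) (Fin j) ℤ[X]) 0 0 (diagonal c) =
        diagonal (Sum.elim (fun _ => 1) c) := fun c => by
    rw [← Matrix.diagonal_one, Matrix.fromBlocks_diagonal]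
  have step₁ : (fromBlocks (N.map C + y • (1 : Matrix ι ι ℤ[X])) 0 (Z.map C)
      (y • (1 : Matrix (Fin m) (Fin m) ℤ[X]))).IsEquivalent
      (fromBlocks (fromBlocks (1 : Matrix (Fin j) (Fin j) ℤ[X]) 0 0 (diagonal b)) 0
        (Z.map C * Q) (y • (1 : Matrix (Fin m) (Fin m) ℤ[X]))) := by
    refine ⟨fromBlocks P 0 0 1, fromBlocks P' 0 0 1, fromBlocks Q 0 0 1, fromBlocks Q' 0 0 1,
      ?_, ?_, ?_, ?_, ?_⟩
    · simp [fromBlocks_multiply, hP, Matrix.fromBlocks_one]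
    · simp [fromBlocks_multiply, hP', Matrix.fromBlocks_one]
    · simp [fromBlocks_multiply, hQ, Matrix.fromBlocks_one]
    · simp [fromBlocks_multiply, hQ', Matrix.fromBlocks_one]
    · rw [hdiag, ← hE]
      simp [fromBlocks_multiply]
  obtain ⟨W, hW⟩ := exists_eq_map_C_add_smul t (H + Y.map C * diagonal b)
  have hW' : H + Y.map C * diagonal b = B.map C + y • W := by
    rw [hW]
    congr 2
    ext i i'
    simp [hB, hH, hf, toCols₂]
  have step₂ := (IsEquivalent.fromBlocks_scalar b y H (B.map C) _ _ hW').trans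
    ((IsEquivalent.fromBlocks_conj b y (B.map C) ((fromRows L Kᵀ).map C) ((fromCols B Vᵀ).map C)
      (by rw [← Matrix.map_mul, hGG']; simp) (by rw [← Matrix.map_mul, hG'G]; simp)))
  rw [← Matrix.map_mul, hGB] at step₂
  have hmap : (fromRows (1 : Matrix (Fin k) (Fin k) ℤ) (0 : Matrix (Fin l) (Fin k) ℤ)).map C =
      fromRows (1 : Matrix (Fin k) (Fin k) ℤ[X]) 0 := by
    ext1 (i | i) i' <;> simp [Matrix.one_apply, apply_ite]
  rw [hmap] at step₂
  have step₃ := step₁.trans ((IsEquivalent.fromBlocks_fromBlocks_one _ _ _).trans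
    ((step₂.trans (IsEquivalent.fromBlocks_fromRows_one b y)).fromBlocks_one))
  rw [hdiag] at step₃
  subst hm
  refine ⟨j + k, Fin.append (fun _ => y) fun i => y * b i, ?_, ?_⟩
  · refine Fin.addCases (fun i => ?_) (fun i => ?_) <;>
      refine Fin.addCases (fun i' => ?_) (fun i' => ?_)
    · simp
    · simp
    · intro h
      simp only [Fin.le_def, Fin.val_natAdd, Fin.val_castAdd] at h
      omega
    · intro h
      simp only [Fin.le_def, Fin.val_natAdd] at h
      simpa using mul_dvd_mul_left y (hb i i' (by rw [Fin.le_def]; omega))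
  · refine step₃.trans ?_
    let e : Fin (j + k) ⊕ Fin (l + k) ≃ Fin j ⊕ (Fin k ⊕ (Fin k ⊕ Fin l)) :=
      ((finSumFinEquiv.symm.sumCongr finSumFinEquiv.symm).trans (Equiv.sumAssoc _ _ _)).trans
        ((Equiv.refl _).sumCongr ((Equiv.refl _).sumCongr (Equiv.sumComm _ _)))
    have he : (diagonal (Sum.elim (fun _ : Fin j => (1 : ℤ[X])) (Sum.elim (fun _ : Fin k => 1)
        (Sum.elim (fun i => y * b i) fun _ : Fin l => y)))).submatrix e e =
        diagonal (Sum.elim (fun _ => 1) (Fin.append (fun _ => y) fun i => y * b i)) := by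
      rw [Matrix.submatrix_diagonal_equiv]
      congr 1
      funext i
      rcases i with i | i <;> refine Fin.addCases (fun i => ?_) (fun i => ?_) i <;> simp [e]
    rw [← he]
    exact IsEquivalent.submatrix _ e e

lemma Matrix.IsEquivalent.hasDivisibilityChain {R ι κ : Type*} [CommRing R] [Fintype ι]
    [DecidableEq ι] [Fintype κ] [DecidableEq κ] {A : Matrix ι ι R} {B : Matrix κ κ R} {k : ℕ}
    (h : A.IsEquivalent B) (hB : B.HasDivisibilityChain k) : A.HasDivisibilityChain k := by
  obtain ⟨j, a, ha, hBa⟩ := hB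
  exact ⟨j, a, ha, h.trans hBa⟩

lemma hasDivisibilityChain_of_mul_transpose {ι κ : Type} [Fintype ι] [DecidableEq ι] [Fintype κ]
    [DecidableEq κ] (A : Matrix ι κ ℤ) (S : Matrix κ ι ℤ) (hS : A * S = 1) (t : ℤ) {j k m : ℕ}
    (a : Fin k → ℤ[X]) (ha : ∀ i i', i ≤ i' → a i ∣ a i')
    (h : ((A * Aᵀ).map C + (X : ℤ[X]) • (1 : Matrix ι ι ℤ[X])).IsEquivalent
      (diagonal (Sum.elim (fun _ : Fin j => (1 : ℤ[X])) a)))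
    (hm : Fintype.card κ = Fintype.card ι + m)
    (hsc : StablyCompletable (fun i => (a i).eval 0) m) :
    ((Aᵀ * A + t • (1 : Matrix κ κ ℤ)).map C +
      (X : ℤ[X]) • (1 : Matrix κ κ ℤ[X])).HasDivisibilityChain m := by
  obtain ⟨l, K, V, h₁, h₂, h₃, h₄⟩ := Matrix.exists_kernel_complement A S hS
  have hGG' : fromRows A V * fromCols S K = 1 := by
    rw [fromRows_mul_fromCols, hS, h₁, h₂, h₃, Matrix.fromBlocks_one]
  have hG'G : fromCols S K * fromRows A V = 1 := by rw [fromCols_mul_fromRows, h₄]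
  obtain rfl : l = m := by
    have := Matrix.square_of_invertible _ _ hGG' hG'G
    simp only [Fintype.card_sum, Fintype.card_fin] at this
    omega
  have hL : (Sᵀ * S) * (A * Aᵀ) + (Sᵀ * K) * (V * Aᵀ) = 1 := by
    calc _ = Sᵀ * (S * A + K * V) * Aᵀ := by
          simp [Matrix.mul_assoc, Matrix.mul_add, Matrix.add_mul]
      _ = 1 := by rw [h₄, Matrix.mul_one, ← Matrix.transpose_mul, hS, Matrix.transpose_one]
  have key := hasDivisibilityChain_fromBlocks (t := t) (A * Aᵀ) (V * Aᵀ) _ _ hL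
    (fun i => (a i).comp (X + C t)) (fun i i' hi => by
      simpa using map_dvd (compRingHom (X + C t)) (ha i i' hi)) (j := j) (by
      have := h.map (compRingHom (X + C t))
      rw [Matrix.diagonal_map (map_zero _)] at this
      convert this using 1
      · generalize A * Aᵀ = N
        ext1 i i'
        simp only [Matrix.add_apply, Matrix.map_apply, Matrix.smul_apply, smul_eq_mul,
          Matrix.one_apply]
        split_ifs <;> simp
      · congr 1
        funext i
        rcases i with i | i <;> simp) (by simpa using hsc)
  refine Matrix.IsEquivalent.hasDivisibilityChain ?_ key
  refine ⟨(fromRows A V).map C, (fromCols S K).map C, (fromCols S K).map C, (fromRows A V).map C,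
    ?_, ?_, ?_, ?_, ?_⟩
  · rw [← Matrix.map_mul, hGG']; simp
  · rw [← Matrix.map_mul, hG'G]; simp
  · rw [← Matrix.map_mul, hG'G]; simp
  · rw [← Matrix.map_mul, hGG']; simp
  · have e₁ : (Aᵀ * A + t • (1 : Matrix κ κ ℤ)).map C + (X : ℤ[X]) • (1 : Matrix κ κ ℤ[X]) =
        (Aᵀ * A).map C + (X + C t : ℤ[X]) • (1 : Matrix κ κ ℤ[X]) := by
      ext1 i i'
      simp only [Matrix.add_apply, Matrix.map_apply, Matrix.smul_apply, smul_eq_mul, map_add,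
        map_mul, Matrix.one_apply]
      split_ifs
      · simp
        ring
      · simp
    have e₂ : fromRows A V * (Aᵀ * A) * fromCols S K = fromBlocks (A * Aᵀ) 0 (V * Aᵀ) 0 := by
      rw [← Matrix.mul_assoc, Matrix.mul_assoc _ A, mul_fromCols, hS, h₁, fromRows_mul,
        fromRows_mul_fromCols]
      simp
    rw [e₁, Matrix.mul_add, Matrix.add_mul, Matrix.mul_smul, Matrix.smul_mul, Matrix.mul_one,
      ← Matrix.map_mul, ← Matrix.map_mul, ← Matrix.map_mul, hGG', e₂]
    rw [Matrix.fromBlocks_map, ← Matrix.fromBlocks_one, Matrix.fromBlocks_map, Matrix.fromBlocks_smul,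
      Matrix.fromBlocks_add]
    simp [-Matrix.map_mul]

lemma Matrix.HasDivisibilityChain.hasSNF' {R ι : Type*} [CommRing R] [Fintype ι] [DecidableEq ι]
    {A : Matrix ι ι R} {k : ℕ} (h : A.HasDivisibilityChain k) : A.HasSNF' := by
  obtain ⟨j, a, ha, P, P', Q, Q', hP, hP', hQ, hQ', hE⟩ := h
  rcases subsingleton_or_nontrivial R with _ | _
  · refine ⟨Fintype.equivFin ι, Fintype.equivFin ι, 1, 1, isUnit_one, isUnit_one,
      fun _ _ _ => Subsingleton.elim _ _, fun _ _ _ => ⟨0, Subsingleton.elim _ _⟩⟩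
  have hcard : Fintype.card ι = j + k := by
    have := Matrix.square_of_invertible _ _ hP hP'
    simp only [Fintype.card_sum, Fintype.card_fin] at this
    omega
  let e := Fintype.equivFin ι
  let g : Fin (Fintype.card ι) ≃ Fin j ⊕ Fin k := (finCongr hcard).trans finSumFinEquiv.symm
  have hdiag : (P.submatrix g e.symm) * reindex e e A * (Q.submatrix e.symm g) =
      diagonal fun i => Fin.append (fun _ => 1) a (finCongr hcard i) := by
    rw [Matrix.reindex_apply, Matrix.submatrix_mul_equiv, Matrix.submatrix_mul_equiv, hE,
      Matrix.submatrix_diagonal_equiv]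
    congr 1
    funext i
    simp only [Function.comp_apply, g, Equiv.trans_apply]
    generalize finCongr hcard i = i
    refine Fin.addCases (fun i => ?_) (fun i => ?_) i <;> simp
  refine ⟨e, e, P.submatrix g e.symm, Q.submatrix e.symm g, ?_, ?_, ?_, ?_⟩
  · refine IsUnit.of_mul_eq_one (P'.submatrix e.symm g) ?_
    rw [Matrix.submatrix_mul_equiv, hP, Matrix.submatrix_one_equiv]
  · refine IsUnit.of_mul_eq_one (Q'.submatrix g e.symm) ?_
    rw [Matrix.submatrix_mul_equiv, hQ, Matrix.submatrix_one_equiv]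
  · intro i i' hi
    rw [hdiag, Matrix.diagonal_apply_ne _ (fun h => hi (by rw [h]))]
  · intro i h₁ h₂
    rw [hdiag, Matrix.diagonal_apply_eq, Matrix.diagonal_apply_eq]
    have key : ∀ x x' : Fin (j + k), x ≤ x' →
        Fin.append (fun _ => 1) a x ∣ Fin.append (fun _ => 1) a x' := by
      refine Fin.addCases (fun x => ?_) (fun x => ?_)
      · simp
      · refine Fin.addCases (fun x' => ?_) (fun x' => ?_)
        · intro h
          simp only [Fin.le_def, Fin.val_natAdd, Fin.val_castAdd] at h
          omega
        · intro h
          simp only [Fin.le_def, Fin.val_natAdd] at h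
          simpa using ha x x' (by rw [Fin.le_def]; omega)
    exact key _ _ (by simp [Fin.le_def])

namespace DiffPoset

variable {t : ℕ} (T : DiffPoset t)

lemma finite_upper (x : T.P) : {z | x ⋖ z}.Finite :=
  (T.fiberFinite (T.rk x + 1)).subset fun _ h => T.rk_covBy h

lemma finite_lower (x : T.P) : {z | z ⋖ x}.Finite :=
  (T.locallyFinite T.bot x).subset fun z h => ⟨T.bot_le z, h.le⟩

lemma exists_covBy {x : T.P} (hx : x ≠ T.bot) : ∃ z, z ⋖ x := by
  have hfin : (Set.Ico T.bot x).Finite := (T.locallyFinite T.bot x).subset Set.Ico_subset_Icc_self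
  obtain ⟨z, hz⟩ := hfin.exists_maximal ⟨T.bot, le_rfl, (T.bot_le x).lt_of_ne hx.symm⟩
  refine ⟨z, hz.prop.2, fun w hzw hwx => ?_⟩
  exact hzw.not_ge (hz.le_of_ge ⟨T.bot_le w, hwx⟩ hzw.le)

lemma eq_bot_of_rk_eq_zero_s6 {x : T.P} (hx : T.rk x = 0) : x = T.bot := by
  by_contra h
  obtain ⟨z, hz⟩ := T.exists_covBy h
  have := T.rk_covBy hz
  omega

lemma bot_covBy_iff {x : T.P} : T.bot ⋖ x ↔ T.rk x = 1 := by
  refine ⟨fun h => by rw [T.rk_covBy h, T.rk_bot], fun h => ?_⟩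
  obtain ⟨z, hz⟩ := T.exists_covBy (x := x) (by rintro rfl; simp [T.rk_bot] at h)
  rwa [← T.eq_bot_of_rk_eq_zero_s6 (x := z) (by have := T.rk_covBy hz; omega)]

lemma p_zero : T.p 0 = 1 :=
  Fintype.card_eq_one_iff.2 ⟨⟨T.bot, T.rk_bot⟩, fun x =>
    Subtype.ext (T.eq_bot_of_rk_eq_zero_s6 x.2)⟩

lemma sum_ite_mem_eq_ncard {n : ℕ} (S : Set T.P) [DecidablePred (· ∈ S)]
    (hS : ∀ x ∈ S, T.rk x = n) :
    ∑ x : T.level n, (if (x : T.P) ∈ S then (1 : ℤ) else 0) = S.ncard := by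
  have hS' : S = Subtype.val '' {x : T.level n | (x : T.P) ∈ S} := by
    ext x
    simpa using hS x
  have hcard := congrArg Set.ncard hS'
  rw [Set.ncard_image_of_injective _ Subtype.val_injective,
    Set.ncard_eq_toFinset_card' {x : T.level n | (x : T.P) ∈ S}] at hcard
  rw [Finset.sum_boole, hcard]
  congr 2
  ext x
  simp

lemma p_eq_ncard (n : ℕ) : T.p n = {x : T.P | T.rk x = n}.ncard := by
  have := T.sum_ite_mem_eq_ncard (n := n) {x : T.P | T.rk x = n} (fun _ h => h)
  simp only [Set.mem_ofPred_eq] at this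
  have h2 : ∑ x : T.level n, (if T.rk (x : T.P) = n then (1 : ℤ) else 0) = T.p n := by
    rw [Finset.sum_congr rfl fun x _ => if_pos x.2]
    simp [p]
  exact_mod_cast h2.symm.trans this

lemma p_one : T.p 1 = t := by
  have h := T.d3 T.bot
  have h₁ : {z | z ⋖ T.bot} = ∅ := by
    ext z
    simpa using fun h : z ⋖ T.bot => h.lt.not_ge (T.bot_le z)
  rw [h₁, Set.ncard_empty, zero_add] at h
  simp only [T.bot_covBy_iff] at h
  rw [p_eq_ncard, h]

lemma transpose_downMatrix (n : ℕ) : (T.downMatrix ℤ n)ᵀ = T.upMatrix ℤ n := rfl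

lemma downMatrix_mul_upMatrix_apply (n : ℕ) (x x' : T.level n) :
    (T.downMatrix ℤ n * T.upMatrix ℤ n) x x' = {z | x.1 ⋖ z ∧ x'.1 ⋖ z}.ncard := by
  classical
  rw [← T.sum_ite_mem_eq_ncard (n := n + 1) _ fun z hz => by rw [T.rk_covBy hz.1, x.2],
    Matrix.mul_apply]
  refine Finset.sum_congr rfl fun z _ => ?_
  simp only [downMatrix, upMatrix, Set.mem_ofPred_eq, ite_and]
  split_ifs <;> simp

lemma upMatrix_mul_downMatrix_apply (n : ℕ) (x x' : T.level (n + 1)) :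
    (T.upMatrix ℤ n * T.downMatrix ℤ n) x x' = {z | z ⋖ x.1 ∧ z ⋖ x'.1}.ncard := by
  classical
  rw [← T.sum_ite_mem_eq_ncard (n := n) _ fun z hz => by
      have := T.rk_covBy hz.1; have := x.2; omega,
    Matrix.mul_apply]
  refine Finset.sum_congr rfl fun z _ => ?_
  simp only [downMatrix, upMatrix, Set.mem_ofPred_eq, ite_and]
  split_ifs <;> simp

lemma duMatrix_succ_s6 (n : ℕ) : T.duMatrix ℤ (n + 1) =
    T.upMatrix ℤ n * T.downMatrix ℤ n + (t : ℤ) • (1 : Matrix _ _ ℤ) := by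
  ext x x'
  rw [duMatrix, downMatrix_mul_upMatrix_apply, Matrix.add_apply, upMatrix_mul_downMatrix_apply,
    Matrix.smul_apply]
  by_cases h : x = x'
  · subst h
    simp [T.d3]
  · rw [Matrix.one_apply_ne h, T.d2 fun h' => h (Subtype.ext h')]
    simp

lemma duMatrix_zero_s6 : T.duMatrix ℤ 0 = (t : ℤ) • (1 : Matrix _ _ ℤ) := by
  ext x x'
  obtain rfl : x = x' := Fintype.card_le_one_iff.1 T.p_zero.le x x'
  have hx := T.eq_bot_of_rk_eq_zero_s6 x.2
  rw [duMatrix, downMatrix_mul_upMatrix_apply, hx]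
  simp only [T.bot_covBy_iff, and_self, ← p_eq_ncard, T.p_one]
  simp

lemma upMatrix_mulVec_injective (ht : 0 < t) (n : ℕ) :
    Function.Injective (T.upMatrix ℤ n).mulVecLin := by
  rw [← LinearMap.ker_eq_bot, LinearMap.ker_eq_bot']
  intro v hv
  have hdu : T.duMatrix ℤ n *ᵥ v = 0 := by
    rw [duMatrix, ← Matrix.mulVec_mulVec]
    rw [Matrix.mulVecLin_apply] at hv
    rw [hv, Matrix.mulVec_zero]
  have ht' : (0 : ℤ) < t := by exact_mod_cast ht
  suffices h : v ⬝ᵥ v ≤ 0 from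
    dotProduct_self_eq_zero.1 (h.antisymm (Finset.sum_nonneg fun i _ => mul_self_nonneg _))
  cases n with
  | zero =>
    rw [duMatrix_zero_s6, Matrix.smul_mulVec, Matrix.one_mulVec] at hdu
    rcases smul_eq_zero.1 hdu with h | h
    · omega
    · simp [h]
  | succ n =>
    have h := congrArg (v ⬝ᵥ ·) hdu
    simp only [duMatrix_succ_s6, Matrix.add_mulVec, Matrix.smul_mulVec, Matrix.one_mulVec,
      dotProduct_add, dotProduct_smul, dotProduct_zero, ← Matrix.mulVec_mulVec,
      ← T.transpose_downMatrix, Matrix.mulVec_transpose, smul_eq_mul] at h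
    rw [dotProduct_comm, ← Matrix.dotProduct_mulVec] at h
    have : 0 ≤ (T.downMatrix ℤ n *ᵥ v) ⬝ᵥ (T.downMatrix ℤ n *ᵥ v) :=
      Finset.sum_nonneg fun i _ => mul_self_nonneg _
    nlinarith

lemma p_le_p_succ (ht : 0 < t) (n : ℕ) : T.p n ≤ T.p (n + 1) := by
  have := LinearMap.finrank_le_finrank_of_injective (T.upMatrix_mulVec_injective ht n)
  simpa [p] using this

lemma p_pos (ht : 0 < t) (n : ℕ) : 0 < T.p n := by
  induction n with
  | zero => simp [T.p_zero]
  | succ n ih => exact ih.trans_le (T.p_le_p_succ ht n)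

lemma isEquivalent_duMatrix_zero :
    ((T.duMatrix ℤ 0).map C + (X : ℤ[X]) • (1 : Matrix (T.level 0) (T.level 0) ℤ[X])).IsEquivalent
      (diagonal (Sum.elim (fun _ : Fin 0 => (1 : ℤ[X])) fun _ : Fin 1 => X + C (t : ℤ))) := by
  let e : Fin 0 ⊕ Fin 1 ≃ T.level 0 := Fintype.equivOfCardEq (by
    have := T.p_zero
    rw [p] at this
    simp [this])
  convert Matrix.IsEquivalent.submatrix _ e e using 1
  ext1 (i | i) (i' | i')
  · exact i.elim0
  · exact i.elim0
  · exact i'.elim0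
  · obtain rfl := Subsingleton.elim i i'
    simp only [duMatrix_zero_s6, Matrix.submatrix_apply, Matrix.add_apply, Matrix.map_apply,
      Matrix.smul_apply, Matrix.one_apply_eq, diagonal_apply_eq, Sum.elim_inr]
    simp [add_comm]

lemma hasDivisibilityChain_duMatrix_succ (hdown : ∀ n, Function.Surjective (T.down ℤ n)) {n : ℕ}
    (hp : T.p n ≤ T.p (n + 1)) {j k : ℕ} (a : Fin k → ℤ[X]) (ha : ∀ i i', i ≤ i' → a i ∣ a i')
    (h : ((T.duMatrix ℤ n).map C +
      (X : ℤ[X]) • (1 : Matrix (T.level n) (T.level n) ℤ[X])).IsEquivalent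
      (diagonal (Sum.elim (fun _ : Fin j => (1 : ℤ[X])) a)))
    (hsc : StablyCompletable (fun i => (a i).eval 0) (T.p (n + 1) - T.p n)) :
    ((T.duMatrix ℤ (n + 1)).map C + (X : ℤ[X]) •
      (1 : Matrix (T.level (n + 1)) (T.level (n + 1)) ℤ[X])).HasDivisibilityChain
      (T.p (n + 1) - T.p n) := by
  obtain ⟨S, hS⟩ := Matrix.mulVec_surjective_iff_exists_right_inverse.1 (hdown n)
  rw [duMatrix_succ_s6]
  refine hasDivisibilityChain_of_mul_transpose (T.downMatrix ℤ n) S hS t a ha h ?_ hsc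
  change T.p (n + 1) = T.p n + _
  omega

/-- If the down maps of a differential poset are surjective and its rank sizes are strictly convex,
then all the matrices `[DU_n] + x·I` have Smith normal form. -/
lemma hasSNF'_duMatrix (ht : 2 ≤ t) (hdown : ∀ n, Function.Surjective (T.down ℤ n))
    (hconv : ∀ n, 2 * T.p (n + 1) < T.p (n + 2) + T.p n) (n : ℕ) :
    ((T.duMatrix ℤ n).map C +
      (X : ℤ[X]) • (1 : Matrix (T.level n) (T.level n) ℤ[X])).HasSNF' := by
  have hp := T.p_le_p_succ (by omega)
  have hchain : ∀ n, ((T.duMatrix ℤ (n + 1)).map C + (X : ℤ[X]) •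
      (1 : Matrix (T.level (n + 1)) (T.level (n + 1)) ℤ[X])).HasDivisibilityChain
      (T.p (n + 1) - T.p n) := by
    intro n
    induction n with
    | zero =>
      refine T.hasDivisibilityChain_duMatrix_succ hdown (hp 0) (j := 0)
        (fun _ : Fin 1 => X + C (t : ℤ)) (fun _ _ _ => dvd_rfl) T.isEquivalent_duMatrix_zero ?_
      rw [T.p_zero, zero_add, T.p_one]
      rcases ht.eq_or_lt with rfl | ht
      · exact stablyCompletable_two _ (by simp)
      · exact stablyCompletable_of_lt (by omega) _
    | succ n ih =>
      obtain ⟨j, a, ha, h⟩ := ih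
      refine T.hasDivisibilityChain_duMatrix_succ hdown (hp _) a ha h
        (stablyCompletable_of_lt ?_ _)
      have := hconv n
      have := hp n
      have := hp (n + 1)
      simp only [add_assoc, Nat.reduceAdd] at *
      omega
  cases n with
  | zero => exact Matrix.HasDivisibilityChain.hasSNF' (k := 1) ⟨0,
      fun _ => X + C (t : ℤ), fun _ _ _ => dvd_rfl, T.isEquivalent_duMatrix_zero⟩
  | succ n => exact (hchain n).hasSNF'

end DiffPoset

namespace DiffPoset

variable {r s : ℕ} (D : DiffPoset r) (E : DiffPoset s)

lemma setOf_covBy_prod {α β : Type*} [PartialOrder α] [PartialOrder β] (x : α × β) :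
    {z | x ⋖ z} = (fun u => (u, x.2)) '' {u | x.1 ⋖ u} ∪ (fun v => (x.1, v)) '' {v | x.2 ⋖ v} := by
  ext ⟨u, v⟩
  simp only [Set.mem_ofPred_eq, Prod.covBy_iff, Set.mem_union, Set.mem_image, Prod.mk.injEq]
  grind

lemma setOf_prod_covBy {α β : Type*} [PartialOrder α] [PartialOrder β] (x : α × β) :
    {z | z ⋖ x} = (fun u => (u, x.2)) '' {u | u ⋖ x.1} ∪ (fun v => (x.1, v)) '' {v | v ⋖ x.2} := by
  ext ⟨u, v⟩
  simp only [Set.mem_ofPred_eq, Prod.covBy_iff, Set.mem_union, Set.mem_image, Prod.mk.injEq]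
  grind

lemma ncard_union_image {α β : Type*} (a : α) (b : β) (S : Set α) (T : Set β) (hS : S.Finite)
    (hT : T.Finite) (ha : a ∉ S) :
    ((fun u => (u, b)) '' S ∪ (fun v => (a, v)) '' T).ncard = S.ncard + T.ncard := by
  rw [Set.ncard_union_eq _ (hS.image _) (hT.image _), Set.ncard_image_of_injective,
    Set.ncard_image_of_injective]
  · exact Prod.mk_right_injective a
  · exact Prod.mk_left_injective b
  · rw [Set.disjoint_left]
    rintro _ ⟨u, hu, rfl⟩ ⟨v, hv, h⟩
    simp only [Prod.mk.injEq] at h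
    exact ha (h.1 ▸ hu)

lemma ncard_lower_eq_ncard_upper {x y : D.P × E.P} (h : x ≠ y) :
    {z | z ⋖ x ∧ z ⋖ y}.ncard = {z | x ⋖ z ∧ y ⋖ z}.ncard := by
  obtain ⟨a, b⟩ := x
  obtain ⟨c, d⟩ := y
  have hirr : ∀ {γ : Type} [PartialOrder γ] (u : γ), ¬ u ⋖ u := fun u hu => hu.lt.ne rfl
  have hasymm : ∀ {γ : Type} [PartialOrder γ] {u v : γ}, u ⋖ v → ¬ v ⋖ u :=
    fun hu hv => hu.lt.asymm hv.lt
  rcases eq_or_ne a c with rfl | hac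
  · have hbd : b ≠ d := fun h' => h (by rw [h'])
    have h₁ : {z : D.P × E.P | z ⋖ (a, b) ∧ z ⋖ (a, d)} =
        (fun v => (a, v)) '' {v | v ⋖ b ∧ v ⋖ d} := by
      ext ⟨u, v⟩
      simp only [Set.mem_ofPred_eq, Prod.covBy_iff, Set.mem_image, Prod.mk.injEq]
      have := hirr a
      grind
    have h₂ : {z : D.P × E.P | (a, b) ⋖ z ∧ (a, d) ⋖ z} =
        (fun v => (a, v)) '' {v | b ⋖ v ∧ d ⋖ v} := by
      ext ⟨u, v⟩
      simp only [Set.mem_ofPred_eq, Prod.covBy_iff, Set.mem_image, Prod.mk.injEq]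
      have := hirr a
      grind
    rw [h₁, h₂, Set.ncard_image_of_injective _ (Prod.mk_right_injective a),
      Set.ncard_image_of_injective _ (Prod.mk_right_injective a), E.d2 hbd]
  rcases eq_or_ne b d with rfl | hbd
  · have h₁ : {z : D.P × E.P | z ⋖ (a, b) ∧ z ⋖ (c, b)} =
        (fun u => (u, b)) '' {u | u ⋖ a ∧ u ⋖ c} := by
      ext ⟨u, v⟩
      simp only [Set.mem_ofPred_eq, Prod.covBy_iff, Set.mem_image, Prod.mk.injEq]
      have := hirr b
      grind
    have h₂ : {z : D.P × E.P | (a, b) ⋖ z ∧ (c, b) ⋖ z} =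
        (fun u => (u, b)) '' {u | a ⋖ u ∧ c ⋖ u} := by
      ext ⟨u, v⟩
      simp only [Set.mem_ofPred_eq, Prod.covBy_iff, Set.mem_image, Prod.mk.injEq]
      have := hirr b
      grind
    rw [h₁, h₂, Set.ncard_image_of_injective _ (Prod.mk_left_injective b),
      Set.ncard_image_of_injective _ (Prod.mk_left_injective b), D.d2 hac]
  have h₁ : ∀ z : D.P × E.P, z ⋖ (a, b) ∧ z ⋖ (c, d) ↔
      (z = (c, b) ∧ c ⋖ a ∧ b ⋖ d) ∨ (z = (a, d) ∧ a ⋖ c ∧ d ⋖ b) := by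
    rintro ⟨u, v⟩
    simp only [Prod.covBy_iff, Prod.mk.injEq]
    grind
  have h₂ : ∀ z : D.P × E.P, (a, b) ⋖ z ∧ (c, d) ⋖ z ↔
      (z = (a, d) ∧ c ⋖ a ∧ b ⋖ d) ∨ (z = (c, b) ∧ a ⋖ c ∧ d ⋖ b) := by
    rintro ⟨u, v⟩
    simp only [Prod.covBy_iff, Prod.mk.injEq]
    grind
  simp only [h₁, h₂]
  by_cases hca : c ⋖ a ∧ b ⋖ d
  · have : ¬ (a ⋖ c ∧ d ⋖ b) := fun h' => hasymm h'.1 hca.1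
    simp [hca, this]
  · by_cases hca' : a ⋖ c ∧ d ⋖ b
    · simp [hca, hca']
    · simp [hca, hca']

/-- The Cartesian product of an `r`-differential and an `s`-differential poset. -/
def prod : DiffPoset (r + s) where
  P := D.P × E.P
  locallyFinite x y := by
    rw [Set.Icc_prod_eq]
    exact (D.locallyFinite _ _).prod (E.locallyFinite _ _)
  rk x := D.rk x.1 + E.rk x.2
  fiberFinite := D.plevel_finite E
  bot := (D.bot, E.bot)
  bot_le x := Prod.le_def.2 ⟨D.bot_le _, E.bot_le _⟩
  rk_bot := by rw [D.rk_bot, E.rk_bot]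
  rk_covBy {x y} h := by
    rcases Prod.covBy_iff.1 h with ⟨h, h'⟩ | ⟨h, h'⟩
    · rw [D.rk_covBy h, h']
      omega
    · rw [E.rk_covBy h, h']
      omega
  d2 := D.ncard_lower_eq_ncard_upper E
  d3 x := by
    rw [setOf_covBy_prod, setOf_prod_covBy, ncard_union_image _ _ _ _ (D.finite_upper _)
      (E.finite_upper _) fun h => h.lt.ne rfl, ncard_union_image _ _ _ _ (D.finite_lower _)
      (E.finite_lower _) fun h => h.lt.ne rfl, D.d3, E.d3]
    omega

/-- The finset of elements covering `x`. -/
noncomputable def upper (x : D.P) : Finset D.P := (D.finite_upper x).toFinset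

variable {D} in
lemma mem_upper {x z : D.P} : z ∈ D.upper x ↔ x ⋖ z := by simp [upper]

lemma down_apply_eq_sum_upper (n : ℕ) (f : D.P → ℤ) (z : D.level n) :
    D.down ℤ n (fun y => f y) z = ∑ x ∈ D.upper z, f x := by
  simp only [down, Matrix.mulVecLin_apply, Matrix.mulVec, dotProduct, downMatrix, ite_mul, one_mul,
    zero_mul]
  rw [← Finset.sum_filter]
  refine Finset.sum_bij (fun y _ => y) ?_ ?_ ?_ ?_
  · simp [mem_upper]
  · simp [Subtype.ext_iff]
  · intro x hx
    rw [mem_upper] at hx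
    exact ⟨⟨x, by rw [D.rk_covBy hx, z.2]⟩, by simpa using hx, rfl⟩
  · simp

lemma down_surjective_iff (n : ℕ) : Function.Surjective (D.down ℤ n) ↔
    ∀ g : D.P → ℤ, ∃ f : D.P → ℤ, ∀ z, D.rk z = n → ∑ x ∈ D.upper z, f x = g z := by
  classical
  have hext : ∀ (m : ℕ) (f : D.level m → ℤ), ∃ f' : D.P → ℤ, f = fun y => f' y.1 := fun m f =>
    ⟨fun x => if h : D.rk x = m then f ⟨x, h⟩ else 0, by ext ⟨x, hx⟩; simp [hx]⟩
  constructor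
  · intro h g
    obtain ⟨f, hf⟩ := h fun z => g z
    obtain ⟨f, rfl⟩ := hext _ f
    refine ⟨f, fun z hz => ?_⟩
    rw [← D.down_apply_eq_sum_upper n f ⟨z, hz⟩, hf]
  · intro h g
    obtain ⟨g, rfl⟩ := hext _ g
    obtain ⟨f, hf⟩ := h g
    exact ⟨fun y => f y, funext fun z => by rw [D.down_apply_eq_sum_upper, hf z z.2]⟩

lemma exists_forall_sum_upper_eq (h : ∀ n, Function.Surjective (D.down ℤ n)) (g : D.P → ℤ) :
    ∃ f : D.P → ℤ, ∀ z, ∑ x ∈ D.upper z, f x = g z := by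
  choose F hF using fun n => (D.down_surjective_iff n).1 (h n) g
  refine ⟨fun x => F (D.rk x - 1) x, fun z => ?_⟩
  rw [← hF (D.rk z) z rfl]
  refine Finset.sum_congr rfl fun x hx => ?_
  simp only [D.rk_covBy (mem_upper.1 hx), Nat.add_sub_cancel]

variable {D E} in
lemma exists_sum_upper_add_sum_upper_eq
    (h : ∀ g : D.P → ℤ, ∃ f : D.P → ℤ, ∀ z, ∑ x ∈ D.upper z, f x = g z) (n j : ℕ) :
    ∀ g : D.P → E.P → ℤ, (∀ a b, D.rk a + E.rk b = n → j ≤ E.rk b → g a b = 0) →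
      ∃ f : D.P → E.P → ℤ, ∀ a b, D.rk a + E.rk b = n →
        ∑ u ∈ D.upper a, f u b + ∑ v ∈ E.upper b, f a v = g a b := by
  induction j with
  | zero => exact fun g hg => ⟨0, fun a b hab => by simp [hg a b hab]⟩
  | succ j ih =>
    intro g hg
    choose F hF using fun b => h fun a => g a b
    let G : D.P → E.P → ℤ := fun a b => if E.rk b = j then F b a else 0
    obtain ⟨f, hf⟩ := ih (fun a b => g a b - (∑ u ∈ D.upper a, G u b + ∑ v ∈ E.upper b, G a v)) (by
      intro a b hab hb
      have hv : ∑ v ∈ E.upper b, G a v = 0 := Finset.sum_eq_zero fun v hv =>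
        if_neg (by have := E.rk_covBy (mem_upper.1 hv); omega)
      by_cases hbj : E.rk b = j
      · simp only [hv, G, hbj, if_true, hF]
        ring
      · simp [hv, G, hbj, hg a b hab (by omega)])
    refine ⟨fun a b => f a b + G a b, fun a b hab => ?_⟩
    simp only [Finset.sum_add_distrib]
    linear_combination hf a b hab

lemma sum_upper_prod (f : D.P × E.P → ℤ) (a : D.P) (b : E.P) :
    ∑ z ∈ (D.prod E).upper (a, b), f z =
      ∑ u ∈ D.upper a, f (u, b) + ∑ v ∈ E.upper b, f (a, v) := by
  classical
  let S : Finset (D.P × E.P) := (D.upper a).map ⟨_, Prod.mk_left_injective b⟩ ∪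
    (E.upper b).map ⟨_, Prod.mk_right_injective a⟩
  have h : ∀ z : D.P × E.P, z ∈ (D.prod E).upper (a, b) ↔ z ∈ S := fun z =>
    mem_upper.trans ((Set.ext_iff.1 (setOf_covBy_prod (a, b)) z).trans (by simp [S, mem_upper]))
  suffices hS : ∑ z ∈ S, f z = ∑ u ∈ D.upper a, f (u, b) + ∑ v ∈ E.upper b, f (a, v) from
    (Finset.sum_congr (Finset.ext h) fun _ _ => rfl).trans hS
  rw [Finset.sum_union, Finset.sum_map, Finset.sum_map]
  · rfl
  · rw [Finset.disjoint_left]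
    simp only [Finset.mem_map, mem_upper, Function.Embedding.coeFn_mk]
    rintro _ ⟨u, hu, rfl⟩ ⟨v, hv, h⟩
    exact hu.lt.ne (congrArg Prod.fst h)

lemma prod_down_surjective (h : (∀ n, Function.Surjective (D.down ℤ n)) ∨
    ∀ n, Function.Surjective (E.down ℤ n)) (n : ℕ) :
    Function.Surjective ((D.prod E).down ℤ n) := by
  rw [down_surjective_iff]
  intro g
  have key : ∃ f : D.P → E.P → ℤ, ∀ a b, D.rk a + E.rk b = n →
      ∑ u ∈ D.upper a, f u b + ∑ v ∈ E.upper b, f a v = g (a, b) := by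
    rcases h with h | h
    · exact exists_sum_upper_add_sum_upper_eq (D.exists_forall_sum_upper_eq h) n (n + 1)
        (fun a b => g (a, b)) fun a b _ _ => by omega
    · obtain ⟨f, hf⟩ := exists_sum_upper_add_sum_upper_eq (E.exists_forall_sum_upper_eq h) n (n + 1)
        (fun b a => g (a, b)) fun a b _ _ => by omega
      exact ⟨fun a b => f b a, fun a b hab => by rw [add_comm, hf b a (by omega)]⟩
  obtain ⟨f, hf⟩ := key
  refine ⟨fun z => f z.1 z.2, ?_⟩
  rintro ⟨a, b⟩ hab
  rw [← hf a b hab]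
  exact D.sum_upper_prod E (fun z => f z.1 z.2) a b

/-- The ranks of a product decompose into products of ranks. -/
def plevelEquiv (n : ℕ) : D.plevel E n ≃
    (ij : Finset.HasAntidiagonal.antidiagonal n) × (D.level ij.1.1 × E.level ij.1.2) where
  toFun x := ⟨⟨(D.rk x.1.1, E.rk x.1.2), Finset.HasAntidiagonal.mem_antidiagonal.2 x.2⟩, ⟨x.1.1, rfl⟩, ⟨x.1.2, rfl⟩⟩
  invFun y := ⟨(y.2.1, y.2.2), by
    rw [y.2.1.2, y.2.2.2]
    exact Finset.HasAntidiagonal.mem_antidiagonal.1 y.1.2⟩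
  left_inv _ := rfl
  right_inv := by
    rintro ⟨⟨⟨i, j⟩, h⟩, (a : D.level i), (b : E.level j)⟩
    obtain ⟨a, rfl⟩ := a
    obtain ⟨b, rfl⟩ := b
    rfl

lemma p_prod (n : ℕ) :
    (D.prod E).p n = ∑ ij ∈ Finset.HasAntidiagonal.antidiagonal n, D.p ij.1 * E.p ij.2 := by
  have h := Fintype.card_congr (D.plevelEquiv E n)
  rw [Fintype.card_sigma] at h
  simp only [Fintype.card_prod] at h
  exact h.trans (Finset.sum_coe_sort (Finset.HasAntidiagonal.antidiagonal n) fun ij => D.p ij.1 * E.p ij.2)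

lemma two_le_p_two (T : DiffPoset 1) : 2 ≤ T.p 2 := by
  obtain ⟨⟨x, hx⟩, -⟩ := Fintype.card_eq_one_iff.1 T.p_one
  have h := T.d3 x
  have h₁ : {z | z ⋖ x} = {T.bot} := by
    ext z
    refine ⟨fun hz => T.eq_bot_of_rk_eq_zero_s6 ?_, ?_⟩
    · have := T.rk_covBy hz
      omega
    · rintro rfl
      exact T.bot_covBy_iff.2 hx
  rw [h₁, Set.ncard_singleton] at h
  rw [p_eq_ncard]
  refine h.ge.trans ?_
  exact Set.ncard_le_ncard (fun z hz => by
    have := T.rk_covBy hz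
    simp only [Set.mem_ofPred_eq]
    omega) (T.fiberFinite 2)

lemma p_prod_convex (hr : 0 < r) (hs : 0 < s)
    (hE : ∀ n, 2 * E.p (n + 1) ≤ E.p (n + 2) + E.p n) (n : ℕ) :
    2 * (D.prod E).p (n + 1) < (D.prod E).p (n + 2) + (D.prod E).p n := by
  set c : ℕ × ℕ → ℤ := fun ij =>
    D.p ij.1 * (E.p (ij.2 + 2) + E.p ij.2 - 2 * E.p (ij.2 + 1)) with hc
  have key : ((D.prod E).p (n + 2) + (D.prod E).p n - 2 * (D.prod E).p (n + 1) : ℤ) =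
      D.p (n + 2) + D.p (n + 1) * (s - 2) +
        ∑ ij ∈ Finset.HasAntidiagonal.antidiagonal n, c ij := by
    simp only [p_prod, Finset.Nat.sum_antidiagonal_succ', Nat.cast_sum, Nat.cast_add, Nat.cast_mul,
      E.p_zero, zero_add, E.p_one, hc, mul_add, mul_sub, Finset.sum_add_distrib,
      Finset.sum_sub_distrib, Finset.mul_sum, mul_left_comm, add_assoc, Nat.reduceAdd]
    push_cast
    ring
  have hc0 : ∀ ij, 0 ≤ c ij := fun ij => mul_nonneg (Int.natCast_nonneg _) (by
    have := hE ij.2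
    omega)
  have hpos := D.p_pos hr (n + 2)
  suffices h : 0 < D.p (n + 2) + D.p (n + 1) * (s - 2 : ℤ) +
      ∑ ij ∈ Finset.HasAntidiagonal.antidiagonal n, c ij by omega
  rcases (Nat.succ_le_of_lt hs).eq_or_lt with rfl | hs
  · have h₁ : c (n, 0) ≤ ∑ ij ∈ Finset.HasAntidiagonal.antidiagonal n, c ij :=
      Finset.single_le_sum (fun ij _ => hc0 ij)
        (Finset.HasAntidiagonal.mem_antidiagonal.2 (add_zero n))
    have h₂ : (D.p n : ℤ) ≤ c (n, 0) := by
      have := E.two_le_p_two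
      simp only [hc, zero_add, E.p_zero, E.p_one]
      refine le_mul_of_one_le_right (Int.natCast_nonneg _) ?_
      push_cast
      omega
    have := D.p_pos hr n
    have : D.p (n + 1) ≤ D.p (n + 2) := D.p_le_p_succ hr (n + 1)
    push_cast
    omega
  · have h₁ : 0 ≤ (D.p (n + 1) : ℤ) * (s - 2) := mul_nonneg (Int.natCast_nonneg _) (by omega)
    have h₂ := Finset.sum_nonneg fun ij (_ : ij ∈ Finset.HasAntidiagonal.antidiagonal n) => hc0 ij
    omega

end DiffPoset

end

/-- Let `P` be an `r`-differential poset and `Q` an `s`-differential poset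
such that `Δq_n ≥ Δq_{n−1}` for all `n ≥ 2` and all the down maps over `ℤ` of at least one of
the two posets are surjective. Then for every `n ≥ 0` the matrix `[DU_n] + x·I` of the
Cartesian product poset `P × Q` has Smith normal form over `ℤ[x]`. -/
theorem prod_du_hasSNF {r s : ℕ} (hr : 0 < r) (hs : 0 < s)
    (D : DiffPoset r) (E : DiffPoset s)
    (hq : ∀ n : ℕ, 2 ≤ n → (E.p (n - 1) : ℤ) - E.p (n - 2) ≤ (E.p n : ℤ) - E.p (n - 1))
    (hdown : (∀ n : ℕ, Function.Surjective (D.down ℤ n)) ∨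
      (∀ n : ℕ, Function.Surjective (E.down ℤ n))) :
    ∀ n : ℕ, Matrix.HasSNF' ((D.pduMatrix E ℤ n).map (C : ℤ → ℤ[X]) +
      (X : ℤ[X]) • (1 : Matrix (D.plevel E n) (D.plevel E n) ℤ[X])) := by
  intro n
  refine (D.prod E).hasSNF'_duMatrix (by omega) (D.prod_down_surjective E hdown)
    (D.p_prod_convex E hr hs fun n => ?_) n
  have := hq (n + 2) (by omega)
  simp only [Nat.add_sub_cancel, show n + 2 - 1 = n + 1 from rfl] at this
  omega
end
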